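/- Let α > 0 and let h : 𝕋 → ℂ be a twice continuously differentiable function on the torus 𝕋 = ℝ/ℤ. Then lim_{T→∞} [ (1/T) ∑_{0<γ≤T} h(αγ mod 1) − (N(T)/T) ∫₀¹ h(u) du ] = ∫₀¹ h(u) g_α(u) du. -/

import Mathlib

open Filter MeasureTheory Real Complex Set

open Classical in
/-- Multiplicity of a point as a zero of the Riemann zeta function. -/
noncomputable def zetaZeroMult (ρ : ℂ) : ℕ :=
  if h : AnalyticAt ℂ riemannZeta ρ then (analyticOrderAt riemannZeta ρ).toNat else 0

/-- Nontrivial zeros with imaginary part in `(0, T]`. -/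
def zetaZerosUpTo (T : ℝ) : Set ℂ :=
  {ρ : ℂ | riemannZeta ρ = 0 ∧ 0 < ρ.re ∧ ρ.re < 1 ∧ 0 < ρ.im ∧ ρ.im ≤ T}

/-- `N(T)`: number of nontrivial zeros with `0 < γ ≤ T`, counted with multiplicity. -/
noncomputable def zetaN (T : ℝ) : ℕ := ∑ᶠ ρ ∈ zetaZerosUpTo T, zetaZeroMult ρ

/-- Explicit density `g` when `α = a log p / (2 π q)`. -/
noncomputable def gPAQ (p a q : ℕ) (t : ℝ) : ℝ :=
  -(((p : ℝ) ^ ((a : ℝ) / 2) * Real.cos (2 * π * q * t) - 1) * Real.log p) /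
    (π * ((p : ℝ) ^ (a : ℝ) - 2 * (p : ℝ) ^ ((a : ℝ) / 2) * Real.cos (2 * π * q * t) + 1))

/-- `α` has the special form `a log p / (2 π q)` with `p` prime, `a, q` coprime positive. -/
def IsSpecialForm (α : ℝ) (p a q : ℕ) : Prop :=
  p.Prime ∧ 0 < a ∧ 0 < q ∧ Nat.Coprime a q ∧ α = a * Real.log p / (2 * π * q)

/-- `g` is the density `g_α` associated with `α`. -/
def IsDensityOf (α : ℝ) (g : ℝ → ℝ) : Prop :=
  (∀ p a q : ℕ, IsSpecialForm α p a q → g = gPAQ p a q) ∧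
    ((¬ ∃ p a q : ℕ, IsSpecialForm α p a q) → g = 0)

/-- Sum of `h(αγ)` over zeros with `0 < γ ≤ T`, with multiplicity; `h` is `1`-periodic so this
equals the sum of `h({αγ})`. -/
noncomputable def zetaZeroSum (α : ℝ) (h : ℝ → ℂ) (T : ℝ) : ℂ :=
  ∑ᶠ ρ ∈ zetaZerosUpTo T, (zetaZeroMult ρ : ℂ) * h (α * ρ.im)

/-- `h` is (a lift of) an absolutely continuous function on `𝕋 = ℝ/ℤ`, with derivative `h'`. -/
def IsAbsContTorus (h h' : ℝ → ℂ) : Prop :=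
  Function.Periodic h 1 ∧ Function.Periodic h' 1 ∧
    (∀ a b : ℝ, IntervalIntegrable h' volume a b) ∧
    ∀ y : ℝ, h y = h 0 + ∫ t in (0:ℝ)..y, h' t

/-- `L¹` modulus of continuity on the torus. -/
noncomputable def modCont (f : ℝ → ℂ) (δ : ℝ) : ℝ :=
  sSup ((fun u => ∫ t in (0:ℝ)..1, ‖f (t + u) - f t‖) '' Set.Icc (-δ) δ)

/-- `M_α(y;T)`. -/
noncomputable def Mfun (α y T : ℝ) : ℝ :=
  (1 / T) * (∑ᶠ ρ ∈ {ρ : ℂ | riemannZeta ρ = 0 ∧ 0 < ρ.re ∧ ρ.re < 1 ∧ 0 < ρ.im ∧ ρ.im ≤ T ∧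
      Int.fract (α * ρ.im) < y}, (zetaZeroMult ρ : ℝ)) - y * (zetaN T) / T

/-- Normalized discrepancy `D*_α(T)`. -/
noncomputable def Dstar (α T : ℝ) : ℝ :=
  sSup ((fun y => (T / (zetaN T)) * |Mfun α y T|) '' Set.Icc (0:ℝ) 1)

lemma fz_ibp2 {a b : ℝ} (hab : a ≤ b) {u u1 u2 v v1 v2 : ℝ → ℝ}
    (hu : ∀ x ∈ Icc a b, HasDerivAt u (u1 x) x) (hu1 : ∀ x ∈ Icc a b, HasDerivAt u1 (u2 x) x)
    (hv : ∀ x ∈ Icc a b, HasDerivAt v (v1 x) x) (hv1 : ∀ x ∈ Icc a b, HasDerivAt v1 (v2 x) x)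
    (hu2 : ContinuousOn u2 (Icc a b)) (hv2 : ContinuousOn v2 (Icc a b)) :
    ∫ x in a..b, u x * v2 x =
      ((u b * v1 b - u1 b * v b) - (u a * v1 a - u1 a * v a)) + ∫ x in a..b, u2 x * v x := by
  have hab' : uIcc a b = Icc a b := uIcc_of_le hab
  have i1 : IntervalIntegrable u1 volume a b :=
    ContinuousOn.intervalIntegrable (by rw [hab']; exact fun x hx => (hu1 x hx).continuousAt.continuousWithinAt)
  have i2 : IntervalIntegrable v1 volume a b :=
    ContinuousOn.intervalIntegrable (by rw [hab']; exact fun x hx => (hv1 x hx).continuousAt.continuousWithinAt)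
  have i3 : IntervalIntegrable u2 volume a b :=
    ContinuousOn.intervalIntegrable (by rwa [hab'])
  have i4 : IntervalIntegrable v2 volume a b :=
    ContinuousOn.intervalIntegrable (by rwa [hab'])
  rw [intervalIntegral.integral_mul_deriv_eq_deriv_mul (by rwa [hab']) (by rwa [hab']) i1 i4,
    intervalIntegral.integral_mul_deriv_eq_deriv_mul (u := u1) (v := v) (by rwa [hab']) (by rwa [hab']) i3 i2]
  ring

lemma fz_prod_xy {a b c d : ℝ} (hab : a ≤ b) (hcd : c ≤ d) {F : ℝ × ℝ → ℝ}
    (hF : IntegrableOn F (Icc a b ×ˢ Icc c d)) :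
    ∫ p in Icc a b ×ˢ Icc c d, F p = ∫ x in a..b, ∫ y in c..d, F (x, y) := by
  rw [intervalIntegral.integral_of_le hab, ← integral_Icc_eq_integral_Ioc,
    Measure.volume_eq_prod, setIntegral_prod _ (by rwa [← Measure.volume_eq_prod])]
  congr 1; ext x
  rw [intervalIntegral.integral_of_le hcd, ← integral_Icc_eq_integral_Ioc]

lemma fz_prod_yx {a b c d : ℝ} (hab : a ≤ b) (hcd : c ≤ d) {F : ℝ × ℝ → ℝ}
    (hF : IntegrableOn F (Icc a b ×ˢ Icc c d)) :
    ∫ p in Icc a b ×ˢ Icc c d, F p = ∫ y in c..d, ∫ x in a..b, F (x, y) := by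
  rw [fz_prod_xy hab hcd hF]
  refine MeasureTheory.intervalIntegral_intervalIntegral_swap (F := fun x y => F (x, y)) ?_
  rw [uIoc_of_le hab, uIoc_of_le hcd]
  exact hF.mono_set (prod_mono Ioc_subset_Icc_self Ioc_subset_Icc_self)

lemma fz_green_smooth {a b c d : ℝ} (hab : a ≤ b) (hcd : c ≤ d) {u ux uxx uy uyy : ℝ × ℝ → ℝ}
    {χ χ1 χ2 k k1 k2 : ℝ → ℝ}
    (hux : ∀ p ∈ Icc a b ×ˢ Icc c d, HasDerivAt (fun x => u (x, p.2)) (ux p) p.1)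
    (huxx : ∀ p ∈ Icc a b ×ˢ Icc c d, HasDerivAt (fun x => ux (x, p.2)) (uxx p) p.1)
    (huy : ∀ p ∈ Icc a b ×ˢ Icc c d, HasDerivAt (fun y => u (p.1, y)) (uy p) p.2)
    (huyy : ∀ p ∈ Icc a b ×ˢ Icc c d, HasDerivAt (fun y => uy (p.1, y)) (uyy p) p.2)
    (cu : ContinuousOn u (Icc a b ×ˢ Icc c d)) (cuxx : ContinuousOn uxx (Icc a b ×ˢ Icc c d))
    (cuyy : ContinuousOn uyy (Icc a b ×ˢ Icc c d))
    (hχ : ∀ x, HasDerivAt χ (χ1 x) x) (hχ1 : ∀ x, HasDerivAt χ1 (χ2 x) x) (cχ2 : Continuous χ2)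
    (hk : ∀ x, HasDerivAt k (k1 x) x) (hk1 : ∀ x, HasDerivAt k1 (k2 x) x) (ck2 : Continuous k2)
    (kc : k c = 0) (kd : k d = 0) (k1c : k1 c = 0) (k1d : k1 d = 0) :
    ∫ p in Icc a b ×ˢ Icc c d, u p * (χ p.1 * k2 p.2 + χ2 p.1 * k p.2) =
      (∫ p in Icc a b ×ˢ Icc c d, (uxx p + uyy p) * (χ p.1 * k p.2)) +
      ∫ y in c..d, k y * ((u (b, y) * χ1 b - ux (b, y) * χ b) - (u (a, y) * χ1 a - ux (a, y) * χ a)) := by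
  have cχ : Continuous χ := continuous_iff_continuousAt.2 fun x => (hχ x).continuousAt
  have ck : Continuous k := continuous_iff_continuousAt.2 fun x => (hk x).continuousAt
  have hK : IsCompact (Icc a b ×ˢ Icc c d) := isCompact_Icc.prod isCompact_Icc
  have I1 : IntegrableOn (fun p => u p * (χ p.1 * k2 p.2)) (Icc a b ×ˢ Icc c d) :=
    ContinuousOn.integrableOn_compact hK (cu.mul (by fun_prop))
  have I2 : IntegrableOn (fun p => u p * (χ2 p.1 * k p.2)) (Icc a b ×ˢ Icc c d) :=
    ContinuousOn.integrableOn_compact hK (cu.mul (by fun_prop))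
  have I3 : IntegrableOn (fun p => uxx p * (χ p.1 * k p.2)) (Icc a b ×ˢ Icc c d) :=
    ContinuousOn.integrableOn_compact hK (cuxx.mul (by fun_prop))
  have I4 : IntegrableOn (fun p => uyy p * (χ p.1 * k p.2)) (Icc a b ×ˢ Icc c d) :=
    ContinuousOn.integrableOn_compact hK (cuyy.mul (by fun_prop))
  simp only [mul_add, add_mul]
  rw [integral_add I1 I2, integral_add I3 I4]
  have E1 : ∫ p in Icc a b ×ˢ Icc c d, u p * (χ p.1 * k2 p.2) =
      ∫ p in Icc a b ×ˢ Icc c d, uyy p * (χ p.1 * k p.2) := by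
    rw [fz_prod_xy hab hcd I1, fz_prod_xy hab hcd I4]
    refine intervalIntegral.integral_congr fun x hx => ?_
    rw [uIcc_of_le hab] at hx
    have := fz_ibp2 hcd (u := fun y => u (x, y)) (u1 := fun y => uy (x, y))
      (u2 := fun y => uyy (x, y)) (v := k) (v1 := k1) (v2 := k2)
      (fun y hy => huy (x, y) ⟨hx, hy⟩) (fun y hy => huyy (x, y) ⟨hx, hy⟩)
      (fun y _ => hk y) (fun y _ => hk1 y)
      (cuyy.comp (by fun_prop) (fun y hy => ⟨hx, hy⟩)) ck2.continuousOn
    rw [kc, kd, k1c, k1d] at this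
    simp only [mul_zero, sub_zero, zero_add] at this
    simp only [mul_left_comm _ (χ x)]
    rw [intervalIntegral.integral_const_mul, intervalIntegral.integral_const_mul, this]
  have E2 : ∫ p in Icc a b ×ˢ Icc c d, u p * (χ2 p.1 * k p.2) =
      (∫ p in Icc a b ×ˢ Icc c d, uxx p * (χ p.1 * k p.2)) +
      ∫ y in c..d, k y * ((u (b, y) * χ1 b - ux (b, y) * χ b) - (u (a, y) * χ1 a - ux (a, y) * χ a)) := by
    have key : ∀ y ∈ Icc c d, ∫ x in a..b, u (x, y) * (χ2 x * k y) =
        (∫ x in a..b, uxx (x, y) * (χ x * k y)) + k y * ((u (b, y) * χ1 b - ux (b, y) * χ b) - (u (a, y) * χ1 a - ux (a, y) * χ a)) := by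
      intro y hy
      have := fz_ibp2 hab (u := fun x => u (x, y)) (u1 := fun x => ux (x, y))
        (u2 := fun x => uxx (x, y)) (v := χ) (v1 := χ1) (v2 := χ2)
        (fun x hx => hux (x, y) ⟨hx, hy⟩) (fun x hx => huxx (x, y) ⟨hx, hy⟩)
        (fun y _ => hχ y) (fun y _ => hχ1 y)
        (cuxx.comp (by fun_prop) (fun x hx => ⟨hx, hy⟩)) cχ2.continuousOn
      simp only [← mul_assoc]
      rw [intervalIntegral.integral_mul_const, intervalIntegral.integral_mul_const, this]
      ring
    have J1 : IntervalIntegrable (fun y => ∫ x in a..b, u (x, y) * (χ2 x * k y)) volume c d := by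
      rw [intervalIntegrable_iff_integrableOn_Icc_of_le hcd]
      have := I2
      rw [IntegrableOn, Measure.volume_eq_prod, ← Measure.prod_restrict] at this
      have := this.integral_prod_right
      simpa only [intervalIntegral.integral_of_le hab, integral_Icc_eq_integral_Ioc, IntegrableOn] using this
    have J2 : IntervalIntegrable (fun y => ∫ x in a..b, uxx (x, y) * (χ x * k y)) volume c d := by
      rw [intervalIntegrable_iff_integrableOn_Icc_of_le hcd]
      have := I3
      rw [IntegrableOn, Measure.volume_eq_prod, ← Measure.prod_restrict] at this
      have := this.integral_prod_right
      simpa only [intervalIntegral.integral_of_le hab, integral_Icc_eq_integral_Ioc, IntegrableOn] using this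
    rw [fz_prod_yx hab hcd I2, fz_prod_yx hab hcd I3, ← sub_eq_iff_eq_add',
      ← intervalIntegral.integral_sub J1 J2]
    refine intervalIntegral.integral_congr fun y hy => ?_
    rw [uIcc_of_le hcd] at hy
    simp only [key y hy]
    ring
  rw [E1, E2]; ring

lemma fz_ker_integral : ∫ z : ℝ × ℝ, 1 / (π * (1 + z.1 ^ 2 + z.2 ^ 2) ^ 2) = 1 := by
  rw [← integral_comp_polarCoord_symm]
  have e : ∀ p : ℝ × ℝ, p.1 • (1 / (π * (1 + (polarCoord.symm p).1 ^ 2 + (polarCoord.symm p).2 ^ 2) ^ 2))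
      = (p.1 / (1 + p.1 ^ 2) ^ 2) * (1 / π) := by
    intro p
    simp only [polarCoord_symm_apply, smul_eq_mul]
    have : 1 + (p.1 * Real.cos p.2) ^ 2 + (p.1 * Real.sin p.2) ^ 2 = 1 + p.1 ^ 2 := by
      have := Real.sin_sq_add_cos_sq p.2
      linear_combination p.1 ^ 2 * this
    rw [this]
    have : (1 + p.1 ^ 2) ≠ 0 := by positivity
    field_simp
  simp only [e]
  rw [polarCoord_target, Measure.volume_eq_prod, setIntegral_prod_mul (fun r : ℝ => r / (1 + r ^ 2) ^ 2) (fun _ => 1 / π)]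
  have : ∫ r in Ioi (0:ℝ), r / (1 + r ^ 2) ^ 2 = 0 - (-1/2 * (1 + (0:ℝ) ^ 2)⁻¹) := by
    refine integral_Ioi_of_hasDerivAt_of_nonneg' (g := fun r => -1/2 * (1 + r ^ 2)⁻¹) ?_ ?_ ?_
    · intro x _
      have h1 : (1 + x ^ 2) ≠ 0 := by positivity
      have := (((hasDerivAt_pow 2 x).const_add 1).inv h1).const_mul (-1/2 : ℝ)
      refine HasDerivAt.congr_deriv (f := fun r : ℝ => -1/2 * (1 + r ^ 2)⁻¹) this ?_
      push_cast
      ring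
    · intro x hx
      have : (0:ℝ) < x := hx
      positivity
    · have : Tendsto (fun r : ℝ => 1 + r ^ 2) atTop atTop :=
        tendsto_atTop_add_const_left _ _ (tendsto_pow_atTop two_ne_zero)
      simpa using this.inv_tendsto_atTop.const_mul (-1/2 : ℝ)
  rw [this]
  simp
  field_simp
  rw [max_eq_left (by positivity)]; ring

lemma fz_ker_tendsto {φ : ℝ × ℝ → ℝ} (hφ : Continuous φ) (hs : HasCompactSupport φ) (q : ℝ × ℝ) :
    Tendsto (fun c : ℝ => ∫ p, (2 * c⁻¹ ^ 2 / ((p.1 - q.1) ^ 2 + (p.2 - q.2) ^ 2 + c⁻¹ ^ 2) ^ 2) * φ p) atTop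
      (nhds (2 * π * φ q)) := by
  have hI : Integrable (fun z => 2 * π * φ (z + q)) :=
    ((hφ.integrable_of_hasCompactSupport hs).comp_add_right q).const_mul _
  have := tendsto_integral_comp_smul_smul_of_integrable (μ := (volume : Measure (ℝ × ℝ)))
    (φ := fun z => 1 / (π * (1 + z.1 ^ 2 + z.2 ^ 2) ^ 2)) (fun x => by positivity) fz_ker_integral ?_
    hI (by fun_prop)
  · simp only [zero_add] at this
    refine this.congr' ?_
    filter_upwards [eventually_gt_atTop 0] with c hc
    rw [← integral_add_right_eq_self (μ := (volume : Measure (ℝ × ℝ))) (fun p => (2 * c⁻¹ ^ 2 / ((p.1 - q.1) ^ 2 + (p.2 - q.2) ^ 2 + c⁻¹ ^ 2) ^ 2) * φ p) q]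
    congr 1; ext z
    simp only [Prod.fst_add, Prod.snd_add, add_sub_cancel_right, Prod.smul_fst, Prod.smul_snd, smul_eq_mul, Module.finrank_prod, Module.finrank_self]
    have e1 : (z.1 ^ 2 + z.2 ^ 2 + c⁻¹ ^ 2) = c⁻¹ ^ 2 * (1 + (c * z.1) ^ 2 + (c * z.2) ^ 2) := by
      field_simp; ring
    rw [e1]
    have e2 : (1 + (c * z.1) ^ 2 + (c * z.2) ^ 2) ≠ 0 := by positivity
    have hp : π ≠ 0 := pi_ne_zero
    generalize (1 + (c * z.1) ^ 2 + (c * z.2) ^ 2) = X at e2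
    field_simp
    norm_num
    ring
  · simp only [Module.finrank_prod, Module.finrank_self]
    have h1 : Tendsto (fun x : ℝ × ℝ => (1 + ‖x‖ ^ 2)⁻¹) (Bornology.cobounded (ℝ × ℝ)) (nhds 0) := by
      apply Tendsto.inv_tendsto_atTop
      exact tendsto_atTop_add_const_left _ _ ((tendsto_pow_atTop two_ne_zero).comp tendsto_norm_cobounded_atTop)
    refine squeeze_zero (fun x => by positivity) (fun x => ?_) h1
    have h2 : ‖x‖ ^ 2 ≤ x.1 ^ 2 + x.2 ^ 2 := by
      rw [Prod.norm_def]
      rcases max_cases ‖x.1‖ ‖x.2‖ with h | h <;> rw [h.1] <;> simp [sq_abs] <;> positivity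
    have h3 : (1 : ℝ) ≤ π := by linarith [pi_gt_three]
    rw [mul_one_div, ← one_div, div_le_div_iff₀ (by positivity) (by positivity)]
    have h4 : (1 + ‖x‖ ^ 2) ^ 2 ≤ (1 + x.1 ^ 2 + x.2 ^ 2) ^ 2 := by
      apply pow_le_pow_left₀ (by positivity); linarith
    have h5 : ‖x‖ ^ (1 + 1) * (1 + ‖x‖ ^ 2) ≤ (1 + ‖x‖ ^ 2) ^ 2 := by
      have := sq_nonneg ‖x‖
      generalize ‖x‖ = w at this
      have e : w ^ (1 + 1) = w ^ 2 := rfl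
      rw [e]; nlinarith
    have h6 : (1 + x.1 ^ 2 + x.2 ^ 2) ^ 2 ≤ π * (1 + x.1 ^ 2 + x.2 ^ 2) ^ 2 :=
      le_mul_of_one_le_left (by positivity) h3
    linarith

/-- A one-dimensional C² test function on `[a,b]` vanishing to second order at the ends. -/
structure FZTest (a b : ℝ) (χ χ1 χ2 : ℝ → ℝ) : Prop where
  d0 : ∀ x, HasDerivAt χ (χ1 x) x
  d1 : ∀ x, HasDerivAt χ1 (χ2 x) x
  c2 : Continuous χ2
  za : χ a = 0
  zb : χ b = 0
  z1a : χ1 a = 0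
  z1b : χ1 b = 0

namespace FZTest
variable {a b : ℝ} {χ χ1 χ2 : ℝ → ℝ}
lemma c0 (h : FZTest a b χ χ1 χ2) : Continuous χ := continuous_iff_continuousAt.2 fun x => (h.d0 x).continuousAt
lemma c1 (h : FZTest a b χ χ1 χ2) : Continuous χ1 := continuous_iff_continuousAt.2 fun x => (h.d1 x).continuousAt
end FZTest

lemma fz_ae_fst_ne (β : ℝ) (s : Set (ℝ × ℝ)) : ∀ᵐ p ∂(volume.restrict s : Measure (ℝ × ℝ)), p.1 ≠ β := by
  apply ae_restrict_of_ae
  rw [Measure.volume_eq_prod]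
  have : ∀ᵐ x : ℝ, x ≠ β := by
    simp [ae_iff]
  exact Measure.quasiMeasurePreserving_fst.ae this

lemma fz_logr_bound {x y : ℝ} (hx : x ≠ 0) {e : ℝ} (he : 0 ≤ e) (he1 : e ≤ 1) :
    |1 / 2 * Real.log (x ^ 2 + y ^ 2 + e)| ≤ |Real.log x| + (x ^ 2 + y ^ 2 + 1) := by
  have hx2 : 0 < x ^ 2 := by positivity
  have hy2 : 0 ≤ y ^ 2 := by positivity
  have h1 : Real.log (x ^ 2) ≤ Real.log (x ^ 2 + y ^ 2 + e) := Real.log_le_log hx2 (by linarith)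
  have h2 : Real.log (x ^ 2 + y ^ 2 + e) ≤ (x ^ 2 + y ^ 2 + e) - 1 := Real.log_le_sub_one_of_pos (by linarith)
  rw [Real.log_pow] at h1
  push_cast at h1
  have h3 := neg_abs_le (Real.log x)
  rw [abs_le]
  constructor
  · linarith
  · have := abs_nonneg (Real.log x)
    linarith

lemma fz_logker_int {a b c d : ℝ} (β γ : ℝ) :
    IntegrableOn (fun p : ℝ × ℝ => |Real.log (p.1 - β)| + ((p.1 - β) ^ 2 + (p.2 - γ) ^ 2 + 1)) (Icc a b ×ˢ Icc c d) := by
  rcases le_or_gt a b with hab | hab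
  swap
  · simp [Icc_eq_empty (not_le.2 hab)]
  refine Integrable.add ?_ (ContinuousOn.integrableOn_compact (isCompact_Icc.prod isCompact_Icc) (by fun_prop))
  rw [Measure.volume_eq_prod, ← Measure.prod_restrict]
  have h := (intervalIntegral.intervalIntegrable_log' (a := a - β) (b := b - β)).comp_sub_right β
  simp only [sub_add_cancel] at h
  rw [intervalIntegrable_iff_integrableOn_Icc_of_le hab] at h
  exact Integrable.comp_fst h.abs _

lemma fz_logker {a b c d : ℝ} (hab : a ≤ b) (hcd : c ≤ d) {χ χ1 χ2 k k1 k2 : ℝ → ℝ}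
    (hχ : FZTest a b χ χ1 χ2) (hk : FZTest c d k k1 k2) (β γ : ℝ) :
    ∫ p in Icc a b ×ˢ Icc c d, (1 / 2 * Real.log ((p.1 - β) ^ 2 + (p.2 - γ) ^ 2)) * (χ p.1 * k2 p.2 + χ2 p.1 * k p.2) =
      2 * π * (Icc a b ×ˢ Icc c d).indicator (fun p => χ p.1 * k p.2) (β, γ) := by
  have cχ := hχ.c0
  have ck := hk.c0
  have cχ2 := hχ.c2
  have ck2 := hk.c2
  have hsupp : HasCompactSupport ((Icc a b ×ˢ Icc c d).indicator (fun p : ℝ × ℝ => χ p.1 * k p.2)) := by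
    refine HasCompactSupport.intro (isCompact_Icc.prod (isCompact_Icc : IsCompact (Icc c d)) : IsCompact (Icc a b ×ˢ Icc c d)) ?_
    intro p hp
    exact indicator_of_notMem hp _
  have hcts : Continuous ((Icc a b ×ˢ Icc c d).indicator (fun p : ℝ × ℝ => χ p.1 * k p.2)) := by
    refine continuous_indicator ?_ (by fun_prop)
    intro p hp
    rw [frontier_prod_eq, frontier_Icc hab, frontier_Icc hcd] at hp
    rcases hp with h | h
    · rcases h.2 with h | h <;> rw [h] <;> simp [hk.za, hk.zb]
    · rcases h.1 with h | h <;> rw [h] <;> simp [hχ.za, hχ.zb]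
  have R := fz_ker_tendsto hcts hsupp (β, γ)
  simp only at R
  have Ldef : Tendsto (fun e : ℝ => ∫ p in Icc a b ×ˢ Icc c d, (1 / 2 * Real.log ((p.1 - β) ^ 2 + (p.2 - γ) ^ 2 + e⁻¹ ^ 2)) * (χ p.1 * k2 p.2 + χ2 p.1 * k p.2)) atTop
      (nhds (∫ p in Icc a b ×ˢ Icc c d, (1 / 2 * Real.log ((p.1 - β) ^ 2 + (p.2 - γ) ^ 2)) * (χ p.1 * k2 p.2 + χ2 p.1 * k p.2))) := by
    obtain ⟨B, hB⟩ := (isCompact_Icc.prod (isCompact_Icc : IsCompact (Icc c d)) : IsCompact (Icc a b ×ˢ Icc c d)).exists_bound_of_continuousOn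
      (f := fun p : ℝ × ℝ => χ p.1 * k2 p.2 + χ2 p.1 * k p.2) (by fun_prop)
    refine tendsto_integral_filter_of_dominated_convergence
      (fun p => (|Real.log (p.1 - β)| + ((p.1 - β) ^ 2 + (p.2 - γ) ^ 2 + 1)) * B) ?_ ?_ ?_ ?_
    · filter_upwards with e
      apply Measurable.aestronglyMeasurable
      fun_prop
    · filter_upwards [eventually_ge_atTop 1] with e he
      filter_upwards [fz_ae_fst_ne β (Icc a b ×ˢ Icc c d), ae_restrict_mem (measurableSet_Icc.prod measurableSet_Icc)] with p hp hp2
      rw [norm_mul, Real.norm_eq_abs]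
      refine mul_le_mul (fz_logr_bound (sub_ne_zero.2 hp) (by positivity) ?_) (hB p hp2) (norm_nonneg _) (by positivity)
      exact pow_le_one₀ (by positivity) (inv_le_one_of_one_le₀ he)
    · exact (fz_logker_int β γ).mul_const B
    · filter_upwards [fz_ae_fst_ne β (Icc a b ×ˢ Icc c d)] with p hp
      refine Tendsto.mul_const _ (Tendsto.const_mul _ ?_)
      have hpos : 0 < (p.1 - β) ^ 2 := by have := sub_ne_zero.2 hp; positivity
      have hne : (p.1 - β) ^ 2 + (p.2 - γ) ^ 2 ≠ 0 := by positivity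
      refine (Real.continuousAt_log hne).tendsto.comp ?_
      have := (((tendsto_inv_atTop_zero (𝕜 := ℝ)).pow 2).const_add ((p.1 - β) ^ 2 + (p.2 - γ) ^ 2))
      simpa using this
  refine tendsto_nhds_unique Ldef (R.congr' ?_)
  filter_upwards [eventually_ge_atTop 1] with e he
  have hr : ∀ p : ℝ × ℝ, 0 < (p.1 - β) ^ 2 + (p.2 - γ) ^ 2 + e⁻¹ ^ 2 := fun p => by positivity
  have G := fz_green_smooth hab hcd (χ := χ) (χ1 := χ1) (χ2 := χ2) (k := k) (k1 := k1) (k2 := k2)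
    (u := fun p => 1 / 2 * Real.log ((p.1 - β) ^ 2 + (p.2 - γ) ^ 2 + e⁻¹ ^ 2))
    (ux := fun p => (p.1 - β) / ((p.1 - β) ^ 2 + (p.2 - γ) ^ 2 + e⁻¹ ^ 2))
    (uy := fun p => (p.2 - γ) / ((p.1 - β) ^ 2 + (p.2 - γ) ^ 2 + e⁻¹ ^ 2))
    (uxx := fun p => (((p.1 - β) ^ 2 + (p.2 - γ) ^ 2 + e⁻¹ ^ 2) - 2 * (p.1 - β) ^ 2) / ((p.1 - β) ^ 2 + (p.2 - γ) ^ 2 + e⁻¹ ^ 2) ^ 2)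
    (uyy := fun p => (((p.1 - β) ^ 2 + (p.2 - γ) ^ 2 + e⁻¹ ^ 2) - 2 * (p.2 - γ) ^ 2) / ((p.1 - β) ^ 2 + (p.2 - γ) ^ 2 + e⁻¹ ^ 2) ^ 2)
    ?_ ?_ ?_ ?_ ?_ ?_ ?_ hχ.d0 hχ.d1 hχ.c2 hk.d0 hk.d1 hk.c2 hk.za hk.zb hk.z1a hk.z1b
  · simp only at G
    rw [G]
    simp only [hχ.za, hχ.zb, hχ.z1a, hχ.z1b, mul_zero, sub_zero,
      intervalIntegral.integral_zero, add_zero]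
    rw [← integral_indicator (measurableSet_Icc.prod measurableSet_Icc)]
    congr 1; ext p
    by_cases hp : p ∈ Icc a b ×ˢ Icc c d
    · rw [indicator_of_mem hp, indicator_of_mem hp]
      congr 1
      rw [← add_div]
      congr 1
      ring
    · rw [indicator_of_notMem hp, indicator_of_notMem hp, mul_zero]
  · intro p _
    have h1 : HasDerivAt (fun x => (x - β) ^ 2 + (p.2 - γ) ^ 2 + e⁻¹ ^ 2) (2 * (p.1 - β)) p.1 := by
      have := (((((hasDerivAt_id p.1).sub_const β).pow 2).add_const ((p.2 - γ) ^ 2)).add_const (e⁻¹ ^ 2))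
      refine HasDerivAt.congr_deriv this ?_
      simp
    have h2 := (h1.log (hr p).ne').const_mul (1/2:ℝ)
    refine HasDerivAt.congr_deriv h2 ?_
    have := (hr p).ne'
    field_simp
  · intro p _
    have h1 : HasDerivAt (fun x => (x - β) ^ 2 + (p.2 - γ) ^ 2 + e⁻¹ ^ 2) (2 * (p.1 - β)) p.1 := by
      have := (((((hasDerivAt_id p.1).sub_const β).pow 2).add_const ((p.2 - γ) ^ 2)).add_const (e⁻¹ ^ 2))
      refine HasDerivAt.congr_deriv this ?_
      simp
    have h2 := ((hasDerivAt_id p.1).sub_const β).div h1 (hr p).ne'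
    refine HasDerivAt.congr_deriv h2 ?_
    simp only [id]
    ring
  · intro p _
    have h1 : HasDerivAt (fun y => (p.1 - β) ^ 2 + (y - γ) ^ 2 + e⁻¹ ^ 2) (2 * (p.2 - γ)) p.2 := by
      have := (((((hasDerivAt_id p.2).sub_const γ).pow 2).const_add ((p.1 - β) ^ 2)).add_const (e⁻¹ ^ 2))
      refine HasDerivAt.congr_deriv this ?_
      simp
    have h2 := (h1.log (hr p).ne').const_mul (1/2:ℝ)
    refine HasDerivAt.congr_deriv h2 ?_
    have := (hr p).ne'
    field_simp
  · intro p _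
    have h1 : HasDerivAt (fun y => (p.1 - β) ^ 2 + (y - γ) ^ 2 + e⁻¹ ^ 2) (2 * (p.2 - γ)) p.2 := by
      have := (((((hasDerivAt_id p.2).sub_const γ).pow 2).const_add ((p.1 - β) ^ 2)).add_const (e⁻¹ ^ 2))
      refine HasDerivAt.congr_deriv this ?_
      simp
    have h2 := ((hasDerivAt_id p.2).sub_const γ).div h1 (hr p).ne'
    refine HasDerivAt.congr_deriv h2 ?_
    simp only [id]
    ring
  · exact ContinuousOn.const_smul (ContinuousOn.log (by fun_prop) fun p _ => (hr p).ne') (1/2 : ℝ)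
  · exact ContinuousOn.div (by fun_prop) (by fun_prop) fun p _ => (pow_pos (hr p) 2).ne'
  · exact ContinuousOn.div (by fun_prop) (by fun_prop) fun p _ => (pow_pos (hr p) 2).ne'

lemma fz_d_re_x {F : ℂ → ℂ} {F' : ℂ} {x y : ℝ} (h : HasDerivAt F F' (x + y * I)) :
    HasDerivAt (fun t : ℝ => (F (t + y * I)).re) F'.re x := by
  have h1 : HasDerivAt (fun t : ℝ => ((t : ℂ) + y * I)) 1 x := (Complex.ofRealCLM.hasDerivAt (x := x)).add_const _
  have h2 := HasDerivAt.scomp (g₁ := F) x h h1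
  have h3 := (Complex.reCLM.hasFDerivAt).comp_hasDerivAt x h2
  exact HasDerivAt.congr_deriv h3 (by simp)

lemma fz_d_im_x {F : ℂ → ℂ} {F' : ℂ} {x y : ℝ} (h : HasDerivAt F F' (x + y * I)) :
    HasDerivAt (fun t : ℝ => (F (t + y * I)).im) F'.im x := by
  have h1 : HasDerivAt (fun t : ℝ => ((t : ℂ) + y * I)) 1 x := (Complex.ofRealCLM.hasDerivAt (x := x)).add_const _
  have h2 := HasDerivAt.scomp (g₁ := F) x h h1
  have h3 := (Complex.imCLM.hasFDerivAt).comp_hasDerivAt x h2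
  exact HasDerivAt.congr_deriv h3 (by simp)

lemma fz_d_re_y {F : ℂ → ℂ} {F' : ℂ} {x y : ℝ} (h : HasDerivAt F F' (x + y * I)) :
    HasDerivAt (fun t : ℝ => (F (x + t * I)).re) (-F'.im) y := by
  have h1 : HasDerivAt (fun t : ℝ => ((x : ℂ) + t * I)) I y := by
    simpa using ((Complex.ofRealCLM.hasDerivAt (x := y)).mul_const I).const_add (x : ℂ)
  have h2 := HasDerivAt.scomp (g₁ := F) y h h1
  have h3 := (Complex.reCLM.hasFDerivAt).comp_hasDerivAt y h2
  exact HasDerivAt.congr_deriv h3 (by simp)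

lemma fz_d_im_y {F : ℂ → ℂ} {F' : ℂ} {x y : ℝ} (h : HasDerivAt F F' (x + y * I)) :
    HasDerivAt (fun t : ℝ => (F (x + t * I)).im) (F'.re) y := by
  have h1 : HasDerivAt (fun t : ℝ => ((x : ℂ) + t * I)) I y := by
    simpa using ((Complex.ofRealCLM.hasDerivAt (x := y)).mul_const I).const_add (x : ℂ)
  have h2 := HasDerivAt.scomp (g₁ := F) y h h1
  have h3 := (Complex.imCLM.hasFDerivAt).comp_hasDerivAt y h2
  exact HasDerivAt.congr_deriv h3 (by simp)

/-- local logarithm -/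
lemma fz_local_log {g : ℂ → ℂ} {g' z0 : ℂ} (h : HasDerivAt g g' z0) (h0 : g z0 ≠ 0) :
    ∃ L : ℂ → ℂ, HasDerivAt L (g' / g z0) z0 ∧ ∀ᶠ z in nhds z0, (L z).re = Real.log ‖g z‖ := by
  refine ⟨fun z => Complex.log (g z / g z0) + Real.log ‖g z0‖, ?_, ?_⟩
  · have h1 : HasDerivAt (fun z => g z / g z0) (g' / g z0) z0 := h.div_const _
    have h2 := h1.clog (by simp [h0])
    simp only [div_self h0, div_one] at h2
    exact h2.add_const _
  · filter_upwards [h.continuousAt.eventually_ne h0] with z hz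
    simp only [add_re, log_re, ofReal_re, norm_div]
    rw [Real.log_div (by simpa using hz) (by simpa using h0)]
    ring

lemma fz_logn_x {g : ℂ → ℂ} {g' : ℂ} {x y : ℝ} (h : HasDerivAt g g' (x + y * I)) (h0 : g (x + y * I) ≠ 0) :
    HasDerivAt (fun t : ℝ => Real.log ‖g (t + y * I)‖) (g' / g (x + y * I)).re x := by
  obtain ⟨L, hL, hL2⟩ := fz_local_log h h0
  refine (fz_d_re_x hL).congr_of_eventuallyEq ?_
  have : Tendsto (fun t : ℝ => ((t : ℂ) + y * I)) (nhds x) (nhds (x + y * I)) :=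
    Continuous.tendsto (by fun_prop) x
  filter_upwards [this.eventually hL2] with t ht using ht.symm

lemma fz_logn_y {g : ℂ → ℂ} {g' : ℂ} {x y : ℝ} (h : HasDerivAt g g' (x + y * I)) (h0 : g (x + y * I) ≠ 0) :
    HasDerivAt (fun t : ℝ => Real.log ‖g (x + t * I)‖) (-(g' / g (x + y * I)).im) y := by
  obtain ⟨L, hL, hL2⟩ := fz_local_log h h0
  refine (fz_d_re_y hL).congr_of_eventuallyEq ?_
  have : Tendsto (fun t : ℝ => ((x : ℂ) + t * I)) (nhds y) (nhds (x + y * I)) :=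
    Continuous.tendsto (by fun_prop) y
  filter_upwards [this.eventually hL2] with t ht using ht.symm

lemma fz_mem_rect {a b c d : ℝ} {p : ℝ × ℝ} (hp : p ∈ Icc a b ×ˢ Icc c d) :
    (p.1 + p.2 * I : ℂ) ∈ Icc a b ×ℂ Icc c d := by
  rw [mem_prod] at hp
  simpa [mem_reProdIm] using hp

/-- Green identity for `log ‖g‖`, `g` analytic and nonvanishing on a neighbourhood of a rectangle. -/
lemma fz_green_nv {a b c d : ℝ} (hab : a ≤ b) (hcd : c ≤ d) {χ χ1 χ2 k k1 k2 : ℝ → ℝ} {g : ℂ → ℂ}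
    (hg : AnalyticOnNhd ℂ g (Icc a b ×ℂ Icc c d)) (hg0 : ∀ z ∈ Icc a b ×ℂ Icc c d, g z ≠ 0)
    (hχ : ∀ x, HasDerivAt χ (χ1 x) x) (hχ1 : ∀ x, HasDerivAt χ1 (χ2 x) x) (cχ2 : Continuous χ2)
    (hk : FZTest c d k k1 k2) :
    ∫ p in Icc a b ×ˢ Icc c d, Real.log ‖g (p.1 + p.2 * I)‖ * (χ p.1 * k2 p.2 + χ2 p.1 * k p.2) =
      ∫ y in c..d, k y * ((Real.log ‖g (b + y * I)‖ * χ1 b - (deriv g (b + y * I) / g (b + y * I)).re * χ b) -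
        (Real.log ‖g (a + y * I)‖ * χ1 a - (deriv g (a + y * I) / g (a + y * I)).re * χ a)) := by
  have hL : AnalyticOnNhd ℂ (fun z => deriv g z / g z) (Icc a b ×ℂ Icc c d) := hg.deriv.div hg hg0
  have hcont : Continuous (fun p : ℝ × ℝ => (p.1 + p.2 * I : ℂ)) := by fun_prop
  have hmaps : MapsTo (fun p : ℝ × ℝ => (p.1 + p.2 * I : ℂ)) (Icc a b ×ˢ Icc c d) (Icc a b ×ℂ Icc c d) :=
    fun p hp => fz_mem_rect hp
  have G := fz_green_smooth hab hcd (χ := χ) (χ1 := χ1) (χ2 := χ2) (k := k) (k1 := k1) (k2 := k2)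
    (u := fun p => Real.log ‖g (p.1 + p.2 * I)‖)
    (ux := fun p => (deriv g (p.1 + p.2 * I) / g (p.1 + p.2 * I)).re)
    (uy := fun p => -(deriv g (p.1 + p.2 * I) / g (p.1 + p.2 * I)).im)
    (uxx := fun p => (deriv (fun z => deriv g z / g z) (p.1 + p.2 * I)).re)
    (uyy := fun p => -(deriv (fun z => deriv g z / g z) (p.1 + p.2 * I)).re)
    ?_ ?_ ?_ ?_ ?_ ?_ ?_ hχ hχ1 cχ2 hk.d0 hk.d1 hk.c2 hk.za hk.zb hk.z1a hk.z1b
  · simpa using G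
  · intro p hp
    exact fz_logn_x (hg _ (fz_mem_rect hp)).differentiableAt.hasDerivAt (hg0 _ (fz_mem_rect hp))
  · intro p hp
    exact fz_d_re_x (F := fun z => deriv g z / g z) (hL _ (fz_mem_rect hp)).differentiableAt.hasDerivAt
  · intro p hp
    exact fz_logn_y (hg _ (fz_mem_rect hp)).differentiableAt.hasDerivAt (hg0 _ (fz_mem_rect hp))
  · intro p hp
    exact (fz_d_im_y (F := fun z => deriv g z / g z) (hL _ (fz_mem_rect hp)).differentiableAt.hasDerivAt).neg
  · refine ContinuousOn.log ((hg.continuousOn.comp hcont.continuousOn hmaps).norm) ?_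
    intro p hp
    simpa using hg0 _ (fz_mem_rect hp)
  · exact Complex.continuous_re.comp_continuousOn (hL.deriv.continuousOn.comp hcont.continuousOn hmaps)
  · exact (Complex.continuous_re.comp_continuousOn (hL.deriv.continuousOn.comp hcont.continuousOn hmaps)).neg

lemma fz_ae_rect {a b c d : ℝ} {P : ℂ → Prop}
    (h : ∀ᶠ z in codiscreteWithin (Icc a b ×ℂ Icc c d), P z) :
    ∀ᵐ p ∂((volume : Measure (ℝ × ℝ)).restrict (Icc a b ×ˢ Icc c d)), P (p.1 + p.2 * I) := by
  have hm : MeasurableSet (Icc a b ×ℂ Icc c d) := (isCompact_Icc.reProdIm isCompact_Icc).measurableSet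
  have h1 : ∀ᵐ z ∂(volume.restrict (Icc a b ×ℂ Icc c d)), P z := ae_restrict_le_codiscreteWithin hm h
  rw [ae_restrict_iff' hm] at h1
  rw [ae_restrict_iff' (measurableSet_Icc.prod measurableSet_Icc)]
  have := (Complex.volume_preserving_equiv_real_prod.symm _).quasiMeasurePreserving.ae h1
  filter_upwards [this] with p hp hp2
  have e : (Complex.measurableEquivRealProd.symm p) = (p.1 + p.2 * I : ℂ) := by
    simp [Complex.measurableEquivRealProd_symm_apply, Complex.mk_eq_add_mul_I]
  rw [e] at hp
  exact hp (fz_mem_rect hp2)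

lemma fz_norm_sub (p : ℝ × ℝ) (ρ : ℂ) : Real.log ‖(p.1 + p.2 * I : ℂ) - ρ‖ =
    1 / 2 * Real.log ((p.1 - ρ.re) ^ 2 + (p.2 - ρ.im) ^ 2) := by
  rw [Complex.norm_def, Real.log_sqrt (normSq_nonneg _), normSq_apply]
  simp
  ring_nf

lemma fz_logker_int' {a b c d : ℝ} (ρ : ℂ) :
    IntegrableOn (fun p : ℝ × ℝ => Real.log ‖(p.1 + p.2 * I : ℂ) - ρ‖) (Icc a b ×ˢ Icc c d) := by
  refine Integrable.mono' (fz_logker_int ρ.re ρ.im) (Measurable.aestronglyMeasurable (by fun_prop)) ?_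
  filter_upwards [fz_ae_fst_ne ρ.re (Icc a b ×ˢ Icc c d)] with p hp
  rw [fz_norm_sub, Real.norm_eq_abs]
  simpa using fz_logr_bound (y := p.2 - ρ.im) (sub_ne_zero.2 hp) le_rfl zero_le_one

/-- Green identity for `log ‖f‖`, `f` analytic. -/
lemma fz_green_an {a b c d : ℝ} (hab : a ≤ b) (hcd : c ≤ d) {χ χ1 χ2 k k1 k2 : ℝ → ℝ} {f : ℂ → ℂ}
    (hf : AnalyticOnNhd ℂ f (Icc a b ×ℂ Icc c d)) (hf0 : ∃ z ∈ Icc a b ×ℂ Icc c d, f z ≠ 0)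
    (hχ : FZTest a b χ χ1 χ2) (hk : FZTest c d k k1 k2) :
    IntegrableOn (fun p : ℝ × ℝ => Real.log ‖f (p.1 + p.2 * I)‖) (Icc a b ×ˢ Icc c d) ∧
    ∫ p in Icc a b ×ˢ Icc c d, Real.log ‖f (p.1 + p.2 * I)‖ * (χ p.1 * k2 p.2 + χ2 p.1 * k p.2) =
      2 * π * ∑ᶠ ρ ∈ Icc a b ×ℂ Icc c d, ((analyticOrderAt f ρ).toNat : ℝ) * (χ ρ.re * k ρ.im) := by
  set K := Icc a b ×ℂ Icc c d with hK
  have hconv : Convex ℝ K :=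
    ((convex_Icc a b).linear_preimage Complex.reLm).inter ((convex_Icc c d).linear_preimage Complex.imLm)
  have hcomp : IsCompact K := isCompact_Icc.reProdIm isCompact_Icc
  have hord : ∀ z ∈ K, analyticOrderAt f z ≠ ⊤ := by
    obtain ⟨z0, hz0, hfz0⟩ := hf0
    have : analyticOrderAt f z0 ≠ ⊤ := by
      rw [(hf z0 hz0).analyticOrderAt_eq_zero.2 hfz0]; simp
    intro z hz
    exact hf.analyticOrderAt_ne_top_of_isPreconnected hconv.isPreconnected hz0 hz this
  have hmer : ∀ u : K, meromorphicOrderAt f u ≠ ⊤ := by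
    intro u
    rw [(hf u u.2).meromorphicOrderAt_eq]
    simpa using hord u u.2
  have hfin := (MeromorphicOn.divisor f K).finiteSupport hcomp
  obtain ⟨g, hg, hg0, hfg⟩ := MeromorphicOn.extract_zeros_poles hf.meromorphicOn hmer hfin
  have hlog := MeromorphicOn.extract_zeros_poles_log hg0 hfg
  have hg0' : ∀ z ∈ K, g z ≠ 0 := fun z hz => hg0 ⟨z, hz⟩
  have hae := fz_ae_rect hlog
  set D := MeromorphicOn.divisor f K with hD
  have hsum : ∀ z, (∑ᶠ u, (fun w : ℂ => (D u : ℝ) * Real.log ‖w - u‖)) z = ∑ u ∈ hfin.toFinset, (D u : ℝ) * Real.log ‖z - u‖ := by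
    intro z
    rw [finsum_eq_sum_of_support_subset (s := hfin.toFinset)]
    · simp
    · intro u hu
      simp only [Function.mem_support] at hu
      simp only [Finite.coe_toFinset, Function.mem_support]
      intro h
      apply hu
      ext w
      simp [h]
  have hcont : Continuous (fun p : ℝ × ℝ => (p.1 + p.2 * I : ℂ)) := by fun_prop
  have hmaps : MapsTo (fun p : ℝ × ℝ => (p.1 + p.2 * I : ℂ)) (Icc a b ×ˢ Icc c d) K :=
    fun p hp => fz_mem_rect hp
  have hgI : ContinuousOn (fun p : ℝ × ℝ => Real.log ‖g (p.1 + p.2 * I)‖) (Icc a b ×ˢ Icc c d) := by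
    refine ContinuousOn.log ((hg.continuousOn.comp hcont.continuousOn hmaps).norm) ?_
    intro p hp
    simpa using hg0' _ (fz_mem_rect hp)
  have hKc : IsCompact (Icc a b ×ˢ Icc c d) := isCompact_Icc.prod isCompact_Icc
  have hae2 : (fun p : ℝ × ℝ => Real.log ‖f (p.1 + p.2 * I)‖) =ᵐ[volume.restrict (Icc a b ×ˢ Icc c d)]
      fun p => (∑ u ∈ hfin.toFinset, (D u : ℝ) * Real.log ‖(p.1 + p.2 * I : ℂ) - u‖) + Real.log ‖g (p.1 + p.2 * I)‖ := by
    filter_upwards [hae] with p hp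
    rw [hp, Pi.add_apply, hsum]
  have hIsum : IntegrableOn (fun p : ℝ × ℝ => ∑ u ∈ hfin.toFinset, (D u : ℝ) * Real.log ‖(p.1 + p.2 * I : ℂ) - u‖) (Icc a b ×ˢ Icc c d) :=
    integrable_finsetSum _ fun u _ => (fz_logker_int' u).const_mul _
  constructor
  · exact (hIsum.add (hgI.integrableOn_compact hKc)).congr hae2.symm
  · have cχ := hχ.c0
    have ck := hk.c0
    have cχ2 := hχ.c2
    have ck2 := hk.c2
    have hΦ : Continuous (fun p : ℝ × ℝ => χ p.1 * k2 p.2 + χ2 p.1 * k p.2) := by fun_prop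
    have hI1 : ∀ u, IntegrableOn (fun p : ℝ × ℝ => (D u : ℝ) * (Real.log ‖(p.1 + p.2 * I : ℂ) - u‖ * (χ p.1 * k2 p.2 + χ2 p.1 * k p.2))) (Icc a b ×ˢ Icc c d) :=
      fun u => ((fz_logker_int' u).mul_continuousOn hΦ.continuousOn hKc).const_mul _
    calc ∫ p in Icc a b ×ˢ Icc c d, Real.log ‖f (p.1 + p.2 * I)‖ * (χ p.1 * k2 p.2 + χ2 p.1 * k p.2)
        = ∫ p in Icc a b ×ˢ Icc c d, ((∑ u ∈ hfin.toFinset, (D u : ℝ) * (Real.log ‖(p.1 + p.2 * I : ℂ) - u‖ * (χ p.1 * k2 p.2 + χ2 p.1 * k p.2)))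
          + Real.log ‖g (p.1 + p.2 * I)‖ * (χ p.1 * k2 p.2 + χ2 p.1 * k p.2)) := by
          refine integral_congr_ae ?_
          filter_upwards [hae2] with p hp
          rw [hp, add_mul, Finset.sum_mul]
          simp only [mul_assoc]
      _ = ∑ u ∈ hfin.toFinset, (D u : ℝ) * (2 * π * (χ u.re * k u.im)) := by
          have hI2 : IntegrableOn (fun p : ℝ × ℝ => Real.log ‖g (p.1 + p.2 * I)‖ * (χ p.1 * k2 p.2 + χ2 p.1 * k p.2)) (Icc a b ×ˢ Icc c d) :=
            (hgI.mul hΦ.continuousOn).integrableOn_compact hKc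
          rw [integral_add (integrable_finsetSum _ fun u _ => hI1 u) hI2,
            fz_green_nv hab hcd hg hg0' hχ.d0 hχ.d1 hχ.c2 hk, integral_finsetSum _ fun u _ => hI1 u]
          simp only [hχ.za, hχ.zb, hχ.z1a, hχ.z1b, mul_zero, sub_zero,
            intervalIntegral.integral_zero, add_zero]
          refine Finset.sum_congr rfl fun u hu => ?_
          have huK : u ∈ K := D.supportWithinDomain (by simpa using hu)
          rw [integral_const_mul]
          simp only [fz_norm_sub]
          rw [fz_logker hab hcd hχ hk, indicator_of_mem]
          exact huK
      _ = _ := by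
          rw [finsum_mem_eq_sum_of_inter_support_eq (t := hfin.toFinset), Finset.mul_sum]
          · refine Finset.sum_congr rfl fun u hu => ?_
            have huK : u ∈ K := D.supportWithinDomain (by simpa using hu)
            have : (D u : ℝ) = ((analyticOrderAt f u).toNat : ℝ) := by
              rw [hD, MeromorphicOn.AnalyticOnNhd.divisor_apply hf huK]
              obtain ⟨n, hn⟩ := ENat.ne_top_iff_exists.1 (hord u huK)
              rw [← hn]
              simp
            rw [this]; ring
          · ext u
            simp only [mem_inter_iff, Function.mem_support, Finite.coe_toFinset]
            constructor
            · rintro ⟨huK, hu⟩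
              refine ⟨?_, hu⟩
              intro h
              apply hu
              rw [hD, MeromorphicOn.AnalyticOnNhd.divisor_apply hf huK] at h
              obtain ⟨n, hn⟩ := ENat.ne_top_iff_exists.1 (hord u huK)
              rw [← hn] at h ⊢
              have : n = 0 := by simpa using h
              simp [this]
            · rintro ⟨h, hu⟩
              exact ⟨D.supportWithinDomain h, hu⟩

lemma fz_bessel_aux {D : ℝ → ℝ} (hD : Integrable D) (hD2 : Integrable (fun v => D v ^ 2)) {b : ℝ} (hb : 0 < b) :
    Integrable (fun t : ℝ => Real.exp (-b * t ^ 2) * ‖∫ v, (D v : ℂ) * cexp (-(t * v) * I)‖ ^ 2) ∧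
    ∫ t : ℝ, Real.exp (-b * t ^ 2) * ‖∫ v, (D v : ℂ) * cexp (-(t * v) * I)‖ ^ 2 ≤ 2 * π * ∫ v, D v ^ 2 := by
  set F : ℝ × (ℝ × ℝ) → ℂ := fun q => (Real.exp (-b * q.1 ^ 2) : ℂ) * (((D q.2.1 : ℂ) * cexp (-(q.1 * q.2.1) * I)) * ((D q.2.2 : ℂ) * cexp ((q.1 * q.2.2) * I))) with hF
  have hDc : Integrable (fun v => (D v : ℂ)) := hD.ofReal
  have hg : Integrable (fun t : ℝ => (Real.exp (-b * t ^ 2) : ℂ)) := (integrable_exp_neg_mul_sq hb).ofReal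
  have hFI : Integrable F (volume.prod (volume.prod volume)) := by
    have h0 : Integrable (fun q : ℝ × (ℝ × ℝ) => (Real.exp (-b * q.1 ^ 2) : ℂ) * ((D q.2.1 : ℂ) * (D q.2.2 : ℂ))) (volume.prod (volume.prod volume)) :=
      hg.mul_prod (hDc.mul_prod hDc)
    have h1 := h0.mul_bdd (c := 1) (g := fun q : ℝ × (ℝ × ℝ) => cexp (-(q.1 * q.2.1) * I) * cexp ((q.1 * q.2.2) * I)) ?_ ?_
    · refine h1.congr (ae_of_all _ fun q => ?_)
      simp only [hF]; ring
    · exact Measurable.aestronglyMeasurable (by fun_prop)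
    · refine ae_of_all _ fun q => ?_
      have e1 : ‖cexp (-(q.1 * q.2.1) * I)‖ = 1 := by
        have := Complex.norm_exp_ofReal_mul_I (-(q.1 * q.2.1))
        simpa using this
      have e2 : ‖cexp ((q.1 * q.2.2) * I)‖ = 1 := by
        have := Complex.norm_exp_ofReal_mul_I ((q.1 * q.2.2))
        simpa using this
      rw [norm_mul, e1, e2, one_mul]
  have hin : ∀ t : ℝ, ∫ p, F (t, p) ∂(volume.prod volume) = ((Real.exp (-b * t ^ 2) * ‖∫ v, (D v : ℂ) * cexp (-(t * v) * I)‖ ^ 2 : ℝ) : ℂ) := by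
    intro t
    simp only [hF]
    rw [integral_const_mul, integral_prod_mul (fun v : ℝ => (D v : ℂ) * cexp (-(t * v) * I)) (fun v : ℝ => (D v : ℂ) * cexp ((t * v) * I))]
    have : ∫ v : ℝ, (D v : ℂ) * cexp ((t * v) * I) = (starRingEnd ℂ) (∫ v, (D v : ℂ) * cexp (-(t * v) * I)) := by
      rw [← integral_conj]
      congr 1; ext v
      rw [map_mul, conj_ofReal, ← Complex.exp_conj]
      simp
    rw [this, Complex.mul_conj, Complex.normSq_eq_norm_sq]
    push_cast
    ring
  set K : ℝ → ℝ := fun x => (π / b) ^ (1 / 2 : ℝ) * Real.exp (-(1 / (4 * b)) * x ^ 2) with hK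
  have hKI : Integrable K := (integrable_exp_neg_mul_sq (by positivity)).const_mul _
  have hKint : ∫ x, K x = 2 * π := by
    simp only [hK]
    rw [integral_const_mul, integral_gaussian, ← Real.sqrt_eq_rpow, ← Real.sqrt_mul (by positivity)]
    rw [show π / b * (π / (1 / (4 * b))) = (2 * π) ^ 2 by field_simp; norm_num]
    exact Real.sqrt_sq (by positivity)
  have hout : ∀ p : ℝ × ℝ, ∫ t, F (t, p) = (D p.1 : ℂ) * D p.2 * K (p.1 - p.2) := by
    intro p
    have := fourierIntegral_gaussian (b := (b : ℂ)) (by simpa using hb) (-((p.1 - p.2 : ℝ) : ℂ))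
    have e : ∀ t : ℝ, F (t, p) = ((D p.1 : ℂ) * D p.2) * (cexp (I * (-((p.1 - p.2 : ℝ) : ℂ)) * t) * cexp (-b * t ^ 2)) := by
      intro t
      simp only [hF]
      push_cast
      rw [show I * (-((p.1 : ℂ) - p.2)) * t = -(t * p.1) * I + (t * p.2) * I by ring, Complex.exp_add]
      ring
    simp only [e]
    rw [integral_const_mul, this]
    congr 1
    simp only [hK]
    push_cast
    rw [Complex.ofReal_cpow (by positivity)]
    push_cast
    congr 2
    field_simp
  have hreal : ((∫ t : ℝ, Real.exp (-b * t ^ 2) * ‖∫ v, (D v : ℂ) * cexp (-(t * v) * I)‖ ^ 2 : ℝ) : ℂ) =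
      ∫ p : ℝ × ℝ, (D p.1 : ℂ) * D p.2 * K (p.1 - p.2) := by
    rw [← integral_complex_ofReal]
    simp only [← hin, ← hout]
    exact integral_integral_swap (f := fun t p => F (t, p)) hFI
  constructor
  · have := hFI.integral_prod_left
    simp only [hin] at this
    exact this.re
  set J := ∫ t : ℝ, Real.exp (-b * t ^ 2) * ‖∫ v, (D v : ℂ) * cexp (-(t * v) * I)‖ ^ 2 with hJ
  have hA : Integrable (fun p : ℝ × ℝ => D p.2 ^ 2 * K (p.1 - p.2)) (volume.prod volume) :=
    MeasureTheory.Integrable.convolution_integrand (ContinuousLinearMap.mul ℝ ℝ) hD2 hKI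
  have hAint : ∫ p : ℝ × ℝ, D p.2 ^ 2 * K (p.1 - p.2) ∂(volume.prod volume) = 2 * π * ∫ v, D v ^ 2 := by
    rw [integral_prod_symm _ hA]
    simp only
    have : ∀ y, ∫ x, D y ^ 2 * K (x - y) = D y ^ 2 * (2 * π) := by
      intro y
      rw [integral_const_mul, integral_sub_right_eq_self K y, hKint]
    simp only [this]
    rw [integral_mul_const]; ring
  have hKn : ∀ x, 0 ≤ K x := fun x => by positivity
  have h1 : J ≤ ‖∫ p : ℝ × ℝ, (D p.1 : ℂ) * D p.2 * K (p.1 - p.2)‖ := by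
    rw [← hreal, Complex.norm_real]; exact le_abs_self _
  refine h1.trans ?_
  have h2 : ∀ p : ℝ × ℝ, ‖(D p.1 : ℂ) * D p.2 * K (p.1 - p.2)‖ ≤ 1 / 2 * (D p.2 ^ 2 * K (p.1 - p.2) + (fun p : ℝ × ℝ => D p.2 ^ 2 * K (p.1 - p.2)) p.swap) := by
    intro p
    simp only [Prod.fst_swap, Prod.snd_swap]
    have e : K (p.2 - p.1) = K (p.1 - p.2) := by
      simp only [hK]; congr 2; ring
    rw [e, norm_mul, norm_mul, Complex.norm_real, Complex.norm_real, Complex.norm_real, Real.norm_of_nonneg (hKn _)]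
    have := two_mul_le_add_sq ‖D p.1‖ ‖D p.2‖
    simp only [Real.norm_eq_abs, sq_abs] at this ⊢
    nlinarith [hKn (p.1 - p.2)]
  calc ‖∫ p : ℝ × ℝ, (D p.1 : ℂ) * D p.2 * K (p.1 - p.2)‖ ≤ ∫ p : ℝ × ℝ, 1 / 2 * (D p.2 ^ 2 * K (p.1 - p.2) + (fun p : ℝ × ℝ => D p.2 ^ 2 * K (p.1 - p.2)) p.swap) :=
        norm_integral_le_of_norm_le ((hA.add hA.swap).const_mul _) (ae_of_all _ h2)
    _ = 2 * π * ∫ v, D v ^ 2 := by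
        have hAs : Integrable (fun q : ℝ × ℝ => (fun p : ℝ × ℝ => D p.2 ^ 2 * K (p.1 - p.2)) q.swap) (volume.prod volume) := hA.swap
        rw [integral_const_mul, Measure.volume_eq_prod, integral_add hA hAs,
          integral_prod_swap (fun p : ℝ × ℝ => D p.2 ^ 2 * K (p.1 - p.2)), hAint]
        ring

lemma fz_bessel {D : ℝ → ℝ} (hD : Integrable D) (hD2 : Integrable (fun v => D v ^ 2)) {T : ℝ} (hT : 0 < T) :
    IntegrableOn (fun t : ℝ => ‖∫ v, (D v : ℂ) * cexp (-(t * v) * I)‖ ^ 2) (Icc 0 T) ∧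
    ∫ t in Icc 0 T, ‖∫ v, (D v : ℂ) * cexp (-(t * v) * I)‖ ^ 2 ≤ 18 * ∫ v, D v ^ 2 := by
  obtain ⟨h1, h2⟩ := fz_bessel_aux hD hD2 (b := 1 / T ^ 2) (by positivity)
  have hle : ∀ t ∈ Icc 0 T, ‖∫ v, (D v : ℂ) * cexp (-(t * v) * I)‖ ^ 2 ≤
      Real.exp 1 * (Real.exp (-(1 / T ^ 2) * t ^ 2) * ‖∫ v, (D v : ℂ) * cexp (-(t * v) * I)‖ ^ 2) := by
    intro t ht
    rw [← mul_assoc, ← Real.exp_add]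
    refine le_mul_of_one_le_left (by positivity) (Real.one_le_exp ?_)
    have : 1 / T ^ 2 * t ^ 2 ≤ 1 := by
      rw [one_div_mul_eq_div, div_le_one (by positivity)]
      exact pow_le_pow_left₀ ht.1 ht.2 2
    linarith
  have hcont : Continuous (fun t : ℝ => ‖∫ v, (D v : ℂ) * cexp (-(t * v) * I)‖ ^ 2) := by
    refine (Continuous.norm ?_).pow 2
    refine continuous_of_dominated (bound := fun v => ‖D v‖) ?_ ?_ hD.norm ?_
    · intro t
      exact hD.ofReal.aestronglyMeasurable.mul (Measurable.aestronglyMeasurable (by fun_prop))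
    · intro t
      refine ae_of_all _ fun v => ?_
      have e1 : ‖cexp (-(t * v) * I)‖ = 1 := by
        have := Complex.norm_exp_ofReal_mul_I (-(t * v))
        simpa using this
      rw [norm_mul, e1, mul_one, Complex.norm_real]
    · refine ae_of_all _ fun v => by fun_prop
  have hI := hcont.continuousOn.integrableOn_compact (μ := volume) (isCompact_Icc (a := (0:ℝ)) (b := T))
  refine ⟨hI, ?_⟩
  have hnn : 0 ≤ ∫ v, D v ^ 2 := integral_nonneg fun v => by positivity
  calc _ ≤ ∫ t in Icc 0 T, Real.exp 1 * (Real.exp (-(1 / T ^ 2) * t ^ 2) * ‖∫ v, (D v : ℂ) * cexp (-(t * v) * I)‖ ^ 2) :=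
        setIntegral_mono_on hI (h1.const_mul _).integrableOn measurableSet_Icc hle
    _ ≤ ∫ t, Real.exp 1 * (Real.exp (-(1 / T ^ 2) * t ^ 2) * ‖∫ v, (D v : ℂ) * cexp (-(t * v) * I)‖ ^ 2) :=
        setIntegral_le_integral (h1.const_mul _) (ae_of_all _ fun t => by positivity)
    _ ≤ Real.exp 1 * (2 * π * ∫ v, D v ^ 2) := by
        rw [integral_const_mul]; gcongr
    _ ≤ 18 * ∫ v, D v ^ 2 := by
        have e := Real.exp_one_lt_d9
        have p := Real.pi_lt_d2
        have : Real.exp 1 * (2 * π) ≤ 18 := by nlinarith [Real.exp_pos 1, pi_pos]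
        nlinarith

structure FZCoef (c : ℕ → ℝ) (κ C : ℝ) (N : ℕ) (f : ℂ → ℂ) : Prop where
  c01 : ∀ n, c n = 0 ∨ c n = 1
  c1 : c 1 = 1
  small : ∀ n, 2 ≤ n → n ≤ N → c n = 0
  k0 : 0 ≤ κ
  k1 : κ ≤ 1
  bd : ∀ n : ℕ, |∑ k ∈ Finset.Icc 1 n, c k - κ * n| ≤ C
  ser : ∀ s : ℂ, 1 < s.re → LSeries (fun n => (c n : ℂ)) s = f s
  diff : ∀ s : ℂ, 0 < s.im → DifferentiableAt ℂ f s

noncomputable def fzE (c : ℕ → ℝ) (κ : ℝ) (y : ℝ) : ℝ :=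
  if y < 1 then 0 else ∑ k ∈ Finset.Icc 1 ⌊y⌋₊, c k - κ * y - 1 + κ

theorem FZCoef.C0 {c κ C N f} (h : FZCoef c κ C N f) : 0 ≤ C :=
  (abs_nonneg _).trans (h.bd 0)

theorem FZCoef.Ebd {c κ C N f} (h : FZCoef c κ C N f) (y : ℝ) : |fzE c κ y| ≤ C + 3 := by
  have hC := h.C0
  unfold fzE
  split_ifs with hy
  · simp; linarith
  · push Not at hy
    have h1 := h.bd ⌊y⌋₊
    have h2 : (⌊y⌋₊ : ℝ) ≤ y := Nat.floor_le (by linarith)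
    have h3 : y < ⌊y⌋₊ + 1 := Nat.lt_floor_add_one y
    have k0 := h.k0
    have k1 := h.k1
    have h4 : κ * (y - ⌊y⌋₊) ≤ 1 * 1 := by
      apply mul_le_mul k1 (by linarith) (by linarith) (by linarith)
    have h5 : 0 ≤ κ * (y - ⌊y⌋₊) := mul_nonneg k0 (by linarith)
    rw [abs_le] at h1 ⊢
    constructor <;> linarith [h1.1, h1.2]

theorem fzE_meas (c : ℕ → ℝ) (κ : ℝ) : Measurable (fzE c κ) := by
  unfold fzE
  refine Measurable.ite measurableSet_Iio measurable_const ?_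
  have : Measurable (fun y : ℝ => ∑ k ∈ Finset.Icc 1 ⌊y⌋₊, c k) :=
    (measurable_from_nat (f := fun n : ℕ => ∑ k ∈ Finset.Icc 1 n, c k)).comp Nat.measurable_floor
  fun_prop

theorem fzE_lint {c κ C N f} (h : FZCoef c κ C N f) :
    LocallyIntegrableOn (fun y => (fzE c κ y : ℂ)) (Ioi 0) := by
  apply LocallyIntegrable.locallyIntegrableOn
  have : LocallyIntegrable (fun _ : ℝ => (C + 3 : ℝ)) := continuous_const.locallyIntegrable
  refine this.mono (Complex.measurable_ofReal.comp (fzE_meas c κ)).aestronglyMeasurable ?_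
  filter_upwards with y
  have := h.Ebd y
  rw [Complex.norm_real, Real.norm_eq_abs, Real.norm_eq_abs]
  exact this.trans (le_abs_self _)

theorem fzE_top {c κ C N f} (h : FZCoef c κ C N f) :
    (fun y => (fzE c κ y : ℂ)) =O[atTop] (fun y : ℝ => y ^ (-(0:ℝ))) := by
  apply Asymptotics.IsBigO.of_bound (C + 3)
  filter_upwards with y
  have := h.Ebd y
  simpa using this

theorem fzE_bot (c κ) (b : ℝ) :
    (fun y => (fzE c κ y : ℂ)) =O[nhdsWithin 0 (Ioi 0)] (fun y : ℝ => y ^ (-b)) := by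
  apply Asymptotics.IsBigO.of_bound 1
  have : Iio (1:ℝ) ∈ nhdsWithin 0 (Ioi 0) := mem_nhdsWithin_of_mem_nhds (Iio_mem_nhds one_pos)
  filter_upwards [this] with y hy
  have : fzE c κ y = 0 := if_pos hy
  simp [this]

theorem fz_rep1 {c κ C N f} (h : FZCoef c κ C N f) {s : ℂ} (hs : 1 < s.re) :
    f s = 1 + κ / (s - 1) + s * mellin (fun y => (fzE c κ y : ℂ)) (-s) := by
  rw [← h.ser s hs]
  have hO : (fun n : ℕ => ∑ k ∈ Finset.Icc 1 n, c k) =O[atTop] fun n : ℕ => (n : ℝ) ^ (1:ℝ) := by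
    apply Asymptotics.IsBigO.of_bound (C + 1)
    filter_upwards [eventually_ge_atTop 1] with n hn
    have hn' : (1:ℝ) ≤ n := by exact_mod_cast hn
    have := abs_le.1 (h.bd n)
    have hC := h.C0
    have : κ * n ≤ 1 * n := mul_le_mul_of_nonneg_right h.k1 (by linarith)
    have : 0 ≤ κ * n := mul_nonneg h.k0 (by linarith)
    rw [Real.rpow_one, Real.norm_eq_abs, Real.norm_eq_abs, abs_of_nonneg (a := (n:ℝ)) (by linarith), abs_le]
    constructor <;> nlinarith
  rw [LSeries_eq_mul_integral_of_nonneg c zero_le_one hs hO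
    (fun n => by rcases h.c01 n with h | h <;> simp [h])]
  have hs0 : s ≠ 0 := by rintro rfl; simp at hs; linarith
  have hs1 : s - 1 ≠ 0 := by
    intro h0
    have : s = 1 := by linear_combination h0
    rw [this] at hs; simp at hs
  have hmc : MellinConvergent (fun y => (fzE c κ y : ℂ)) (-s) :=
    mellinConvergent_of_isBigO_rpow (a := 0) (b := -s.re - 1) (fzE_lint h) (fzE_top h) (by simp; linarith)
      (fzE_bot c κ _) (by simp)
  have hm : mellin (fun y => (fzE c κ y : ℂ)) (-s) = ∫ t in Ioi (1:ℝ), (t:ℂ) ^ (-(s + 1)) * (fzE c κ t : ℂ) := by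
    unfold mellin
    have e1 : ∀ t : ℝ, t ∈ Ioi (0:ℝ) → t ∉ Ici (1:ℝ) → (t:ℂ) ^ (-s - 1) • (fzE c κ t : ℂ) = 0 := by
      intro t _ ht
      have : fzE c κ t = 0 := if_pos (by simpa using ht)
      simp [this]
    rw [setIntegral_eq_of_subset_of_forall_sdiff_eq_zero (s := Ici (1:ℝ)) measurableSet_Ioi
      (fun x (hx : 1 ≤ x) => (lt_of_lt_of_le one_pos hx : (0:ℝ) < x)) (fun x hx => e1 x hx.1 hx.2),
      integral_Ici_eq_integral_Ioi]
    refine setIntegral_congr_fun measurableSet_Ioi fun t ht => ?_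
    simp only [smul_eq_mul]; congr 2; ring
  have i0 : IntegrableOn (fun t : ℝ => (t:ℂ) ^ (-(s + 1)) * (fzE c κ t : ℂ)) (Ioi 1) := by
    have := hmc.mono_set (t := Ioi (0:ℝ)) (s := Ioi 1) (Ioi_subset_Ioi zero_le_one)
    refine this.congr_fun (fun t ht => ?_) measurableSet_Ioi
    simp only [smul_eq_mul]; congr 2; ring
  have i1 : IntegrableOn (fun t : ℝ => (t:ℂ) ^ (-s)) (Ioi 1) :=
    integrableOn_Ioi_cpow_of_lt (by simp; linarith) one_pos
  have i2 : IntegrableOn (fun t : ℝ => (t:ℂ) ^ (-(s+1))) (Ioi 1) :=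
    integrableOn_Ioi_cpow_of_lt (by simp; linarith) one_pos
  have v1 : ∫ t in Ioi (1:ℝ), (t:ℂ) ^ (-s) = 1 / (s - 1) := by
    rw [integral_Ioi_cpow_of_lt (by simp; linarith) one_pos]
    have : -s + 1 ≠ 0 := by intro h0; apply hs1; linear_combination -h0
    simp; field_simp; ring
  have v2 : ∫ t in Ioi (1:ℝ), (t:ℂ) ^ (-(s+1)) = 1 / s := by
    rw [integral_Ioi_cpow_of_lt (by simp; linarith) one_pos]
    simp
  have hsplit : ∀ t ∈ Ioi (1:ℝ), (∑ k ∈ Finset.Icc 1 ⌊t⌋₊, (c k : ℂ)) * (t:ℂ) ^ (-(s + 1))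
      = (t:ℂ) ^ (-(s + 1)) * (fzE c κ t : ℂ) + (κ * (t:ℂ) ^ (-s) + (1 - κ) * (t:ℂ) ^ (-(s+1))) := by
    intro t ht
    have ht' : (1:ℝ) < t := ht
    have e : (fzE c κ t) = ∑ k ∈ Finset.Icc 1 ⌊t⌋₊, c k - κ * t - 1 + κ := if_neg (by linarith)
    have e2 : (t:ℂ) ^ (-s) = (t:ℂ) * (t:ℂ) ^ (-(s+1)) := by
      rw [show -s = 1 + -(s+1) by ring, Complex.cpow_add _ _ (by exact_mod_cast (by linarith : t ≠ 0)), Complex.cpow_one]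
    rw [e, e2]; push_cast; ring
  rw [setIntegral_congr_fun measurableSet_Ioi hsplit]
  have j1 : IntegrableOn (fun t : ℝ => κ * (t:ℂ) ^ (-s)) (Ioi 1) := i1.const_mul _
  have j2 : IntegrableOn (fun t : ℝ => (1 - κ : ℂ) * (t:ℂ) ^ (-(s+1))) (Ioi 1) := i2.const_mul _
  have j3 : IntegrableOn (fun t : ℝ => κ * (t:ℂ) ^ (-s) + (1 - κ : ℂ) * (t:ℂ) ^ (-(s+1))) (Ioi 1) := j1.add j2
  rw [integral_add i0 j3, integral_add j1 j2, integral_const_mul, integral_const_mul, v1, v2, hm]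
  field_simp
  ring

theorem fz_rep2 {c κ C N f} (h : FZCoef c κ C N f) {s : ℂ} (hs : 0 < s.re) (ht : 0 < s.im) :
    f s = 1 + κ / (s - 1) + s * mellin (fun y => (fzE c κ y : ℂ)) (-s) := by
  let U : Set ℂ := {s | 0 < s.re} ∩ {s | 0 < s.im}
  have hUo : IsOpen U := (isOpen_lt continuous_const Complex.continuous_re).inter
    (isOpen_lt continuous_const Complex.continuous_im)
  have hUc : Convex ℝ U := (convex_halfSpace_re_gt 0).inter (convex_halfSpace_im_gt 0)
  have hf : AnalyticOnNhd ℂ f U := DifferentiableOn.analyticOnNhd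
    (fun z hz => (h.diff z hz.2).differentiableWithinAt) hUo
  have hg : AnalyticOnNhd ℂ (fun s => 1 + κ / (s - 1) + s * mellin (fun y => (fzE c κ y : ℂ)) (-s)) U := by
    refine DifferentiableOn.analyticOnNhd (fun z hz => DifferentiableAt.differentiableWithinAt ?_) hUo
    have hz1 : z - 1 ≠ 0 := by
      intro h0
      have : z = 1 := by linear_combination h0
      have h2 := hz.2; rw [this] at h2; simp at h2
    have hm : DifferentiableAt ℂ (mellin (fun y => (fzE c κ y : ℂ))) (-z) :=
      mellin_differentiableAt_of_isBigO_rpow (a := 0) (b := -z.re - 1) (fzE_lint h) (fzE_top h)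
        (by simpa using hz.1) (fzE_bot c κ _) (by simp)
    have hm' : DifferentiableAt ℂ (fun s => mellin (fun y => (fzE c κ y : ℂ)) (-s)) z :=
      DifferentiableAt.comp (g := mellin (fun y => (fzE c κ y : ℂ))) z hm (differentiableAt_id.neg)
    have h1 : DifferentiableAt ℂ (fun s : ℂ => (κ:ℂ) / (s - 1)) z := by
      exact (differentiableAt_const _).div (differentiableAt_id.sub_const _) hz1
    exact ((differentiableAt_const _).add h1).add (differentiableAt_id.mul hm')
  have h0 : (2 + I : ℂ) ∈ U := by constructor <;> simp
  refine hf.eqOn_of_preconnected_of_eventuallyEq hg hUc.isPreconnected h0 ?_ ⟨hs, ht⟩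
  have : {s : ℂ | 1 < s.re} ∈ nhds (2 + I : ℂ) :=
    (isOpen_lt continuous_const Complex.continuous_re).mem_nhds (by simp)
  filter_upwards [this] with z hz
  exact fz_rep1 h hz

theorem fz_rep {c κ C N f} (h : FZCoef c κ C N f) {σ t : ℝ} (hs : 0 < σ) (ht : 0 < t) :
    f (σ + t * I) = 1 + κ / ((σ + t * I) - 1) + (σ + t * I) *
      ∫ v : ℝ, ((fzE c κ (Real.exp v) * Real.exp (-σ * v) : ℝ) : ℂ) * cexp (-(t * v) * I) := by
  rw [fz_rep2 h (by simpa using hs) (by simpa using ht), mellin_eq_fourier, Real.fourier_eq']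
  congr 2
  rw [← integral_neg_eq_self]
  refine integral_congr_ae (ae_of_all _ fun v => ?_)
  simp
  ring_nf
  have e : (π * t * (π:ℂ)⁻¹ * v * I) = t * v * I := by
    have : (π:ℂ) ≠ 0 := by exact_mod_cast Real.pi_ne_zero
    field_simp
  rw [e]; ring

theorem fz_coef_bd (M : ℕ) (hM : 0 < M) (n : ℕ) :
    |∑ k ∈ Finset.Icc 1 n, (if M.Coprime k then (1:ℝ) else 0) - ((M.totient : ℝ) / M) * n| ≤ 2 * M := by
  have hM' : (0:ℝ) < M := by exact_mod_cast hM
  set F : ℕ → ℝ := fun n => ∑ k ∈ Finset.Icc 1 n, (if M.Coprime k then (1:ℝ) else 0) - ((M.totient : ℝ) / M) * n with hF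
  have hper : ∀ n, F (n + M) = F n := by
    intro n
    have e1 : ∀ m, ∑ k ∈ Finset.Icc 1 m, (if M.Coprime k then (1:ℝ) else 0) = ∑ k ∈ Finset.Ico 1 (m+1), (if M.Coprime k then (1:ℝ) else 0) := fun m => rfl
    have e2 : ∑ k ∈ Finset.Ico (n+1) (n + 1 + M), (if M.Coprime k then (1:ℝ) else 0) = M.totient := by
      rw [← Nat.filter_coprime_Ico_eq_totient M (n+1), Finset.sum_ite]; simp
    have e3 := Finset.sum_Ico_consecutive (fun k => if M.Coprime k then (1:ℝ) else 0) (show 1 ≤ n + 1 by omega) (show n + 1 ≤ n + 1 + M by omega)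
    rw [e2] at e3
    simp only [hF]
    rw [e1, e1, show n + M + 1 = n + 1 + M by ring, ← e3]
    push_cast
    field_simp
    ring
  have hmod : F n = F (n % M) := by
    conv_lhs => rw [← Nat.mod_add_div n M]
    induction n / M with
    | zero => simp
    | succ k ih => rw [mul_add, mul_one, ← add_assoc, hper, ih]
  change |F n| ≤ _
  rw [hmod]
  have hlt : ((n % M : ℕ):ℝ) ≤ M := by exact_mod_cast (Nat.mod_lt n hM).le
  generalize n % M = r at hlt
  have a1 : ∑ k ∈ Finset.Icc 1 r, (if M.Coprime k then (1:ℝ) else 0) ≤ r := by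
    calc _ ≤ ∑ k ∈ Finset.Icc 1 r, (1:ℝ) := Finset.sum_le_sum fun k _ => by split_ifs <;> norm_num
      _ = r := by simp
  have a2 : 0 ≤ ∑ k ∈ Finset.Icc 1 r, (if M.Coprime k then (1:ℝ) else 0) :=
    Finset.sum_nonneg fun k _ => by split_ifs <;> norm_num
  have a3 : (M.totient : ℝ) / M ≤ 1 := by
    rw [div_le_one hM']; exact_mod_cast Nat.totient_le M
  have a4 : 0 ≤ (M.totient : ℝ) / M := by positivity
  have a5 : (M.totient : ℝ) / M * r ≤ 1 * r := mul_le_mul_of_nonneg_right a3 (by positivity)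
  have a6 : 0 ≤ (M.totient : ℝ) / M * r := by positivity
  simp only [hF]
  rw [abs_le]; constructor <;> linarith

noncomputable def fzM (N : ℕ) (s : ℂ) : ℂ := ∏ p ∈ (N.factorial).primeFactors, (1 - (p : ℂ) ^ (-s))

noncomputable def fzF (N : ℕ) (s : ℂ) : ℂ := fzM N s * riemannZeta s

theorem fz_coef (N : ℕ) : ∃ c κ C, FZCoef c κ C N (fzF N) := by
  have hM : 0 < N.factorial := Nat.factorial_pos N
  have : NeZero N.factorial := ⟨hM.ne'⟩
  refine ⟨fun k => if (N.factorial).Coprime k then 1 else 0, ((N.factorial).totient : ℝ) / N.factorial, 2 * N.factorial,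
    ⟨fun n => ?_, by simp, fun n h2 hn => ?_, by positivity, ?_, fz_coef_bd _ hM, fun s hs => ?_, fun s hs => ?_⟩⟩
  · by_cases h : (N.factorial).Coprime n <;> simp [h]
  · rw [if_neg]
    intro h
    have h3 : n ∣ N.factorial := Nat.dvd_factorial (by omega) hn
    have := Nat.Coprime.eq_one_of_dvd (Nat.Coprime.symm h) h3
    omega
  · rw [div_le_one (by exact_mod_cast hM)]; exact_mod_cast Nat.totient_le _
  · have hs1 : s ≠ 1 := by rintro rfl; simp at hs
    have := DirichletCharacter.LFunctionTrivChar_eq_mul_riemannZeta (N := N.factorial) hs1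
    unfold fzF fzM
    rw [← this, DirichletCharacter.LFunctionTrivChar, DirichletCharacter.LFunction_eq_LSeries _ hs]
    congr 1
    ext n
    by_cases h : (N.factorial).Coprime n
    · rw [if_pos h, MulChar.one_apply]; simp
      exact (ZMod.isUnit_iff_coprime _ _).2 h.symm
    · rw [if_neg h, MulChar.map_nonunit]; simp
      rw [ZMod.isUnit_iff_coprime]; exact fun h' => h h'.symm
  · have hs1 : s ≠ 1 := by rintro rfl; simp at hs
    have : DifferentiableAt ℂ (fzM N) s := by
      unfold fzM
      apply DifferentiableAt.fun_finsetProd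
      intro p hp
      have : (p:ℂ) ≠ 0 := by exact_mod_cast (Nat.prime_of_mem_primeFactors hp).ne_zero
      have : DifferentiableAt ℂ (fun s : ℂ => (p:ℂ) ^ (-s)) s :=
        DifferentiableAt.const_cpow (by fun_prop) (Or.inl this)
      fun_prop
    exact this.mul (differentiableAt_riemannZeta hs1)

theorem fz_exp_abs {a : ℝ} (ha : 0 < a) : Integrable (fun v : ℝ => Real.exp (-a * |v|)) ∧
    ∫ v : ℝ, Real.exp (-a * |v|) = 2 / a := by
  have e : ∫ v : ℝ, Real.exp (-a * |v|) = 2 / a := by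
    rw [integral_comp_abs (f := fun v => Real.exp (-a * v)), integral_exp_mul_Ioi (by linarith)]
    simp; field_simp
  refine ⟨?_, e⟩
  by_contra h
  rw [integral_undef h] at e
  have : 0 < 2 / a := by positivity
  linarith

theorem fz_psum {N m : ℕ} (hN : 1 ≤ N) {x : ℝ} (hx : 0 < x) :
    ∑ n ∈ Finset.Ioc N m, (n : ℝ) ^ (-(1 + 2 * x)) ≤ (N : ℝ) ^ (-(2 * x)) / (2 * x) := by
  have hN' : (0:ℝ) < N := by exact_mod_cast hN
  rcases lt_or_ge m N with h | h
  · rw [Finset.Ioc_eq_empty (by omega)]; simp; positivity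
  have e : ∑ n ∈ Finset.Ioc N m, (n : ℝ) ^ (-(1 + 2 * x)) = ∑ i ∈ Finset.Ico N m, ((i + 1 : ℕ) : ℝ) ^ (-(1 + 2 * x)) := by
    rw [Finset.sum_Ico_add' (fun n : ℕ => (n : ℝ) ^ (-(1 + 2 * x))) N m 1]
    refine Finset.sum_congr ?_ fun _ _ => rfl
    ext i; simp only [Finset.mem_Ioc, Finset.mem_Ico]; omega
  rw [e]
  have := AntitoneOn.sum_le_integral_Ico (f := fun y : ℝ => y ^ (-(1 + 2 * x))) h (by
    intro a ha b hb hab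
    exact Real.rpow_le_rpow_of_nonpos (by linarith [ha.1]) hab (by linarith))
  refine this.trans ?_
  rw [integral_rpow (Or.inr ⟨by linarith, ?_⟩)]
  · rw [show -(1 + 2 * x) + 1 = -(2 * x) by ring, div_neg, ← neg_div, neg_sub]
    gcongr
    have : 0 ≤ (m:ℝ) ^ (-(2 * x)) := by positivity
    linarith
  · rw [uIcc_of_le (by exact_mod_cast h)]
    intro h0; linarith [h0.1]

theorem fz_E_zero (c κ) {y : ℝ} (hy : y < 1) : fzE c κ y = 0 := if_pos hy

theorem FZCoef.E_near {c κ C N f} (h : FZCoef c κ C N f) {y : ℝ} (hy : 1 ≤ y) (hy2 : y < 2) :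
    |fzE c κ y| ≤ y - 1 := by
  have : ⌊y⌋₊ = 1 := by
    rw [Nat.floor_eq_iff (by linarith)]; norm_num; exact ⟨hy, hy2⟩
  unfold fzE
  rw [if_neg (by linarith), this]
  simp only [Finset.Icc_self, Finset.sum_singleton, h.c1]
  have := h.k0; have := h.k1
  rw [abs_le]; constructor <;> nlinarith

theorem FZCoef.E_step {c κ C N f} (h : FZCoef c κ C N f) {y z : ℝ} (hy : 1 ≤ y) (hyz : y ≤ z) (hz : z < y + 1) :
    ∃ J : ℝ, fzE c κ z - fzE c κ y = J - κ * (z - y) ∧ (J = 0 ∨ (J = 1 ∧ ∃ n : ℕ, N < n ∧ y < n ∧ (n:ℝ) ≤ z)) := by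
  refine ⟨∑ k ∈ Finset.Icc 1 ⌊z⌋₊, c k - ∑ k ∈ Finset.Icc 1 ⌊y⌋₊, c k, ?_, ?_⟩
  · unfold fzE
    rw [if_neg (by linarith), if_neg (by linarith)]; ring
  · have h1 : ⌊y⌋₊ ≤ ⌊z⌋₊ := Nat.floor_mono hyz
    have h2 : ⌊z⌋₊ ≤ ⌊y⌋₊ + 1 := by
      rw [← Nat.floor_add_one (by linarith)]; exact Nat.floor_mono hz.le
    rcases (by omega : ⌊z⌋₊ = ⌊y⌋₊ ∨ ⌊z⌋₊ = ⌊y⌋₊ + 1) with h3 | h3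
    · left; rw [h3]; ring
    · rw [h3, Finset.sum_Icc_succ_top (by omega)]
      simp only [add_sub_cancel_left]
      rcases h.c01 (⌊y⌋₊ + 1) with h4 | h4
      · left; exact h4
      · right
        refine ⟨h4, ⌊y⌋₊ + 1, ?_, ?_, ?_⟩
        · by_contra hc
          have hy1 : 1 ≤ ⌊y⌋₊ := (Nat.one_le_floor_iff y).2 hy
          have := h.small (⌊y⌋₊ + 1) (by omega) (by omega)
          rw [this] at h4; norm_num at h4
        · push_cast; exact Nat.lt_floor_add_one y
        · rw [← h3]; exact Nat.floor_le (by linarith)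

set_option maxHeartbeats 2000000 in
theorem FZCoef.D_bd {c κ C N f} (h : FZCoef c κ C N f) {x δ T : ℝ} (hx0 : 0 < x) (hx : x ≤ 3/2)
    (hd0 : 0 ≤ δ) (hdx : δ ≤ x) (hd : δ ≤ 1/4) (hT : 4 ≤ T) (v : ℝ) :
    ((fzE c κ (Real.exp (v + 1/(4*T))) - fzE c κ (Real.exp v)) * Real.exp (-(1/2+x) * v)) ^ 2 ≤
    ∑ n ∈ Finset.Ioc N ⌊T⌋₊, (Ico (Real.log n - 1/(4*T)) (Real.log n)).indicator (fun _ => 6 * (n:ℝ) ^ (-(1+2*x))) v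
      + 4 * (C+3)^2 * (4/T)^(1+2*δ) * Real.exp (-(1/2) * |v - Real.log (T/4)|) := by
  set b := 1/(4*T) with hb
  set L := Real.log (T/4) with hL
  have hC := h.C0
  have hb0 : 0 < b := by positivity
  have hb1 : b ≤ 1/16 := by rw [hb]; rw [div_le_div_iff₀ (by positivity) (by norm_num)]; linarith
  have hL0 : 0 ≤ L := Real.log_nonneg (by linarith)
  have heL : Real.exp L = T/4 := Real.exp_log (by linarith)
  have hbL : b = Real.exp (-L) / 16 := by rw [Real.exp_neg, heL, hb]; field_simp; ring
  have hTd : (4/T)^(1+2*δ) = Real.exp (-(1+2*δ)*L) := by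
    rw [show (4/T) = Real.exp (-L) by rw [Real.exp_neg, heL, inv_div], ← Real.exp_mul]; ring_nf
  rw [hTd]
  have hsum : 0 ≤ ∑ n ∈ Finset.Ioc N ⌊T⌋₊, (Ico (Real.log n - b) (Real.log n)).indicator (fun _ => 6 * (n:ℝ) ^ (-(1+2*x))) v :=
    Finset.sum_nonneg fun n _ => indicator_nonneg (fun _ _ => by positivity) _
  have heb : Real.exp b - 1 ≤ 2 * b := by
    have := Real.abs_exp_sub_one_le (x := b) (by rw [abs_of_pos hb0]; linarith)
    rw [abs_of_pos hb0] at this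
    exact (le_abs_self _).trans this
  have heb0 : 0 ≤ Real.exp b - 1 := by linarith [Real.add_one_le_exp b]
  have hsq : Real.exp (-(1/2+x)*v) ^ 2 = Real.exp (-(1+2*x)*v) := by
    rw [← Real.exp_nat_mul]; congr 1; push_cast; ring
  rw [mul_pow, hsq]
  have hE0 : 0 < Real.exp (-(1+2*x)*v) := Real.exp_pos _
  have e1 : Real.exp 1 < 3 := Real.exp_one_lt_three
  rcases lt_or_ge v (-b) with hv | hv
  · rw [fz_E_zero c κ (y := Real.exp (v+b)), fz_E_zero c κ (y := Real.exp v)]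
    · simp only [sub_zero]; rw [zero_pow two_ne_zero, zero_mul]; positivity
    · rw [Real.exp_lt_one_iff]; linarith
    · rw [Real.exp_lt_one_iff]; linarith
  rcases lt_or_ge v 0 with hv0 | hv0
  · rw [fz_E_zero c κ (y := Real.exp v) (by rw [Real.exp_lt_one_iff]; linarith), sub_zero]
    have h1 : 1 ≤ Real.exp (v+b) := Real.one_le_exp (by linarith)
    have h2 : Real.exp (v+b) ≤ Real.exp b := Real.exp_le_exp.2 (by linarith)
    have h3 := h.E_near h1 (by linarith)
    have h4 : fzE c κ (Real.exp (v+b)) ^ 2 ≤ (2*b)^2 := by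
      rw [← sq_abs]; apply pow_le_pow_left₀ (abs_nonneg _); linarith
    have h5 : Real.exp (-(1+2*x)*v) ≤ 3 := by
      refine (Real.exp_le_exp.2 ?_).trans e1.le
      nlinarith
    have h6 : Real.exp (-2*L) * (1/2) ≤ Real.exp (-(1+2*δ)*L) * Real.exp (-(1/2) * |v - L|) := by
      rw [abs_of_nonpos (by linarith), ← Real.exp_add]
      have : Real.exp (-2*L) * Real.exp (-(1/2)) ≤ Real.exp (-(1+2*δ)*L + -(1/2)*-(v-L)) := by
        rw [← Real.exp_add, Real.exp_le_exp]; nlinarith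
      refine le_trans (mul_le_mul_of_nonneg_left ?_ (Real.exp_pos _).le) this
      have := Real.add_one_le_exp (-(1/2:ℝ)); linarith
    have h7 : (2*b)^2 = Real.exp (-2*L) / 64 := by
      rw [hbL, show -2*L = -L + -L by ring, Real.exp_add]; ring
    have h8 : fzE c κ (Real.exp (v+b)) ^ 2 * Real.exp (-(1+2*x)*v) ≤ (2*b)^2 * 3 :=
      mul_le_mul h4 h5 hE0.le (by positivity)
    have h9 : 4 * (C+3)^2 ≥ 1 := by nlinarith
    have h10 : 0 < Real.exp (-(1+2*δ)*L) * Real.exp (-(1/2) * |v - L|) := by positivity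
    have h11 : 0 < Real.exp (-2*L) := Real.exp_pos _
    nlinarith
  rcases le_or_gt v L with hvL | hvL
  · have hy : 1 ≤ Real.exp v := Real.one_le_exp hv0
    have hyz : Real.exp v ≤ Real.exp (v+b) := Real.exp_le_exp.2 (by linarith)
    have hdif : Real.exp (v+b) - Real.exp v ≤ 2*b*Real.exp v := by
      rw [Real.exp_add]; nlinarith
    have hvT : Real.exp v ≤ T/4 := by rw [← heL]; exact Real.exp_le_exp.2 hvL
    have hbT : 2*b*Real.exp v ≤ 1/8 := by
      calc 2*b*Real.exp v ≤ 2*b*(T/4) := by gcongr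
        _ = 1/8 := by rw [hb]; field_simp; ring
    obtain ⟨J, hJ, hJ2⟩ := h.E_step hy hyz (by linarith)
    rw [hJ]
    have hk0 := h.k0
    have hk1 := h.k1
    have hR : (κ * (Real.exp (v+b) - Real.exp v))^2 ≤ (2*b*Real.exp v)^2 := by
      apply pow_le_pow_left₀ (mul_nonneg hk0 (by linarith))
      calc κ * (Real.exp (v+b) - Real.exp v) ≤ 1 * (Real.exp (v+b) - Real.exp v) :=
            mul_le_mul_of_nonneg_right hk1 (by linarith)
        _ ≤ _ := by linarith
    have hJJ : (J - κ * (Real.exp (v+b) - Real.exp v))^2 ≤ 2*J^2 + 2*(2*b*Real.exp v)^2 := by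
      nlinarith [sq_nonneg (J + κ * (Real.exp (v+b) - Real.exp v))]
    have hA : 2*(2*b*Real.exp v)^2 * Real.exp (-(1+2*x)*v) ≤ Real.exp (-(1+2*δ)*L) * Real.exp (-(1/2) * |v - L|) := by
      have : (2*b*Real.exp v)^2 = Real.exp (-2*L + 2*v) / 64 := by
        rw [hbL, show -2*L+2*v = -L + -L + v + v by ring, Real.exp_add, Real.exp_add, Real.exp_add]; ring
      rw [this]
      have h2 : Real.exp (-2*L+2*v) * Real.exp (-(1+2*x)*v) ≤ Real.exp (-(1+2*δ)*L) * Real.exp (-(1/2) * |v - L|) := by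
        rw [← Real.exp_add, ← Real.exp_add, Real.exp_le_exp, abs_of_nonpos (by linarith)]
        nlinarith [mul_nonneg hd0 (sub_nonneg.2 hvL), mul_nonneg (sub_nonneg.2 hd) (sub_nonneg.2 hvL), mul_nonneg hv0 (sub_nonneg.2 hdx)]
      have h3 : 0 < Real.exp (-2*L+2*v) * Real.exp (-(1+2*x)*v) := by positivity
      nlinarith
    have hB : 2*J^2 * Real.exp (-(1+2*x)*v) ≤ ∑ n ∈ Finset.Ioc N ⌊T⌋₊, (Ico (Real.log n - b) (Real.log n)).indicator (fun _ => 6 * (n:ℝ) ^ (-(1+2*x))) v := by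
      rcases hJ2 with rfl | ⟨rfl, n, hn, hyn, hnz⟩
      · simpa using hsum
      · have hn0 : (0:ℝ) < n := by linarith
        have hnT : n ≤ ⌊T⌋₊ := Nat.le_floor (by linarith)
        have hmem : v ∈ Ico (Real.log n - b) (Real.log n) := by
          constructor
          · have := (Real.log_le_iff_le_exp hn0).2 hnz; linarith
          · exact (Real.lt_log_iff_exp_lt hn0).2 hyn
        refine le_trans ?_ (Finset.single_le_sum (f := fun n : ℕ => (Ico (Real.log n - b) (Real.log n)).indicator (fun _ => 6 * (n:ℝ) ^ (-(1+2*x))) v)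
          (fun n _ => indicator_nonneg (fun _ _ => by positivity) _) (Finset.mem_Ioc.2 ⟨hn, hnT⟩))
        simp only [indicator_of_mem hmem]
        rw [Real.rpow_def_of_pos hn0]
        have : Real.exp (-(1+2*x)*v) ≤ Real.exp (Real.log n * -(1+2*x)) * Real.exp 1 := by
          rw [← Real.exp_add, Real.exp_le_exp]
          have := hmem.1
          nlinarith
        have h3 : 0 < Real.exp (Real.log n * -(1+2*x)) := Real.exp_pos _
        nlinarith
    have h9 : 4 * (C+3)^2 ≥ 1 := by nlinarith
    have h10 : 0 < Real.exp (-(1+2*δ)*L) * Real.exp (-(1/2) * |v - L|) := by positivity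
    have h12 := mul_le_mul_of_nonneg_right hJJ hE0.le
    nlinarith
  · have h1 := h.Ebd (Real.exp (v+b))
    have h2 := h.Ebd (Real.exp v)
    have h3 : (fzE c κ (Real.exp (v+b)) - fzE c κ (Real.exp v))^2 ≤ (2*(C+3))^2 := by
      rw [abs_le] at h1 h2
      apply sq_le_sq'
      · linarith [h1.1, h2.2]
      · linarith [h1.2, h2.1]
    have h4 : Real.exp (-(1+2*x)*v) ≤ Real.exp (-(1+2*δ)*L) * Real.exp (-(1/2) * |v - L|) := by
      rw [← Real.exp_add, Real.exp_le_exp, abs_of_nonneg (by linarith)]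
      nlinarith [mul_nonneg hd0 (sub_nonneg.2 hvL.le), mul_nonneg hv0 (sub_nonneg.2 hdx)]
    have h5 := mul_le_mul h3 h4 hE0.le (by positivity)
    calc _ ≤ _ := h5
      _ = 0 + 4 * (C + 3) ^ 2 * Real.exp (-(1+2*δ)*L) * Real.exp (-(1/2) * |v - L|) := by ring
      _ ≤ _ := by gcongr

theorem FZCoef.D2 {c κ C N f} (h : FZCoef c κ C N f) {x δ T : ℝ} (hN : 1 ≤ N) (hx0 : 0 < x) (hx : x ≤ 3/2)
    (hd0 : 0 ≤ δ) (hdx : δ ≤ x) (hd : δ ≤ 1/4) (hT : 4 ≤ T) :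
    Integrable (fun v => ((fzE c κ (Real.exp (v + 1/(4*T))) - fzE c κ (Real.exp v)) * Real.exp (-(1/2+x) * v)) ^ 2) ∧
    ∫ v, ((fzE c κ (Real.exp (v + 1/(4*T))) - fzE c κ (Real.exp v)) * Real.exp (-(1/2+x) * v)) ^ 2 ≤
      (1/(4*T)) * (6 * ((N : ℝ) ^ (-(2 * x)) / (2 * x))) + 16 * (C+3)^2 * (4/T)^(1+2*δ) := by
  have hT0 : 0 < T := by linarith
  set b := 1/(4*T) with hb
  have hb0 : 0 < b := by positivity
  have hi1 : ∀ n ∈ Finset.Ioc N ⌊T⌋₊, Integrable ((Ico (Real.log n - b) (Real.log n)).indicator (fun _ => 6 * (n:ℝ) ^ (-(1+2*x)))) := by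
    intro n _
    rw [integrable_indicator_iff measurableSet_Ico]
    exact integrableOn_const (by simp)
  obtain ⟨k1, k2⟩ := fz_exp_abs (a := 1/2) (by norm_num)
  have hi2 : Integrable (fun v : ℝ => 4 * (C+3)^2 * (4/T)^(1+2*δ) * Real.exp (-(1/2) * |v - Real.log (T/4)|)) := by
    apply Integrable.const_mul
    exact k1.comp_sub_right (Real.log (T/4))
  have hi3 : Integrable (fun v : ℝ => ∑ n ∈ Finset.Ioc N ⌊T⌋₊, (Ico (Real.log n - b) (Real.log n)).indicator (fun _ => 6 * (n:ℝ) ^ (-(1+2*x))) v) :=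
    integrable_finsetSum _ hi1
  have hle := h.D_bd hx0 hx hd0 hdx hd hT
  have hmE := fzE_meas c κ
  have hm : Measurable (fun v => ((fzE c κ (Real.exp (v + 1/(4*T))) - fzE c κ (Real.exp v)) * Real.exp (-(1/2+x) * v)) ^ 2) := by
    have h1 : Measurable (fun v : ℝ => fzE c κ (Real.exp (v + 1/(4*T)))) := hmE.comp (by fun_prop)
    have h2 : Measurable (fun v : ℝ => fzE c κ (Real.exp v)) := hmE.comp (by fun_prop)
    exact ((h1.sub h2).mul (by fun_prop)).pow_const 2
  have hI : Integrable (fun v => ((fzE c κ (Real.exp (v + 1/(4*T))) - fzE c κ (Real.exp v)) * Real.exp (-(1/2+x) * v)) ^ 2) := by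
    refine (hi3.add hi2).mono' hm.aestronglyMeasurable (ae_of_all _ fun v => ?_)
    rw [Real.norm_of_nonneg (sq_nonneg _)]
    exact hle v
  refine ⟨hI, ?_⟩
  refine (integral_mono hI (hi3.add hi2) hle).trans ?_
  simp only [Pi.add_apply]
  rw [integral_add hi3 hi2, integral_finsetSum _ hi1, integral_const_mul]
  have e1 : ∫ v : ℝ, Real.exp (-(1/2) * |v - Real.log (T/4)|) = 4 := by
    rw [integral_sub_right_eq_self (fun v : ℝ => Real.exp (-(1/2) * |v|)), k2]; norm_num
  have e2 : ∀ n ∈ Finset.Ioc N ⌊T⌋₊, ∫ v, (Ico (Real.log n - b) (Real.log n)).indicator (fun _ => 6 * (n:ℝ) ^ (-(1+2*x))) v = (b * 6) * (n:ℝ) ^ (-(1+2*x)) := by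
    intro n _
    rw [integral_indicator measurableSet_Ico, setIntegral_const, smul_eq_mul, Real.volume_real_Ico_of_le (by linarith)]
    ring
  rw [e1, Finset.sum_congr rfl e2, ← Finset.mul_sum]
  have := fz_psum (m := ⌊T⌋₊) hN hx0
  have h3 := mul_le_mul_of_nonneg_left this (by positivity : 0 ≤ b * 6)
  nlinarith

theorem FZCoef.F_int {c κ C N f} (h : FZCoef c κ C N f) {σ : ℝ} (hs : 0 < σ) :
    Integrable (fun v => fzE c κ (Real.exp v) * Real.exp (-σ * v)) := by
  have := ((fz_exp_abs hs).1.const_mul (C+3))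
  refine this.mono' (((fzE_meas c κ).comp Real.measurable_exp).mul (by fun_prop)).aestronglyMeasurable (ae_of_all _ fun v => ?_)
  rw [norm_mul, Real.norm_eq_abs, Real.norm_eq_abs, abs_of_pos (Real.exp_pos _)]
  rcases lt_or_ge v 0 with hv | hv
  · rw [fz_E_zero c κ (by rwa [Real.exp_lt_one_iff])]
    have := h.C0
    simp; positivity
  · rw [abs_of_nonneg hv]
    gcongr
    exact h.Ebd _

theorem FZCoef.D_tr {c κ C N f} (h : FZCoef c κ C N f) {σ : ℝ} (hs : 0 < σ) (b t : ℝ) :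
    Integrable (fun v => (fzE c κ (Real.exp (v + b)) - fzE c κ (Real.exp v)) * Real.exp (-σ * v)) ∧
    ∫ v : ℝ, (((fzE c κ (Real.exp (v + b)) - fzE c κ (Real.exp v)) * Real.exp (-σ * v) : ℝ) : ℂ) * cexp (-(t * v) * I)
     = (cexp ((σ + t * I) * b) - 1) * ∫ v : ℝ, ((fzE c κ (Real.exp v) * Real.exp (-σ * v) : ℝ) : ℂ) * cexp (-(t * v) * I) := by
  have h1 := h.F_int hs
  have e : ∀ v, (fzE c κ (Real.exp (v + b)) - fzE c κ (Real.exp v)) * Real.exp (-σ * v) =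
      Real.exp (σ * b) * (fzE c κ (Real.exp (v + b)) * Real.exp (-σ * (v + b))) - fzE c κ (Real.exp v) * Real.exp (-σ * v) := by
    intro v
    have : Real.exp (-σ * v) = Real.exp (σ * b) * Real.exp (-σ * (v + b)) := by
      rw [← Real.exp_add]; congr 1; ring
    rw [sub_mul]
    nth_rewrite 1 [this]
    ring
  have h2 := (h1.comp_add_right b).const_mul (Real.exp (σ * b))
  refine ⟨(h2.sub h1).congr (ae_of_all _ fun v => (e v).symm), ?_⟩
  have hc : ∀ {u : ℝ → ℝ}, Integrable u → Integrable (fun v : ℝ => (u v : ℂ) * cexp (-(t * v) * I)) := by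
    intro u hu
    refine Integrable.mul_bdd (c := 1) (g := fun v : ℝ => cexp (-(t * v) * I)) hu.ofReal (by fun_prop) (ae_of_all _ fun v => ?_)
    have : -((t:ℂ) * v) * I = ((-(t * v) : ℝ) : ℂ) * I := by push_cast; ring
    rw [this, Complex.norm_exp_ofReal_mul_I]
  set G : ℝ → ℂ := fun v => ((fzE c κ (Real.exp v) * Real.exp (-σ * v) : ℝ) : ℂ) * cexp (-(t * v) * I) with hG
  have hGi : Integrable G := hc h1
  have e2 : ∀ v : ℝ, (((fzE c κ (Real.exp (v + b)) - fzE c κ (Real.exp v)) * Real.exp (-σ * v) : ℝ) : ℂ) * cexp (-(t * v) * I)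
     = cexp ((σ + t * I) * b) * G (v + b) - G v := by
    intro v
    rw [e v, hG]
    have : cexp (-(t * v) * I) = cexp (t * I * b) * cexp (-(t * (v + b : ℝ)) * I) := by
      rw [← Complex.exp_add]; congr 1; push_cast; ring
    simp only []
    push_cast
    rw [add_mul, Complex.exp_add]
    push_cast at this
    rw [sub_mul]
    nth_rewrite 1 [this]
    ring_nf
  simp_rw [e2]
  rw [integral_sub ((hGi.comp_add_right b).const_mul _) hGi, integral_const_mul, integral_add_right_eq_self G b]
  ring

theorem fz_ms {c κ C N f} (h : FZCoef c κ C N f) {x δ T : ℝ} (hN : 1 ≤ N) (hx0 : 0 < x) (hx : x ≤ 3/2)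
    (hd0 : 0 ≤ δ) (hdx : δ ≤ x) (hd : δ ≤ 1/4) (hT : 4 ≤ T) :
    ∫ t in Icc 1 T, ‖f ((1/2 + x : ℝ) + t * I) - 1‖ ^ 2 ≤
      4000 * T * ((N : ℝ) ^ (-(2 * x)) / (2 * x)) + 300000 * (C+3)^2 * T * T ^ (-(2*δ)) + 2 := by
  have hT0 : 0 < T := by linarith
  set σ : ℝ := 1/2 + x with hσ
  have hσ0 : 0 < σ := by linarith
  set b := 1/(4*T) with hb
  have hb0 : 0 < b := by positivity
  obtain ⟨i2, v2⟩ := h.D2 hN hx0 hx hd0 hdx hd hT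
  have htr := fun t => h.D_tr hσ0 b t
  obtain ⟨i3, v3⟩ := fz_bessel (htr 0).1 i2 hT0
  set A : ℝ → ℂ := fun t => ∫ v : ℝ, ((fzE c κ (Real.exp v) * Real.exp (-σ * v) : ℝ) : ℂ) * cexp (-(t * v) * I) with hA
  set Dh : ℝ → ℝ := fun t => ‖∫ v : ℝ, (((fzE c κ (Real.exp (v + b)) - fzE c κ (Real.exp v)) * Real.exp (-σ * v) : ℝ) : ℂ) * cexp (-(t * v) * I)‖ ^ 2 with hDh
  have i3' : IntegrableOn Dh (Icc 1 T) := i3.mono_set (Icc_subset_Icc_left zero_le_one)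
  have i4 : IntegrableOn (fun t : ℝ => 2 * t ^ (-2:ℝ)) (Icc 1 T) := by
    apply ContinuousOn.integrableOn_compact isCompact_Icc
    intro t ht
    have : t ≠ 0 := by linarith [ht.1]
    exact (continuousAt_const.mul (Real.continuousAt_rpow_const _ _ (Or.inl this))).continuousWithinAt
  have v4 : ∫ t in Icc 1 T, 2 * t ^ (-2:ℝ) ≤ 2 := by
    rw [integral_Icc_eq_integral_Ioc, ← intervalIntegral.integral_of_le (by linarith),
      intervalIntegral.integral_const_mul, integral_rpow (Or.inr ⟨by norm_num, ?_⟩)]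
    · norm_num
      have : 0 ≤ T ^ (-1:ℝ) := by positivity
      linarith
    · rw [uIcc_of_le (by linarith)]; intro h; linarith [h.1]
  have key : ∀ t ∈ Icc 1 T, ‖f (σ + t * I) - 1‖ ^ 2 ≤ 8 / b ^ 2 * Dh t + 2 * t ^ (-2:ℝ) := by
    intro t ht
    have ht0 : 0 < t := by linarith [ht.1]
    have e := fz_rep h hσ0 ht0
    rw [e]
    set s : ℂ := σ + t * I with hs
    have hst : t ≤ ‖s‖ := by
      have := Complex.abs_im_le_norm s
      simp [hs] at this
      exact (le_abs_self t).trans this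
    have hst1 : t ≤ ‖s - 1‖ := by
      have := Complex.abs_im_le_norm (s - 1)
      simp [hs] at this
      exact (le_abs_self t).trans this
    have hs2 : ‖s‖ ≤ 2 * T := by
      calc ‖s‖ ≤ ‖(σ:ℂ)‖ + ‖t * I‖ := norm_add_le _ _
        _ = σ + t := by simp [abs_of_pos hσ0, abs_of_pos ht0]
        _ ≤ 2 * T := by linarith [ht.2]
    have hsb : ‖s * b‖ = ‖s‖ * b := by rw [norm_mul, Complex.norm_real, Real.norm_of_nonneg hb0.le]
    have hsb2 : ‖s‖ * b ≤ 1/2 := by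
      calc ‖s‖ * b ≤ 2 * T * b := by gcongr
        _ = 1/2 := by rw [hb]; field_simp; norm_num
    have hexp : ‖s‖ * b / 2 ≤ ‖cexp (s * b) - 1‖ := by
      have h1 := Complex.norm_exp_sub_one_sub_id_le (x := s * b) (by rw [hsb]; linarith)
      rw [hsb] at h1
      have h2 : ‖s * b‖ ≤ ‖cexp (s * b) - 1‖ + ‖cexp (s * b) - 1 - s * b‖ := by
        have := norm_sub_le (cexp (s * b) - 1) (cexp (s * b) - 1 - s * b)
        simpa using this
      rw [hsb] at h2
      nlinarith [mul_nonneg (norm_nonneg s) hb0.le]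
    have hD : Dh t = (‖cexp (s * b) - 1‖ * ‖A t‖) ^ 2 := by
      rw [hDh]; simp only []; rw [(htr t).2, norm_mul]
    have h5 : ‖s * A t‖ ^ 2 ≤ 4 / b ^ 2 * Dh t := by
      rw [hD, norm_mul]
      have : (‖s‖ * b / 2 * ‖A t‖) ^ 2 ≤ (‖cexp (s * b) - 1‖ * ‖A t‖) ^ 2 := by gcongr
      calc (‖s‖ * ‖A t‖) ^ 2 = 4 / b ^ 2 * (‖s‖ * b / 2 * ‖A t‖) ^ 2 := by field_simp; norm_num
        _ ≤ _ := by gcongr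
    have h6 : ‖(κ:ℂ) / (s - 1)‖ ^ 2 ≤ t ^ (-2:ℝ) := by
      rw [norm_div, Complex.norm_real, Real.norm_of_nonneg h.k0, Real.rpow_neg ht0.le]
      have : κ / ‖s - 1‖ ≤ 1 / t := div_le_div₀ zero_le_one h.k1 ht0 hst1
      calc (κ / ‖s - 1‖) ^ 2 ≤ (1 / t) ^ 2 := pow_le_pow_left₀ (div_nonneg h.k0 (norm_nonneg _)) this 2
        _ = _ := by rw [show (2:ℝ) = ((2:ℕ):ℝ) by norm_num, Real.rpow_natCast]; simp
    have h7 : ‖1 + (κ:ℂ) / (s - 1) + s * A t - 1‖ ≤ ‖(κ:ℂ) / (s - 1)‖ + ‖s * A t‖ := by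
      rw [show 1 + (κ:ℂ) / (s - 1) + s * A t - 1 = (κ:ℂ) / (s - 1) + s * A t by ring]
      exact norm_add_le _ _
    have h8 := pow_le_pow_left₀ (norm_nonneg _) h7 2
    have h9 : 8 / b ^ 2 * Dh t = 2 * (4 / b ^ 2 * Dh t) := by ring
    rw [h9]
    nlinarith [sq_nonneg (‖(κ:ℂ) / (s - 1)‖ - ‖s * A t‖)]
  have i5 : IntegrableOn (fun t => 8 / b ^ 2 * Dh t) (Icc 1 T) := i3'.const_mul _
  have i0 : IntegrableOn (fun t : ℝ => ‖f (σ + t * I) - 1‖ ^ 2) (Icc 1 T) := by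
    apply ContinuousOn.integrableOn_compact isCompact_Icc
    intro t ht
    have hd : ContinuousAt f (σ + t * I) := (h.diff _ (by simp; linarith [ht.1])).continuousAt
    have : ContinuousAt (fun t : ℝ => f (σ + t * I)) t :=
      ContinuousAt.comp (f := fun t : ℝ => (σ + t * I : ℂ)) hd (by fun_prop)
    exact ((this.sub continuousAt_const).norm.pow 2).continuousWithinAt
  have hfin : ∫ t in Icc 1 T, ‖f (σ + t * I) - 1‖ ^ 2 ≤ 8 / b ^ 2 * (∫ t in Icc 1 T, Dh t) + 2 := by
    have hm := setIntegral_mono_on i0 (i5.add i4) measurableSet_Icc key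
    refine hm.trans ?_
    simp only [Pi.add_apply]
    rw [integral_add i5 i4, integral_const_mul]
    linarith
  have v3' : ∫ t in Icc 1 T, Dh t ≤ ∫ t in Icc 0 T, Dh t :=
    setIntegral_mono_set i3 (ae_of_all _ fun t => by simp only [hDh]; positivity) (Icc_subset_Icc_left zero_le_one).eventuallyLE
  refine hfin.trans ?_
  have hpow : (4/T)^(1+2*δ) ≤ 8 / T * T ^ (-(2*δ)) := by
    rw [Real.div_rpow (by norm_num) hT0.le, Real.rpow_add hT0, Real.rpow_one, Real.rpow_neg hT0.le]
    have h4 : (4:ℝ) ^ (1+2*δ) ≤ 8 := by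
      calc (4:ℝ) ^ (1+2*δ) ≤ 4 ^ (3/2:ℝ) := Real.rpow_le_rpow_of_exponent_le (by norm_num) (by linarith)
        _ = 8 := by
          rw [show (4:ℝ) = 2 ^ (2:ℝ) by norm_num, ← Real.rpow_mul (by norm_num)]; norm_num
    rw [div_le_iff₀ (by positivity)]
    have : 0 < T ^ (2*δ) := by positivity
    field_simp
    exact h4
  have hS : 0 ≤ (N : ℝ) ^ (-(2 * x)) / (2 * x) := by positivity
  set S := (N : ℝ) ^ (-(2 * x)) / (2 * x)
  set R := T ^ (-(2*δ))
  have hR : 0 < R := by positivity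
  have hall : ∫ t in Icc 1 T, Dh t ≤ 18 * (b * (6 * S) + 16 * (C+3)^2 * (8 / T * R)) := by
    refine (v3'.trans v3).trans ?_
    gcongr
    refine v2.trans ?_
    gcongr
  calc 8 / b ^ 2 * (∫ t in Icc 1 T, Dh t) + 2 ≤ 8 / b ^ 2 * (18 * (b * (6 * S) + 16 * (C+3)^2 * (8 / T * R))) + 2 := by gcongr
    _ = 3456 * T * S + 294912 * (C+3)^2 * T * R + 2 := by rw [hb]; field_simp; ring
    _ ≤ _ := by gcongr <;> norm_num

theorem fz_rpow_quarter {a y : ℝ} (ha : 1 < a) (hy : 0 < y) : a ^ (-y) ≤ (y * Real.log a) ^ (-(1/4):ℝ) := by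
  have hl : 0 < Real.log a := Real.log_pos ha
  have hu : 0 < y * Real.log a := by positivity
  set u := y * Real.log a with hu'
  have e : a ^ (-y) = Real.exp (-u) := by
    rw [Real.rpow_def_of_pos (by linarith), hu']; congr 1; ring
  rw [e, Real.rpow_neg hu.le, Real.exp_neg]
  have h1 : u ^ (1/4:ℝ) ≤ Real.exp u := by
    calc u ^ (1/4:ℝ) ≤ (Real.exp u) ^ (1/4:ℝ) :=
          Real.rpow_le_rpow hu.le (by linarith [Real.add_one_le_exp u]) (by norm_num)
      _ = Real.exp (u * (1/4)) := by rw [← Real.exp_mul]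
      _ ≤ Real.exp u := Real.exp_le_exp.2 (by linarith)
  exact inv_anti₀ (by positivity) h1

theorem fzF_cont (N : ℕ) : ContinuousOn (fzF N) {s | 0 < s.im} := by
  obtain ⟨c, κ, C, h⟩ := fz_coef N
  exact fun s hs => (h.diff s hs).continuousAt.continuousWithinAt

theorem fz_log_tend {k : ℝ} (hk : 0 < k) {ι : Type} {l : Filter ι} {g : ι → ℝ} (hg : Tendsto g l atTop) :
    Tendsto (fun n => (k * Real.log (g n)) ^ (-(1/4):ℝ)) l (nhds 0) := by
  have h1 : Tendsto (fun n => k * Real.log (g n)) l atTop := (Real.tendsto_log_atTop.comp hg).const_mul_atTop hk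
  exact (tendsto_rpow_neg_atTop (by norm_num : (0:ℝ) < 1/4)).comp h1

set_option maxHeartbeats 1000000 in
theorem fz_l1 (ε : ℝ) (hε : 0 < ε) : ∃ N0 : ℕ, ∀ N ≥ N0, ∃ T0 : ℝ, ∀ T ≥ T0, ∀ x : ℝ, 0 < x → x ≤ 3/2 →
    ∫ t in Icc 1 T, ‖fzF N ((1/2 + x : ℝ) + t * I) - 1‖ ≤ ε * T * x ^ (-(3/4):ℝ) := by
  have hN := (fz_log_tend (k := 2) (by norm_num) (tendsto_natCast_atTop_atTop (R := ℝ))).eventually (gt_mem_nhds (show 0 < ε^2/8000 by positivity))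
  obtain ⟨N0, hN0⟩ := eventually_atTop.1 (hN.and (eventually_ge_atTop 2))
  refine ⟨N0, fun N hNN => ?_⟩
  obtain ⟨hN1, hN2⟩ := hN0 N hNN
  obtain ⟨c, κ, C, h⟩ := fz_coef N
  have hC := h.C0
  have hB : 0 < (C+3)^2 := by positivity
  have hT := (fz_log_tend (k := 1/3) (by norm_num) (tendsto_id (α := ℝ) (x := atTop))).eventually (gt_mem_nhds (show 0 < ε^2/(8000000 * (C+3)^2) by positivity))
  obtain ⟨T0, hT0⟩ := eventually_atTop.1 ((hT.and (eventually_ge_atTop 4)).and (eventually_ge_atTop (1000/ε^2)))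
  refine ⟨T0, fun T hTT x hx0 hx => ?_⟩
  obtain ⟨⟨hT1, hT4⟩, hTe⟩ := hT0 T hTT
  have hTp : 0 < T := by linarith
  have hms := fz_ms h (N := N) (x := x) (δ := x/6) (T := T) (by omega) hx0 hx (by linarith) (by linarith) (by linarith) hT4
  have hN2' : (1:ℝ) < N := by exact_mod_cast (by omega : 1 < N)
  -- pieces
  have q1 : (N:ℝ) ^ (-(2*x)) ≤ x ^ (-(1/4):ℝ) * (ε^2/8000) := by
    refine (fz_rpow_quarter hN2' (by linarith)).trans ?_
    rw [show 2 * x * Real.log N = x * (2 * Real.log N) by ring, Real.mul_rpow hx0.le (by have := Real.log_pos hN2'; positivity)]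
    gcongr
  have q2 : T ^ (-(2*(x/6))) ≤ x ^ (-(1/4):ℝ) * (ε^2/(8000000 * (C+3)^2)) := by
    have hl := Real.log_pos (show 1 < T by linarith)
    refine (fz_rpow_quarter (show 1 < T by linarith) (by linarith)).trans ?_
    rw [show 2 * (x/6) * Real.log T = x * (1/3 * Real.log T) by ring, Real.mul_rpow hx0.le (by positivity)]
    gcongr
    exact hT1.le
  set X := x ^ (-(3/4):ℝ) with hX
  have hX0 : 0 < X := by positivity
  have pw : ∀ r : ℝ, 0 ≤ r → r ≤ 2 → x ^ r ≤ 2.25 := by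
    intro r h0 h2
    calc x ^ r ≤ (3/2:ℝ) ^ r := Real.rpow_le_rpow hx0.le hx h0
      _ ≤ (3/2:ℝ) ^ (2:ℝ) := Real.rpow_le_rpow_of_exponent_le (by norm_num) h2
      _ = 2.25 := by norm_num
  have p1 : x ^ (-(1/2):ℝ) ≤ 2.25 * X := by
    rw [show (-(1/2):ℝ) = 1/4 + -(3/4) by norm_num, Real.rpow_add hx0]
    exact mul_le_mul_of_nonneg_right (pw _ (by norm_num) (by norm_num)) hX0.le
  have p2 : x ^ (1/2:ℝ) * (x ^ (-(1/4):ℝ) / x) = X := by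
    rw [← Real.rpow_sub_one hx0.ne', ← Real.rpow_add hx0, hX]; norm_num
  have p3 : x ^ (1/2:ℝ) * x ^ (-(1/4):ℝ) ≤ 2.25 * X := by
    rw [← Real.rpow_add hx0, show (1/2 + -(1/4):ℝ) = 1 + -(3/4) by norm_num, Real.rpow_add hx0]
    exact mul_le_mul_of_nonneg_right (pw _ (by norm_num) (by norm_num)) hX0.le
  have p4 : x ^ (1/2:ℝ) ≤ 2.25 * X := by
    rw [show (1/2:ℝ) = 5/4 + -(3/4) by norm_num, Real.rpow_add hx0]
    exact mul_le_mul_of_nonneg_right (pw _ (by norm_num) (by norm_num)) hX0.le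
  set lam := ε/4 * x ^ (-(1/2):ℝ) with hlam
  have hl0 : 0 < lam := by positivity
  have hli : 1 / (2 * lam) = 2 / ε * x ^ (1/2:ℝ) := by
    rw [hlam, Real.rpow_neg hx0.le]; field_simp; norm_num
  have hcont : ContinuousOn (fun t : ℝ => fzF N ((1/2 + x : ℝ) + t * I) - 1) (Icc 1 T) := by
    refine ContinuousOn.sub ?_ continuousOn_const
    refine (fzF_cont N).comp (by fun_prop) ?_
    intro t ht
    have : 0 < t := by linarith [ht.1]
    simpa using this
  have i1 : IntegrableOn (fun t : ℝ => ‖fzF N ((1/2 + x : ℝ) + t * I) - 1‖) (Icc 1 T) :=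
    hcont.norm.integrableOn_compact isCompact_Icc
  have i2 : IntegrableOn (fun t : ℝ => 1 / (2 * lam) * ‖fzF N ((1/2 + x : ℝ) + t * I) - 1‖ ^ 2) (Icc 1 T) :=
    ((hcont.norm.pow 2).integrableOn_compact isCompact_Icc).const_mul _
  have i3 : IntegrableOn (fun t : ℝ => lam / 2) (Icc 1 T) := integrableOn_const (by simp)
  have hmono := setIntegral_mono_on i1 (i3.add i2) measurableSet_Icc (fun t _ => by
    simp only [Pi.add_apply]
    set w := ‖fzF N ((1/2 + x : ℝ) + t * I) - 1‖
    have : lam / 2 + 1 / (2 * lam) * w ^ 2 - w = (lam - w) ^ 2 / (2 * lam) := by field_simp; ring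
    have h2 : 0 ≤ (lam - w) ^ 2 / (2 * lam) := by positivity
    linarith)
  refine hmono.trans ?_
  simp only [Pi.add_apply]
  rw [integral_add i3 i2, integral_const_mul, setIntegral_const, Real.volume_real_Icc_of_le (by linarith), hli, smul_eq_mul]
  have hms2 := mul_le_mul_of_nonneg_left hms (by positivity : 0 ≤ 2 / ε * x ^ (1/2:ℝ))
  have r1 : (T - 1) * (lam / 2) ≤ T * (ε * 0.29 * X) := by
    rw [hlam]
    have : (T-1) * (ε / 4 * x ^ (-(1/2):ℝ) / 2) ≤ T * (ε / 4 * (2.25 * X) / 2) := by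
      gcongr; linarith
    refine this.trans ?_
    have : 0 < T * ε * X := by positivity
    nlinarith
  have r2 : 2 / ε * x ^ (1/2:ℝ) * (4000 * T * ((N : ℝ) ^ (-(2 * x)) / (2 * x))) ≤ T * (ε * 0.5 * X) := by
    calc 2 / ε * x ^ (1/2:ℝ) * (4000 * T * ((N : ℝ) ^ (-(2 * x)) / (2 * x)))
        ≤ 2 / ε * x ^ (1/2:ℝ) * (4000 * T * ((x ^ (-(1/4):ℝ) * (ε^2/8000)) / (2 * x))) := by gcongr
      _ = T * (ε * 0.5 * (x ^ (1/2:ℝ) * (x ^ (-(1/4):ℝ) / x))) := by field_simp; norm_num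
      _ = _ := by rw [p2]
  have r3 : 2 / ε * x ^ (1/2:ℝ) * (300000 * (C+3)^2 * T * T ^ (-(2*(x/6)))) ≤ T * (ε * 0.17 * X) := by
    calc 2 / ε * x ^ (1/2:ℝ) * (300000 * (C+3)^2 * T * T ^ (-(2*(x/6))))
        ≤ 2 / ε * x ^ (1/2:ℝ) * (300000 * (C+3)^2 * T * (x ^ (-(1/4):ℝ) * (ε^2/(8000000 * (C+3)^2)))) := by gcongr
      _ = T * (ε * 0.075 * (x ^ (1/2:ℝ) * x ^ (-(1/4):ℝ))) := by field_simp; norm_num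
      _ ≤ T * (ε * 0.075 * (2.25 * X)) := by gcongr
      _ ≤ _ := by
        have : 0 < T * ε * X := by positivity
        nlinarith
  have r4 : 2 / ε * x ^ (1/2:ℝ) * 2 ≤ T * (ε * 0.01 * X) := by
    have h1 : 1000 ≤ T * ε^2 := by
      have := (div_le_iff₀ (by positivity : 0 < ε^2)).1 hTe; linarith
    calc 2 / ε * x ^ (1/2:ℝ) * 2 ≤ 2 / ε * (2.25 * X) * 2 := by gcongr
      _ = 9 / ε * X := by ring
      _ ≤ (T * ε^2 * 0.01) / ε * X := by gcongr; linarith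
      _ = _ := by field_simp
  have : 0 < T * ε * X := by positivity
  nlinarith

theorem fz_cont_rect (N : ℕ) {a b c d : ℝ} (hc : 0 < c) :
    ContinuousOn (fun p : ℝ × ℝ => fzF N (p.1 + p.2 * I)) (Icc a b ×ˢ Icc c d) := by
  refine (fzF_cont N).comp (by fun_prop) ?_
  intro p hp
  have : 0 < p.2 := by linarith [hp.2.1]
  simpa using this

theorem fz_int_rect (N : ℕ) {a b c d : ℝ} (hc : 0 < c) :
    IntegrableOn (fun p : ℝ × ℝ => ‖fzF N (p.1 + p.2 * I) - 1‖) (Icc a b ×ˢ Icc c d) :=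
  (((fz_cont_rect N hc).sub continuousOn_const).norm).integrableOn_compact (isCompact_Icc.prod isCompact_Icc)

theorem fz_l1d (ε : ℝ) (hε : 0 < ε) : ∃ N0 : ℕ, ∀ N ≥ N0, ∃ T0 : ℝ, ∀ T ≥ T0,
    ∫ p in Icc (1/2:ℝ) 2 ×ˢ Icc 1 T, ‖fzF N (p.1 + p.2 * I) - 1‖ ≤ ε * T := by
  obtain ⟨N0, h0⟩ := fz_l1 (ε/6) (by positivity)
  refine ⟨N0, fun N hN => ?_⟩
  obtain ⟨T0, h1⟩ := h0 N hN
  refine ⟨max T0 1, fun T hT => ?_⟩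
  have hT0 : T0 ≤ T := le_trans (le_max_left _ _) hT
  have hT1 : 1 ≤ T := le_trans (le_max_right _ _) hT
  have hI := fz_int_rect N (a := 1/2) (b := 2) (c := 1) (d := T) one_pos
  rw [fz_prod_xy (by norm_num) hT1 hI]
  have i2 : IntervalIntegrable (fun σ : ℝ => (ε/6) * T * (σ - 1/2) ^ (-(3/4):ℝ)) volume (1/2) 2 := by
    apply IntervalIntegrable.const_mul
    have := (intervalIntegral.intervalIntegrable_rpow' (a := 0) (b := 3/2) (r := -(3/4)) (by norm_num)).comp_sub_right (1/2)
    norm_num at this ⊢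
    exact this
  have i1 : IntervalIntegrable (fun σ : ℝ => ∫ y in (1:ℝ)..T, ‖fzF N ((σ:ℂ) + (y:ℂ) * I) - 1‖) volume (1/2) 2 := by
    rw [intervalIntegrable_iff_integrableOn_Icc_of_le (by norm_num)]
    have h2 : Integrable (fun p : ℝ × ℝ => ‖fzF N (p.1 + p.2 * I) - 1‖) ((volume.restrict (Icc (1/2:ℝ) 2)).prod (volume.restrict (Icc 1 T))) := by
      rw [Measure.prod_restrict]; exact hI
    have := h2.integral_prod_left
    refine this.congr (ae_of_all _ fun σ => ?_)
    simp only []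
    rw [intervalIntegral.integral_of_le hT1, integral_Icc_eq_integral_Ioc]
  refine (intervalIntegral.integral_mono_on_of_le_Ioo (by norm_num) i1 i2 ?_).trans ?_
  · intro σ hσ
    have := h1 T hT0 (σ - 1/2) (by linarith [hσ.1]) (by linarith [hσ.2])
    rw [intervalIntegral.integral_of_le hT1, ← integral_Icc_eq_integral_Ioc]
    simpa using this
  · rw [intervalIntegral.integral_const_mul, intervalIntegral.integral_comp_sub_right (fun u : ℝ => u ^ (-(3/4):ℝ)) (1/2),
      integral_rpow (Or.inl (by norm_num))]
    have h3 : (3/2:ℝ) ^ (1/4:ℝ) ≤ 3/2 := by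
      calc (3/2:ℝ) ^ (1/4:ℝ) ≤ (3/2:ℝ) ^ (1:ℝ) := Real.rpow_le_rpow_of_exponent_le (by norm_num) (by norm_num)
        _ = _ := by norm_num
    norm_num at h3 ⊢
    have : 0 < ε / 6 * T := by positivity
    nlinarith

theorem fz_sig2 {N : ℕ} (hN : 1 ≤ N) {s : ℂ} (hs : 2 ≤ s.re) : ‖fzF N s - 1‖ ≤ 1 / N := by
  obtain ⟨c, κ, C, h⟩ := fz_coef N
  rw [← h.ser s (by linarith)]
  have hsum : LSeriesSummable (fun n => (c n : ℂ)) s := by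
    refine LSeriesSummable_of_bounded_of_one_lt_re (m := 1) (fun n _ => ?_) (by linarith)
    rcases h.c01 n with h | h <;> simp [h]
  have hu0 : ∀ n, 0 ≤ (fun n : ℕ => if n ≤ N then (0:ℝ) else ((n:ℝ)^2)⁻¹) n := fun n => by
    simp only []; split_ifs <;> positivity
  have hub : ∀ m, ∑ n ∈ Finset.range m, (fun n : ℕ => if n ≤ N then (0:ℝ) else ((n:ℝ)^2)⁻¹) n ≤ 1 / N := by
    intro m
    rcases le_or_gt m N with hm | hm
    · rw [Finset.sum_eq_zero]; positivity
      intro n hn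
      have := Finset.mem_range.1 hn
      rw [if_pos (by omega)]
    · have h1 := sum_Ioc_inv_sq_le_sub (α := ℝ) (k := N) (n := m) (by omega) (by omega)
      have h2 : ∑ n ∈ Finset.range m, (fun n : ℕ => if n ≤ N then (0:ℝ) else ((n:ℝ)^2)⁻¹) n ≤ ∑ n ∈ Finset.Ioc N m, ((n:ℝ)^2)⁻¹ := by
        simp only []
        rw [Finset.sum_ite, Finset.sum_const_zero, zero_add]
        refine Finset.sum_le_sum_of_subset_of_nonneg ?_ fun _ _ _ => by positivity
        intro n hn
        simp at hn ⊢; omega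
      have h3 : 0 ≤ (m:ℝ)⁻¹ := by positivity
      rw [one_div]; linarith
  have hus : Summable (fun n : ℕ => if n ≤ N then (0:ℝ) else ((n:ℝ)^2)⁻¹) :=
    summable_of_sum_range_le hu0 hub
  have hut := Real.tsum_le_of_sum_range_le hu0 hub
  have e : LSeries (fun n => (c n : ℂ)) s - 1 = ∑' n, (LSeries.term (fun n => (c n : ℂ)) s n - if n = 1 then 1 else 0) := by
    have h1 : HasSum (fun n : ℕ => if n = 1 then (1:ℂ) else 0) 1 := hasSum_ite_eq 1 1
    have h2 := hsum.hasSum.sub h1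
    rw [← h2.tsum_eq.symm] 
    rfl
  rw [e]
  refine (tsum_of_norm_bounded hus.hasSum fun n => ?_).trans hut
  rcases eq_or_ne n 0 with rfl | hn0
  · simp
  rw [LSeries.term_of_ne_zero hn0]
  rcases eq_or_ne n 1 with rfl | hn1
  · simp [h.c1, hN]
  rw [if_neg hn1, sub_zero]
  split_ifs with hnN
  · rw [h.small n (by omega) hnN]; simp
  · have hnp : (1:ℝ) ≤ n := by exact_mod_cast Nat.one_le_iff_ne_zero.2 hn0
    rw [norm_div, Complex.norm_natCast_cpow_of_pos (by omega), ← one_div]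
    apply div_le_div₀ zero_le_one ?_ (by positivity) ?_
    · rcases h.c01 n with h | h <;> simp [h]
    · calc (n:ℝ)^2 = (n:ℝ)^(2:ℝ) := by norm_num
        _ ≤ _ := Real.rpow_le_rpow_of_exponent_le hnp hs

theorem fz_log_le (z : ℂ) : Real.log ‖z‖ ≤ ‖z - 1‖ := by
  have h1 : ‖z‖ ≤ ‖z - 1‖ + 1 := by
    have := norm_add_le (z - 1) 1; simpa using this
  rcases eq_or_ne z 0 with rfl | hz
  · simp
  have := Real.log_le_sub_one_of_pos (norm_pos_iff.2 hz)
  linarith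

theorem fz_abslog_le {z : ℂ} (hz : ‖z - 1‖ ≤ 1/2) : |Real.log ‖z‖| ≤ 2 * ‖z - 1‖ := by
  have h1 : 1 ≤ ‖z‖ + ‖z - 1‖ := by
    have := norm_sub_le z (z - 1); simpa using this
  have hzp : 1/2 ≤ ‖z‖ := by linarith
  rw [abs_le]
  constructor
  · have h2 := Real.one_sub_inv_le_log_of_pos (show 0 < ‖z‖ by linarith)
    have h3 : ‖z‖⁻¹ ≤ 1 + 2 * ‖z - 1‖ := by
      rw [inv_le_iff_one_le_mul₀ (by linarith)]
      nlinarith [norm_nonneg (z - 1)]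
    linarith
  · have := fz_log_le z
    linarith [norm_nonneg (z - 1)]

theorem fzF_an (N : ℕ) : AnalyticOnNhd ℂ (fzF N) {s | 0 < s.im} := by
  obtain ⟨c, κ, C, h⟩ := fz_coef N
  exact DifferentiableOn.analyticOnNhd (fun z hz => (h.diff z hz).differentiableWithinAt)
    (isOpen_lt continuous_const Complex.continuous_im)

theorem fz_test_chi : FZTest (1/2) (21/2) (fun s => (s - 1/2)^2 * (21/2 - s)^2)
    (fun s => 2 * (s - 1/2) * (21/2 - s)^2 - 2 * (s - 1/2)^2 * (21/2 - s))
    (fun s => 2 * (21/2 - s)^2 - 8 * (s - 1/2) * (21/2 - s) + 2 * (s - 1/2)^2) where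
  d0 x := by
    have h1 := ((hasDerivAt_id x).sub_const (1/2)).pow 2
    have h2 := ((hasDerivAt_id x).const_sub (21/2)).pow 2
    refine HasDerivAt.congr_deriv (h1.mul h2) ?_
    simp; ring
  d1 x := by
    have h1 := ((hasDerivAt_id x).sub_const (1/2))
    have h2 := ((hasDerivAt_id x).const_sub (21/2))
    refine HasDerivAt.congr_deriv (((h1.const_mul 2).mul (h2.pow 2)).sub (((h1.pow 2).const_mul 2).mul h2)) ?_
    simp; ring
  c2 := by fun_prop
  za := by norm_num
  zb := by norm_num
  z1a := by norm_num
  z1b := by norm_num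

theorem fz_test_k (τ : ℝ) : FZTest (τ - 7) (τ + 7) (fun t => (49 - (t - τ)^2)^2)
    (fun t => -4 * (t - τ) * (49 - (t - τ)^2))
    (fun t => -196 + 12 * (t - τ)^2) where
  d0 x := by
    have h1 := ((((hasDerivAt_id x).sub_const τ).pow 2).const_sub 49).pow 2
    refine HasDerivAt.congr_deriv h1 ?_
    simp; ring
  d1 x := by
    have h1 := ((hasDerivAt_id x).sub_const τ)
    refine HasDerivAt.congr_deriv ((h1.const_mul (-4)).mul ((h1.pow 2).const_sub 49)) ?_
    simp; ring
  c2 := by fun_prop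
  za := by norm_num
  zb := by norm_num
  z1a := by norm_num
  z1b := by norm_num

noncomputable def fzW (τ : ℝ) (p : ℝ × ℝ) : ℝ :=
  ((p.1 - 1/2)^2 * (21/2 - p.1)^2) * (-196 + 12 * (p.2 - τ)^2) +
   (2 * (21/2 - p.1)^2 - 8 * (p.1 - 1/2) * (21/2 - p.1) + 2 * (p.1 - 1/2)^2) * (49 - (p.2 - τ)^2)^2

theorem fzW_bd {τ : ℝ} {p : ℝ × ℝ} (h1 : 1/2 ≤ p.1) (h2 : p.1 ≤ 21/2) (h3 : τ - 7 ≤ p.2) (h4 : p.2 ≤ τ + 7) :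
    |fzW τ p| ≤ 10000000 := by
  unfold fzW
  set x := p.1 - 1/2 with hx
  set y := p.2 - τ with hy
  have e : 21/2 - p.1 = 10 - x := by rw [hx]; ring
  rw [e]
  have x0 : 0 ≤ x := by linarith
  have x1 : x ≤ 10 := by linarith
  have y2 : y^2 ≤ 49 := by nlinarith
  have y0 : 0 ≤ y^2 := sq_nonneg y
  have a1 : 0 ≤ x * (10 - x) := mul_nonneg x0 (by linarith)
  have a2 : x * (10 - x) ≤ 25 := by nlinarith [sq_nonneg (x - 5)]
  have a3 : x^2 * (10-x)^2 ≤ 625 := by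
    have : x^2 * (10-x)^2 = (x * (10-x))^2 := by ring
    rw [this]; nlinarith
  have a4 : 0 ≤ x^2 * (10-x)^2 := by positivity
  have b1 : |(-196 + 12 * y^2)| ≤ 392 := by rw [abs_le]; constructor <;> linarith
  have c1 : |2 * (10 - x)^2 - 8 * x * (10 - x) + 2 * x^2| ≤ 600 := by
    rw [abs_le]; constructor <;> nlinarith
  have d1 : |(49 - y^2)^2| ≤ 2401 := by rw [abs_le]; constructor <;> nlinarith
  calc _ ≤ |x^2 * (10-x)^2 * (-196 + 12 * y^2)| + |(2 * (10 - x)^2 - 8 * x * (10 - x) + 2 * x^2) * (49 - y^2)^2| := abs_add_le _ _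
    _ ≤ 625 * 392 + 600 * 2401 := by
      rw [abs_mul (x^2 * (10-x)^2), abs_mul (2 * (10 - x)^2 - 8 * x * (10 - x) + 2 * x^2), abs_of_nonneg a4]
      gcongr
    _ ≤ _ := by norm_num

theorem fzW_pos {τ : ℝ} {p : ℝ × ℝ} (h1 : 1/2 ≤ p.1) (h2 : p.1 ≤ 2) (h3 : τ - 7 ≤ p.2) (h4 : p.2 ≤ τ + 7) :
    0 ≤ fzW τ p ∧ (τ - 3 ≤ p.2 → p.2 ≤ τ + 3 → 1 ≤ fzW τ p) := by
  unfold fzW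
  set x := p.1 - 1/2 with hx
  set y := p.2 - τ with hy
  have e : 21/2 - p.1 = 10 - x := by rw [hx]; ring
  rw [e]
  have x0 : 0 ≤ x := by linarith
  have x1 : x ≤ 3/2 := by linarith
  have y2 : y^2 ≤ 49 := by nlinarith
  have a1 : 0 ≤ x * (10 - x) := mul_nonneg x0 (by linarith)
  have a2 : x * (10 - x) ≤ 13 := by nlinarith
  have a3 : x^2 * (10-x)^2 ≤ 169 := by
    have : x^2 * (10-x)^2 = (x * (10-x))^2 := by ring
    rw [this]; nlinarith
  have a4 : 0 ≤ x^2 * (10-x)^2 := by positivity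
  have c1 : 44 ≤ 2 * (10 - x)^2 - 8 * x * (10 - x) + 2 * x^2 := by nlinarith
  set P := x^2 * (10-x)^2
  set Q := 2 * (10 - x)^2 - 8 * x * (10 - x) + 2 * x^2
  set Y := y^2
  have hY0 : 0 ≤ Y := sq_nonneg y
  have hq : 44 * (49 - Y)^2 ≤ Q * (49 - Y)^2 := mul_le_mul_of_nonneg_right c1 (sq_nonneg _)
  constructor
  · rcases le_total 0 (-196 + 12 * Y) with h | h
    · nlinarith [mul_nonneg a4 h, sq_nonneg (49 - Y)]
    · have hp : 169 * (-196 + 12 * Y) ≤ P * (-196 + 12 * Y) := mul_le_mul_of_nonpos_right a3 h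
      nlinarith
  · intro h5 h6
    have hY : Y ≤ 9 := by show y^2 ≤ 9; nlinarith
    have hp : 169 * (-196 + 12 * Y) ≤ P * (-196 + 12 * Y) := mul_le_mul_of_nonpos_right a3 (by linarith)
    nlinarith

theorem fz_local {N : ℕ} (hN : 2 ≤ N) {τ : ℝ} (hτ : 15 ≤ τ) :
    IntegrableOn (fun p : ℝ × ℝ => Real.log ‖fzF N (p.1 + p.2 * I)‖) (Icc (1/2:ℝ) 2 ×ˢ Icc (τ-3) (τ+3)) ∧
    ∫ p in Icc (1/2:ℝ) 2 ×ˢ Icc (τ-3) (τ+3), |Real.log ‖fzF N (p.1 + p.2 * I)‖| ≤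
      30000000 * ((∫ p in Icc (1/2:ℝ) 2 ×ˢ Icc (τ-9) (τ+9), ‖fzF N (p.1 + p.2 * I) - 1‖) + 140 / N) := by
  have hN0 : (2:ℝ) ≤ N := by exact_mod_cast hN
  have hNi : 1 / (N:ℝ) ≤ 1/2 := one_div_le_one_div_of_le (by norm_num) hN0
  have hfan : AnalyticOnNhd ℂ (fzF N) (Icc (1/2:ℝ) (21/2) ×ℂ Icc (τ-7) (τ+7)) :=
    (fzF_an N).mono fun z hz => by
      have := hz.2.1; simp only [mem_ofPred_eq]; linarith
  have hne : ∃ z ∈ Icc (1/2:ℝ) (21/2) ×ℂ Icc (τ-7) (τ+7), fzF N z ≠ 0 := by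
    refine ⟨(10:ℝ) + τ * I, ?_, ?_⟩
    · rw [mem_reProdIm]; simp; norm_num
    · intro h0
      have := fz_sig2 (N := N) (by omega) (s := (10:ℝ) + τ * I) (by simp; norm_num)
      rw [h0] at this; simp at this
      rw [one_div] at hNi
      linarith
  obtain ⟨hI, hid⟩ := fz_green_an (by norm_num) (by linarith) hfan hne fz_test_chi (fz_test_k τ)
  set ℓ : ℝ × ℝ → ℝ := fun p => Real.log ‖fzF N (p.1 + p.2 * I)‖ with hℓ
  set Q := Icc (1/2:ℝ) (21/2) ×ˢ Icc (τ-7) (τ+7) with hQ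
  set R := Icc (1/2:ℝ) 2 ×ˢ Icc (τ-3) (τ+3) with hR
  set S := Icc (1/2:ℝ) 2 ×ˢ Icc (τ-9) (τ+9) with hS
  have hRQ : R ⊆ Q := prod_mono (Icc_subset_Icc le_rfl (by norm_num)) (Icc_subset_Icc (by linarith) (by linarith))
  have hRm : MeasurableSet R := measurableSet_Icc.prod measurableSet_Icc
  have hQm : MeasurableSet Q := measurableSet_Icc.prod measurableSet_Icc
  have hSm : MeasurableSet S := measurableSet_Icc.prod measurableSet_Icc
  refine ⟨hI.mono_set hRQ, ?_⟩
  have hpos : 0 ≤ ∫ p in Q, ℓ p * fzW τ p := by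
    unfold fzW
    refine le_of_le_of_eq ?_ hid.symm
    refine mul_nonneg (by positivity) (finsum_mem_induction (fun x : ℝ => 0 ≤ x) le_rfl (fun _ _ => add_nonneg) fun ρ hρ => ?_)
    positivity
  have hWc : Continuous (fzW τ) := by unfold fzW; fun_prop
  have iW : IntegrableOn (fun p => ℓ p * fzW τ p) Q := by
    refine Integrable.mul_bdd (c := 10000000) (g := fzW τ) hI hWc.aestronglyMeasurable ?_
    refine (ae_restrict_iff' hQm).2 (ae_of_all _ fun p hp => ?_)
    exact fzW_bd hp.1.1 hp.1.2 hp.2.1 hp.2.2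
  have iR : IntegrableOn (R.indicator fun p => |ℓ p|) Q := (hI.abs).indicator hRm
  have iS0 : IntegrableOn (fun p : ℝ × ℝ => ‖fzF N (p.1 + p.2 * I) - 1‖) S := fz_int_rect N (by linarith)
  have iS : IntegrableOn (S.indicator fun p : ℝ × ℝ => ‖fzF N (p.1 + p.2 * I) - 1‖) Q := by
    have : Integrable (S.indicator fun p : ℝ × ℝ => ‖fzF N (p.1 + p.2 * I) - 1‖) := (integrable_indicator_iff hSm).2 iS0
    exact this.integrableOn
  have hQfin : volume Q ≠ ⊤ := (isCompact_Icc.prod isCompact_Icc).measure_lt_top.ne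
  have iC : IntegrableOn (fun _ : ℝ × ℝ => 1 / (N:ℝ)) Q := integrableOn_const hQfin
  have iSC : IntegrableOn (fun p => 30000000 * (S.indicator (fun p : ℝ × ℝ => ‖fzF N (p.1 + p.2 * I) - 1‖) p + 1 / (N:ℝ))) Q := (iS.add iC).const_mul _
  have hmono := setIntegral_mono_on (iW.add iR) iSC hQm (fun p hp => by
    simp only [Pi.add_apply]
    have hNp : 0 < 1 / (N:ℝ) := by positivity
    have hw := fzW_bd (τ := τ) hp.1.1 hp.1.2 hp.2.1 hp.2.2
    rcases le_or_gt p.1 2 with h2 | h2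
    · have hpS : p ∈ S := ⟨⟨hp.1.1, h2⟩, by linarith [hp.2.1], by linarith [hp.2.2]⟩
      rw [indicator_of_mem hpS]
      obtain ⟨w0, w1⟩ := fzW_pos (τ := τ) hp.1.1 h2 hp.2.1 hp.2.2
      rw [abs_of_nonneg w0] at hw
      have hle : ℓ p ≤ ‖fzF N (p.1 + p.2 * I) - 1‖ := fz_log_le _
      have hnn := norm_nonneg (fzF N (p.1 + p.2 * I) - 1)
      by_cases hpR : p ∈ R
      · rw [indicator_of_mem hpR]
        have := w1 hpR.2.1 hpR.2.2
        rcases le_total 0 (ℓ p) with h | h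
        · rw [abs_of_nonneg h]; nlinarith
        · rw [abs_of_nonpos h]; nlinarith
      · rw [indicator_of_notMem hpR]
        rcases le_total 0 (ℓ p) with h | h
        · nlinarith
        · nlinarith
    · have hpR : p ∉ R := fun h => by linarith [h.1.2]
      have hpS : p ∉ S := fun h => by linarith [h.1.2]
      rw [indicator_of_notMem hpR, indicator_of_notMem hpS]
      have h3 := fz_sig2 (N := N) (by omega) (s := p.1 + p.2 * I) (by simp; linarith)
      have h4 : |ℓ p| ≤ 2 * _ := fz_abslog_le (h3.trans hNi)
      have h5 : ℓ p * fzW τ p ≤ |ℓ p| * |fzW τ p| := by rw [← abs_mul]; exact le_abs_self _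
      have h6 : |ℓ p| * |fzW τ p| ≤ (2 * (1 / N)) * 10000000 := by
        apply mul_le_mul (by linarith) hw (abs_nonneg _) (by positivity)
      linarith)
  simp only [Pi.add_apply] at hmono
  rw [integral_add iW iR, integral_const_mul, integral_add iS iC, setIntegral_indicator hRm, inter_eq_right.2 hRQ,
    setIntegral_indicator hSm, setIntegral_const] at hmono
  have hvol : volume.real Q = 140 := by
    rw [hQ, Measure.volume_eq_prod, measureReal_prod_prod, Real.volume_real_Icc_of_le (by norm_num), Real.volume_real_Icc_of_le (by linarith)]
    ring
  have hSmono : ∫ p in Q ∩ S, ‖fzF N (p.1 + p.2 * I) - 1‖ ≤ ∫ p in S, ‖fzF N (p.1 + p.2 * I) - 1‖ :=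
    setIntegral_mono_set iS0 (ae_of_all _ fun p => norm_nonneg _) inter_subset_right.eventuallyLE
  rw [hvol, smul_eq_mul, ← mul_div_assoc, mul_one] at hmono
  linarith

theorem fz_rect_split {a b c d e : ℝ} (hcd : c ≤ d) (hde : d ≤ e) {F : ℝ × ℝ → ℝ}
    (h1 : IntegrableOn F (Icc a b ×ˢ Icc c d)) (h2 : IntegrableOn F (Icc a b ×ˢ Icc d e)) :
    IntegrableOn F (Icc a b ×ˢ Icc c e) ∧
    ∫ p in Icc a b ×ˢ Icc c e, F p = (∫ p in Icc a b ×ˢ Icc c d, F p) + ∫ p in Icc a b ×ˢ Icc d e, F p := by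
  constructor
  · rw [← Icc_union_Icc_eq_Icc hcd hde, prod_union]
    exact h1.union h2
  · have e1 : ∫ p in Icc a b ×ˢ Icc d e, F p = ∫ p in Icc a b ×ˢ Ioc d e, F p :=
      (setIntegral_congr_set (Measure.set_prod_ae_eq (ae_eq_refl _) Ioc_ae_eq_Icc)).symm
    have e2 : Icc c e = Icc c d ∪ Ioc d e := (Icc_union_Ioc_eq_Icc hcd hde).symm
    rw [e1, e2, prod_union]
    refine setIntegral_union ?_ (measurableSet_Icc.prod measurableSet_Ioc) h1
      (h2.mono_set (Set.prod_mono le_rfl Ioc_subset_Icc_self))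
    rw [disjoint_left]
    intro p hp hp'
    linarith [hp.2.2, hp'.2.1]

theorem fz_tiles {N : ℕ} (hN : 2 ≤ N) (n : ℕ) :
    IntegrableOn (fun p : ℝ × ℝ => Real.log ‖fzF N (p.1 + p.2 * I)‖) (Icc (1/2:ℝ) 2 ×ˢ Icc 12 (6*n+18:ℝ)) ∧
    ∫ p in Icc (1/2:ℝ) 2 ×ˢ Icc 12 (6*n+18:ℝ), |Real.log ‖fzF N (p.1 + p.2 * I)‖| ≤
      30000000 * ((∫ p in Icc (1/2:ℝ) 2 ×ˢ Icc 6 (6*n+12:ℝ), ‖fzF N (p.1 + p.2 * I) - 1‖) +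
       (∫ p in Icc (1/2:ℝ) 2 ×ˢ Icc 12 (6*n+18:ℝ), ‖fzF N (p.1 + p.2 * I) - 1‖) +
       (∫ p in Icc (1/2:ℝ) 2 ×ˢ Icc 18 (6*n+24:ℝ), ‖fzF N (p.1 + p.2 * I) - 1‖) + 140 / N * (n+1)) := by
  have sp : ∀ c d e : ℝ, 0 < c → c ≤ d → d ≤ e → 
     ∫ p in Icc (1/2:ℝ) 2 ×ˢ Icc c e, ‖fzF N (p.1 + p.2 * I) - 1‖ = 
     (∫ p in Icc (1/2:ℝ) 2 ×ˢ Icc c d, ‖fzF N (p.1 + p.2 * I) - 1‖) +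
     ∫ p in Icc (1/2:ℝ) 2 ×ˢ Icc d e, ‖fzF N (p.1 + p.2 * I) - 1‖ := fun c d e h0 h1 h2 =>
    (fz_rect_split h1 h2 (fz_int_rect N h0) (fz_int_rect N (by linarith))).2
  induction n with
  | zero =>
    obtain ⟨h1, h2⟩ := fz_local hN (τ := 15) le_rfl
    have q1 : (15:ℝ)-3 = 12 := by norm_num
    have q2 : (15:ℝ)+3 = 18 := by norm_num
    have q3 : (15:ℝ)-9 = 6 := by norm_num
    have q4 : (15:ℝ)+9 = 24 := by norm_num
    rw [q1, q2] at h1 h2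
    rw [q3, q4] at h2
    simp only [Nat.cast_zero, mul_zero, zero_add, mul_one]
    refine ⟨h1, ?_⟩
    rw [sp 6 12 24 (by norm_num) (by norm_num) (by norm_num), sp 12 18 24 (by norm_num) (by norm_num) (by norm_num)] at h2
    linarith
  | succ n ih =>
    obtain ⟨i1, i2⟩ := ih
    have hn : (0:ℝ) ≤ n := n.cast_nonneg
    obtain ⟨h1, h2⟩ := fz_local hN (τ := 6*n+21) (by linarith)
    have q1 : (6*n+21:ℝ)-3 = 6*n+18 := by ring
    have q2 : (6*n+21:ℝ)+3 = 6*n+24 := by ring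
    have q3 : (6*n+21:ℝ)-9 = 6*n+12 := by ring
    have q4 : (6*n+21:ℝ)+9 = 6*n+30 := by ring
    rw [q1, q2] at h1 h2
    rw [q3, q4] at h2
    have r1 : 6 * ((n+1:ℕ):ℝ) + 18 = 6*n+24 := by push_cast; ring
    have r2 : 6 * ((n+1:ℕ):ℝ) + 12 = 6*n+18 := by push_cast; ring
    have r3 : 6 * ((n+1:ℕ):ℝ) + 24 = 6*n+30 := by push_cast; ring
    rw [r1, r2, r3]
    have hs := fz_rect_split (by linarith) (by linarith) i1 h1
    have hs2 := fz_rect_split (by linarith) (by linarith) i1.abs h1.abs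
    refine ⟨hs.1, ?_⟩
    rw [hs2.2]
    rw [sp (6*n+12) (6*n+18) (6*n+30) (by linarith) (by linarith) (by linarith), sp (6*n+18) (6*n+24) (6*n+30) (by linarith) (by linarith) (by linarith)] at h2
    rw [sp 6 (6*n+12) (6*n+18) (by linarith) (by linarith) (by linarith),
      sp 12 (6*n+18) (6*n+24) (by linarith) (by linarith) (by linarith),
      sp 18 (6*n+24) (6*n+30) (by linarith) (by linarith) (by linarith)]
    push_cast
    refine (add_le_add i2 h2).trans (le_of_eq ?_)
    ring

theorem fz_logF_int {N : ℕ} (hN : 2 ≤ N) (T : ℝ) :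
    IntegrableOn (fun p : ℝ × ℝ => Real.log ‖fzF N (p.1 + p.2 * I)‖) (Icc (1/2:ℝ) 2 ×ˢ Icc 12 T) := by
  obtain ⟨n, hn⟩ := exists_nat_ge T
  refine (fz_tiles hN n).1.mono_set (Set.prod_mono le_rfl (Icc_subset_Icc le_rfl ?_))
  have : (0:ℝ) ≤ n := n.cast_nonneg
  linarith

theorem fz_key {ε : ℝ} (hε : 0 < ε) : ∃ N0 : ℕ, ∀ N ≥ N0, ∃ T0 : ℝ, ∀ T ≥ T0,
    ∫ p in Icc (1/2:ℝ) 2 ×ˢ Icc 12 T, |Real.log ‖fzF N (p.1 + p.2 * I)‖| ≤ ε * T := by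
  obtain ⟨N0, h0⟩ := fz_l1d (ε / 1000000000) (by positivity)
  obtain ⟨N1, hN1⟩ := exists_nat_gt (140 * 1000000000 / ε)
  refine ⟨max 2 (max N0 N1), fun N hN => ?_⟩
  have hN2 : 2 ≤ N := le_of_max_le_left hN
  have hNN0 : N0 ≤ N := (le_max_left _ _).trans ((le_max_right _ _).trans hN)
  have hNN1 : N1 ≤ N := (le_max_right _ _).trans ((le_max_right _ _).trans hN)
  obtain ⟨T0, hT0⟩ := h0 N hNN0
  refine ⟨max T0 100, fun T hT => ?_⟩
  have hTT : T0 ≤ T := le_of_max_le_left hT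
  have hT1 : 100 ≤ T := le_of_max_le_right hT
  set n := ⌈T/6⌉₊ with hn
  have n1 : T / 6 ≤ n := Nat.le_ceil _
  have n2 : (n:ℝ) < T/6 + 1 := Nat.ceil_lt_add_one (by positivity)
  obtain ⟨i1, i2⟩ := fz_tiles hN2 n
  have hB := hT0 (6*n+24) (by linarith)
  have mono : ∀ c d : ℝ, 1 ≤ c → d ≤ 6*n+24 → ∫ p in Icc (1/2:ℝ) 2 ×ˢ Icc c d, ‖fzF N (p.1 + p.2 * I) - 1‖ ≤
      ∫ p in Icc (1/2:ℝ) 2 ×ˢ Icc 1 (6*n+24:ℝ), ‖fzF N (p.1 + p.2 * I) - 1‖ := fun c d h1 h2 =>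
    setIntegral_mono_set (fz_int_rect N one_pos) (ae_of_all _ fun p => norm_nonneg _)
      (Set.prod_mono le_rfl (Icc_subset_Icc h1 h2)).eventuallyLE
  have m1 := mono 6 (6*n+12) (by norm_num) (by linarith)
  have m2 := mono 12 (6*n+18) (by norm_num) (by linarith)
  have m3 := mono 18 (6*n+24) (by norm_num) (by linarith)
  have hA : ∫ p in Icc (1/2:ℝ) 2 ×ˢ Icc 12 T, |Real.log ‖fzF N (p.1 + p.2 * I)‖| ≤ 
      ∫ p in Icc (1/2:ℝ) 2 ×ˢ Icc 12 (6*n+18:ℝ), |Real.log ‖fzF N (p.1 + p.2 * I)‖| :=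
    setIntegral_mono_set i1.abs (ae_of_all _ fun p => abs_nonneg _)
      (Set.prod_mono le_rfl (Icc_subset_Icc le_rfl (by linarith))).eventuallyLE
  have hN' : 140 / (N:ℝ) ≤ ε / 1000000000 := by
    have : (N1:ℝ) ≤ N := by exact_mod_cast hNN1
    have hNp : (0:ℝ) < N := by exact_mod_cast (by omega : 0 < N)
    rw [div_le_div_iff₀ hNp (by norm_num)]
    rw [div_lt_iff₀ hε] at hN1
    nlinarith
  have hc : 140 / (N:ℝ) * (n+1) ≤ ε / 1000000000 * T := mul_le_mul hN' (by linarith) (by positivity) (by positivity)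
  have hd : ε / 1000000000 * (6*n+24) ≤ ε / 1000000000 * (2*T) := mul_le_mul_of_nonneg_left (by linarith) (by positivity)
  have : 0 ≤ ε * T := by positivity
  linarith

theorem fz_gamma_mono {a a' t t' : ℝ} (ha : 0 < a) (haa : a ≤ a') (ht : 0 ≤ t) (htt : t ≤ t') :
    ‖Complex.Gamma (a + t' * I)‖ * ‖Complex.Gamma (a' + t * I)‖ ≤
      ‖Complex.Gamma (a' + t' * I)‖ * ‖Complex.Gamma (a + t * I)‖ := by
  have h1 := (Complex.GammaSeq_tendsto_Gamma (a + t' * I)).norm.mul (Complex.GammaSeq_tendsto_Gamma (a' + t * I)).norm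
  have h2 := (Complex.GammaSeq_tendsto_Gamma (a' + t' * I)).norm.mul (Complex.GammaSeq_tendsto_Gamma (a + t * I)).norm
  refine le_of_tendsto_of_tendsto h1 h2 ?_
  filter_upwards [eventually_gt_atTop 0] with n hn
  have nv : ∀ b u : ℝ, 0 < b → ∀ j : ℕ, 0 < ‖(b + u * I : ℂ) + j‖ := by
    intro b u hb j
    rw [norm_pos_iff]
    intro h
    have := congrArg Complex.re h
    simp at this
    have hj : (0:ℝ) ≤ j := j.cast_nonneg
    linarith
  have nq : ∀ b u : ℝ, ‖Complex.GammaSeq (b + u * I) n‖ = (n:ℝ)^b * n.factorial / ∏ j ∈ Finset.range (n+1), ‖(b + u * I : ℂ) + j‖ := by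
    intro b u
    unfold Complex.GammaSeq
    rw [norm_div, norm_mul, Complex.norm_natCast_cpow_of_pos hn, norm_prod]
    simp
  have hpos : ∀ b u : ℝ, 0 < b → 0 < ∏ j ∈ Finset.range (n+1), ‖(b + u * I : ℂ) + j‖ := fun b u hb =>
    Finset.prod_pos fun j _ => nv b u hb j
  rw [nq, nq, nq, nq, div_mul_div_comm, div_mul_div_comm]
  have ha' : 0 < a' := by linarith
  rw [div_le_div_iff₀ (mul_pos (hpos _ _ ha) (hpos _ _ ha')) (mul_pos (hpos _ _ ha') (hpos _ _ ha))]
  have key : (∏ j ∈ Finset.range (n+1), ‖(a' + t' * I : ℂ) + j‖) * (∏ j ∈ Finset.range (n+1), ‖(a + t * I : ℂ) + j‖) ≤ 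
     (∏ j ∈ Finset.range (n+1), ‖(a + t' * I : ℂ) + j‖) * (∏ j ∈ Finset.range (n+1), ‖(a' + t * I : ℂ) + j‖) := by
    rw [← Finset.prod_mul_distrib, ← Finset.prod_mul_distrib]
    refine Finset.prod_le_prod (fun j _ => by positivity) fun j _ => ?_
    refine abs_le_of_sq_le_sq' ?_ (by positivity) |>.2
    have hs : ∀ b u : ℝ, ‖(b + u * I : ℂ) + j‖^2 = (b+j)^2 + u^2 := by
      intro b u
      rw [← Complex.normSq_eq_norm_sq, normSq_apply]; simp; ring
    rw [mul_pow, mul_pow, hs, hs, hs, hs]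
    have hj : (0:ℝ) ≤ j := j.cast_nonneg
    have e1 : 0 ≤ (a'+j)^2 - (a+j)^2 := by nlinarith
    have e2 : 0 ≤ t'^2 - t^2 := by nlinarith
    nlinarith [mul_nonneg e1 e2]
  have hc : 0 ≤ (n:ℝ)^a * n.factorial * ((n:ℝ)^a' * n.factorial) := by positivity
  nlinarith [mul_le_mul_of_nonneg_left key hc]

theorem fz_gamma_half (t : ℝ) : ‖Complex.Gamma ((1/2:ℝ) + t * I)‖^2 = π / Real.cosh (π * t) := by
  have h := Complex.Gamma_mul_Gamma_one_sub ((1/2:ℝ) + t * I)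
  have e : 1 - (((1/2:ℝ):ℂ) + t * I) = (starRingEnd ℂ) ((1/2:ℝ) + t * I) := by
    apply Complex.ext <;> simp; norm_num
  rw [e, Complex.Gamma_conj, Complex.mul_conj, Complex.normSq_eq_norm_sq] at h
  have e2 : Complex.sin (π * ((1/2:ℝ) + t * I)) = (Real.cosh (π * t) : ℝ) := by
    have : (π * (((1/2:ℝ):ℂ) + t * I) : ℂ) = (π * t : ℂ) * I + π/2 := by push_cast; ring
    rw [this, Complex.sin_add_pi_div_two, Complex.cos_mul_I]
    push_cast; rfl
  rw [e2] at h
  exact_mod_cast h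

theorem fz_gamma_ne {σ t : ℝ} (hσ : 0 < σ) : Complex.Gamma (σ + t * I) ≠ 0 :=
  Complex.Gamma_ne_zero_of_re_pos (by simpa using hσ)

theorem fz_loggamma_half (t : ℝ) : Real.log ‖Complex.Gamma ((1/2:ℝ) + t * I)‖ =
    1/2 * Real.log π - 1/2 * Real.log (Real.cosh (π * t)) := by
  have h := congrArg Real.log (fz_gamma_half t)
  rw [Real.log_pow, Real.log_div pi_pos.ne' (Real.cosh_pos _).ne'] at h
  rw [Nat.cast_ofNat] at h
  linarith

theorem fz_L_bd {σ t t' : ℝ} (h1 : 1/2 ≤ σ) (h2 : σ ≤ 3/2) (ht : 0 < t) (htt : t ≤ t') :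
    |(Real.log ‖Complex.Gamma (σ + t' * I)‖ + 1/2 * Real.log (Real.cosh (π * t'))) -
     (Real.log ‖Complex.Gamma (σ + t * I)‖ + 1/2 * Real.log (Real.cosh (π * t)))| ≤ (t' - t) / t := by
  have np : ∀ b u : ℝ, 0 < b → 0 < ‖Complex.Gamma (b + u * I)‖ := fun b u hb => norm_pos_iff.2 (fz_gamma_ne hb)
  have p0 : (0:ℝ) < 1/2 := by norm_num
  have p1 : (0:ℝ) < σ := by linarith
  have p2 : (0:ℝ) < 3/2 := by norm_num
  have m1 := Real.log_le_log (mul_pos (np _ _ p0) (np _ _ p1)) (fz_gamma_mono p0 h1 ht.le htt)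
  have m2 := Real.log_le_log (mul_pos (np _ _ p1) (np _ _ p2)) (fz_gamma_mono p1 h2 ht.le htt)
  rw [Real.log_mul (np _ _ p0).ne' (np _ _ p1).ne', Real.log_mul (np _ _ p1).ne' (np _ _ p0).ne',
    fz_loggamma_half, fz_loggamma_half] at m1
  have e3 : ∀ u : ℝ, 0 < u → Real.log ‖Complex.Gamma ((3/2:ℝ) + u * I)‖ = 
      Real.log ‖((1/2:ℝ) + u * I : ℂ)‖ + (1/2 * Real.log π - 1/2 * Real.log (Real.cosh (π * u))) := by
    intro u hu
    have hne : ((1/2:ℝ) + u * I : ℂ) ≠ 0 := by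
      intro h; have := congrArg Complex.re h; simp at this
    have : (((3/2:ℝ):ℂ) + u * I) = ((1/2:ℝ) + u * I) + 1 := by push_cast; ring
    rw [this, Complex.Gamma_add_one _ hne, norm_mul, Real.log_mul (norm_pos_iff.2 hne).ne' (np _ _ p0).ne', fz_loggamma_half]
  rw [Real.log_mul (np _ _ p1).ne' (np _ _ p2).ne', Real.log_mul (np _ _ p2).ne' (np _ _ p1).ne',
    e3 t ht, e3 t' (by linarith)] at m2
  have hn : ∀ u : ℝ, Real.log ‖((1/2:ℝ) + u * I : ℂ)‖ = 1/2 * Real.log (1/4 + u^2) := by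
    intro u
    rw [Complex.norm_def, Real.log_sqrt (normSq_nonneg _), normSq_apply]
    simp
    ring_nf
  rw [hn, hn] at m2
  have e4 : Real.log (1/4 + t'^2) - Real.log (1/4+t^2) ≤ 2 * ((t' - t)/t) := by
    have a1 : Real.log (1/4 + t'^2) - Real.log (1/4+t^2) ≤ Real.log (t'^2) - Real.log (t^2) := by
      rw [← Real.log_div (by positivity) (by positivity), ← Real.log_div (by nlinarith) (by positivity)]
      apply Real.log_le_log (by positivity)
      rw [div_le_div_iff₀ (by positivity) (by positivity)]
      nlinarith
    have a2 : Real.log (t'/t) ≤ t'/t - 1 := Real.log_le_sub_one_of_pos (by apply div_pos <;> linarith)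
    rw [Real.log_div (by linarith) ht.ne'] at a2
    have a3 : (t' - t)/t = t'/t - 1 := by field_simp
    rw [Real.log_pow, Real.log_pow] at a1
    push_cast at a1
    linarith
  have e5 : 0 ≤ (t' - t)/t := div_nonneg (by linarith) ht.le
  rw [abs_le]
  constructor <;> linarith

noncomputable def fzX (s : ℂ) : ℂ := 2 * (2 * π) ^ (-s) * Complex.Gamma s * Complex.cos (π * s / 2)

theorem fz_cos_sq (σ t : ℝ) : ‖Complex.cos (π * (σ + t * I) / 2)‖^2 = (Real.cosh (π * t) + Real.cos (π * σ)) / 2 := by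
  have e : (π * (σ + t * I) / 2 : ℂ) = ((π * σ / 2 : ℝ) : ℂ) + ((π * t / 2 : ℝ) : ℂ) * I := by push_cast; ring
  rw [e, Complex.cos_add_mul_I, ← Complex.normSq_eq_norm_sq, ← Complex.ofReal_cos, ← Complex.ofReal_sin, ← Complex.ofReal_cosh, ← Complex.ofReal_sinh, normSq_apply]
  simp only [Complex.sub_re, Complex.sub_im, Complex.mul_re, Complex.mul_im, Complex.ofReal_re, Complex.ofReal_im, Complex.I_re, Complex.I_im]
  have c1 : Real.cosh (π * t) = 2 * Real.cosh (π * t / 2)^2 - 1 := by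
    have := Real.cosh_two_mul (π * t / 2)
    have h2 := Real.cosh_sq (π * t/2)
    rw [show 2 * (π * t / 2) = π * t by ring] at this
    linarith
  have c2 : Real.cos (π * σ) = 2 * Real.cos (π * σ / 2)^2 - 1 := by
    have := Real.cos_two_mul (π * σ / 2)
    rw [show 2 * (π * σ / 2) = π * σ by ring] at this
    exact this
  have h2 := Real.cosh_sq (π * t/2)
  have h3 := Real.sin_sq_add_cos_sq (π * σ / 2)
  rw [c1, c2]
  have h4 : Real.sinh (π * t/2)^2 = Real.cosh (π * t/2)^2 - 1 := by linarith
  have h5 : Real.sin (π * σ/2)^2 = 1 - Real.cos (π * σ/2)^2 := by linarith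
  calc _ = Real.cos (π * σ / 2)^2 * Real.cosh (π * t/2)^2 + Real.sin (π * σ/2)^2 * Real.sinh (π * t/2)^2 := by ring
    _ = _ := by rw [h4, h5]; ring

theorem fz_cosh_gt {t : ℝ} (ht : 0 < t) (σ : ℝ) : 0 < Real.cosh (π * t) + Real.cos (π * σ) := by
  have : 1 < Real.cosh (π * t) := Real.one_lt_cosh.2 (by positivity)
  linarith [Real.neg_one_le_cos (π * σ)]

theorem fzX_ne {σ t : ℝ} (hσ : 0 < σ) (ht : 0 < t) : fzX (σ + t * I) ≠ 0 := by
  unfold fzX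
  have h1 : Complex.cos (π * (σ + t * I) / 2) ≠ 0 := by
    intro h
    have := fz_cos_sq σ t
    rw [h] at this
    have := fz_cosh_gt ht σ
    simp at *
    linarith
  have h2 : (2 * π : ℂ) ^ (-(σ + t * I : ℂ)) ≠ 0 := by
    rw [Complex.cpow_ne_zero_iff]
    left
    exact_mod_cast (by positivity : (2 * π : ℝ) ≠ 0)
  have := fz_gamma_ne (t := t) hσ
  simp_all

theorem fzX_log {σ t : ℝ} (hσ : 0 < σ) (ht : 0 < t) : Real.log ‖fzX (σ + t * I)‖ =
    (Real.log 2 - σ * Real.log (2 * π) - 1/2 * Real.log 2) + (Real.log ‖Complex.Gamma (σ + t * I)‖ + 1/2 * Real.log (Real.cosh (π * t))) +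
      (1/2 * Real.log (Real.cosh (π * t) + Real.cos (π * σ)) - 1/2 * Real.log (Real.cosh (π * t))) := by
  have hne := fzX_ne hσ ht
  unfold fzX at hne ⊢
  simp only [mul_ne_zero_iff] at hne
  obtain ⟨⟨⟨_, h2⟩, h3⟩, h4⟩ := hne
  have n2 := norm_ne_zero_iff.2 h2
  have n3 := norm_ne_zero_iff.2 h3
  have n4 := norm_ne_zero_iff.2 h4
  rw [norm_mul, norm_mul, norm_mul, Real.log_mul (by simp at *; tauto) n4, Real.log_mul (by simp at *; try tauto) n3, Real.log_mul (by simp) n2]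
  have e1 : Real.log ‖(2 * π : ℂ) ^ (-(σ + t * I : ℂ))‖ = - σ * Real.log (2 * π) := by
    have : (2 * π : ℂ) = ((2 * π : ℝ) : ℂ) := by push_cast; ring
    rw [this, Complex.norm_cpow_eq_rpow_re_of_pos (by positivity), Real.log_rpow (by positivity)]
    simp
  have e2 := congrArg Real.log (fz_cos_sq σ t)
  rw [Real.log_pow, Real.log_div (fz_cosh_gt ht σ).ne' (by norm_num)] at e2
  push_cast at e2
  rw [e1]
  simp only [Complex.norm_ofNat]
  linarith

theorem fzX_an {s : ℂ} (hs : 0 < s.re) : AnalyticAt ℂ fzX s := by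
  have : DifferentiableOn ℂ fzX {s | 0 < s.re} := by
    intro z hz
    apply DifferentiableAt.differentiableWithinAt
    unfold fzX
    have hg : DifferentiableAt ℂ Complex.Gamma z := by
      apply Complex.differentiableAt_Gamma
      intro m h
      rw [h] at hz
      simp at hz
      linarith [(Nat.cast_nonneg m : (0:ℝ) ≤ m)]
    have hc : DifferentiableAt ℂ (fun s : ℂ => (2 * π : ℂ) ^ (-s)) z := by
      apply DifferentiableAt.const_cpow (by fun_prop)
      left
      exact_mod_cast (by positivity : (2 * π : ℝ) ≠ 0)
    exact ((hc.const_mul 2).mul hg).mul (by fun_prop)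
  exact this.analyticAt ((isOpen_lt continuous_const Complex.continuous_re).mem_nhds hs)

theorem fzX_dt {σ t : ℝ} (h1 : 1/2 ≤ σ) (h2 : σ ≤ 3/2) (ht : 12 ≤ t) :
    HasDerivAt (fun u : ℝ => Real.log ‖fzX (σ + u * I)‖) (-(deriv fzX (σ + t * I) / fzX (σ + t * I)).im) t ∧
    |(-(deriv fzX (σ + t * I) / fzX (σ + t * I)).im)| ≤ 5 / t := by
  have hσ : 0 < σ := by linarith
  have t0 : 0 < t := by linarith
  have hd := fz_logn_y (fzX_an (s := σ + t * I) (by simpa using hσ)).differentiableAt.hasDerivAt (fzX_ne hσ t0)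
  refine ⟨hd, ?_⟩
  set v := (-(deriv fzX (σ + t * I) / fzX (σ + t * I)).im)
  have hcosh : HasDerivAt (fun u : ℝ => Real.cosh (π * u)) (Real.sinh (π * t) * π) t := by
    have := ((hasDerivAt_id t).const_mul π).cosh
    simpa using this
  have hp := fz_cosh_gt t0 σ
  have hE : HasDerivAt (fun u : ℝ => 1/2 * Real.log (Real.cosh (π * u) + Real.cos (π * σ)) - 1/2 * Real.log (Real.cosh (π * u)))
      (1/2 * (Real.sinh (π * t) * π / (Real.cosh (π * t) + Real.cos (π * σ))) - 1/2 * (Real.sinh (π * t) * π / Real.cosh (π * t))) t :=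
    (((hcosh.add_const _).log hp.ne').const_mul _).sub ((hcosh.log (Real.cosh_pos _).ne').const_mul _)
  set e := (1/2 * (Real.sinh (π * t) * π / (Real.cosh (π * t) + Real.cos (π * σ))) - 1/2 * (Real.sinh (π * t) * π / Real.cosh (π * t))) with he
  have hL : HasDerivAt (fun u : ℝ => Real.log ‖Complex.Gamma (σ + u * I)‖ + 1/2 * Real.log (Real.cosh (π * u))) (v - e) t := by
    have := (hd.sub hE).sub_const (Real.log 2 - σ * Real.log (2 * π) - 1/2 * Real.log 2)
    refine this.congr_of_eventuallyEq ?_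
    filter_upwards [eventually_gt_nhds t0] with u hu
    simp only [Pi.sub_apply]
    rw [fzX_log hσ hu]
    ring
  have b1 : ‖v - e‖ ≤ 4 / t := by
    refine hL.le_of_lip' (by positivity) ?_
    filter_upwards [eventually_gt_nhds (show t/2 < t by linarith)] with u hu
    rw [Real.norm_eq_abs, Real.norm_eq_abs]
    rcases le_total t u with h | h
    · refine (fz_L_bd h1 h2 t0 h).trans ?_
      rw [abs_of_nonneg (by linarith), div_mul_eq_mul_div]
      gcongr
      linarith
    · rw [abs_sub_comm]
      refine (fz_L_bd h1 h2 (by linarith) h).trans ?_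
      rw [abs_of_nonpos (by linarith), div_mul_eq_mul_div, div_le_div_iff₀ (by linarith) t0]
      nlinarith
  have b2 : |e| ≤ 1 / t := by
    have hx36 : 36 ≤ π * t := by nlinarith [Real.pi_gt_three]
    have hc1 : (1 + π * t + (π * t)^2/2) / 2 ≤ Real.cosh (π * t) := by
      rw [Real.cosh_eq]
      have := Real.quadratic_le_exp_of_nonneg (x := π * t) (by positivity)
      have h0 := Real.exp_pos (-(π * t))
      linarith
    set C := Real.cosh (π * t) with hC
    set S := Real.sinh (π * t) with hS
    set c := Real.cos (π * σ) with hc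
    have hcc : |c| ≤ 1 := Real.abs_cos_le_one _
    have hc' := abs_le.1 hcc
    have hSC : S ≤ C := (Real.sinh_lt_cosh _).le
    have hS0 : 0 ≤ S := Real.sinh_nonneg_iff.2 (by positivity)
    have hC0 : 0 < C := Real.cosh_pos _
    have e1 : e = -(1/2 * (π * S * c) / ((C + c) * C)) := by rw [he]; field_simp; ring
    rw [e1, abs_neg, abs_div, abs_of_pos (mul_pos hp hC0), div_le_div_iff₀ (mul_pos hp hC0) t0, one_mul]
    have hπ := Real.pi_gt_three
    have hπ4 := Real.pi_le_four
    have e2 : |1/2 * (π * S * c)| ≤ 1/2 * (π * C) := by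
      rw [abs_mul, abs_mul, abs_mul, abs_of_pos pi_pos, abs_of_nonneg hS0, abs_of_pos (by norm_num : (0:ℝ) < 1/2)]
      have : S * |c| ≤ C * 1 := mul_le_mul hSC hcc (abs_nonneg _) hC0.le
      nlinarith
    have e3 : π * t / 2 ≤ C + c := by nlinarith only [hc1, hx36, hc'.1]
    calc _ ≤ 1/2 * (π * C) * t := by gcongr
      _ = π * t / 2 * C := by ring
      _ ≤ _ := by gcongr
  have b1' : |v - e| ≤ 4 / t := b1
  have e5 : 5 / t = 4/t + 1/t := by ring
  rw [e5]
  calc |v| = |(v - e) + e| := by ring_nf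
    _ ≤ |v - e| + |e| := abs_add_le _ _
    _ ≤ _ := by linarith

theorem fzX_cont : ContinuousOn (fun p : ℝ × ℝ => Real.log ‖fzX (p.1 + p.2 * I)‖) (Ioi 0 ×ˢ Ioi 0) := by
  apply ContinuousOn.log
  · apply ContinuousOn.norm
    intro p hp
    apply ContinuousAt.continuousWithinAt
    have : ContinuousAt fzX (p.1 + p.2 * I) := (fzX_an (by simpa using hp.1)).continuousAt
    exact ContinuousAt.comp (f := fun p : ℝ × ℝ => (p.1 + p.2 * I : ℂ)) this (by fun_prop)
  · intro p hp
    exact norm_ne_zero_iff.2 (fzX_ne hp.1 hp.2)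

theorem fz_osc : ∃ A : ℝ, 0 ≤ A ∧ ∀ σ ∈ Icc (1/2:ℝ) (3/2), ∀ d ≥ (12:ℝ), ∀ (w W : ℝ → ℝ) (B : ℝ),
    (∀ t, HasDerivAt W (w t) t) → Continuous w → (∀ t ∈ Icc 12 d, |W t| ≤ B) →
    |∫ t in (12:ℝ)..d, Real.log ‖fzX (σ + t * I)‖ * w t| ≤ B * (A + 10 * Real.log d) := by
  have hc : ContinuousOn (fun σ : ℝ => Real.log ‖fzX (σ + (12:ℝ) * I)‖) (Icc (1/2:ℝ) (3/2)) := by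
    have h := fzX_cont.comp (f := fun σ : ℝ => (σ, (12:ℝ))) (s := Icc (1/2:ℝ) (3/2)) (by fun_prop)
      (fun σ hσ => ⟨by simp; linarith [hσ.1], by simp⟩)
    exact h
  obtain ⟨A0, hA0⟩ := isCompact_Icc.exists_bound_of_continuousOn hc
  refine ⟨2 * |A0|, by positivity, fun σ hσ d hd w W B hW hw hB => ?_⟩
  set G : ℝ → ℝ := fun t => Real.log ‖fzX (σ + t * I)‖ with hG
  set G' : ℝ → ℝ := fun t => -(deriv fzX (σ + t * I) / fzX (σ + t * I)).im with hG'
  have hσ0 : 0 < σ := by linarith [hσ.1]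
  have hB0 : 0 ≤ B := (abs_nonneg _).trans (hB 12 ⟨le_rfl, hd⟩)
  have gc : ContinuousOn G' (Icc 12 d) := by
    intro t ht
    apply ContinuousAt.continuousWithinAt
    have han : AnalyticAt ℂ fzX (σ + t * I) := fzX_an (by simpa using hσ0)
    have h1 : ContinuousAt (fun z => deriv fzX z / fzX z) (σ + t * I) :=
      (han.deriv.continuousAt).div han.continuousAt (fzX_ne hσ0 (by linarith [ht.1]))
    have h2 : ContinuousAt (fun t : ℝ => deriv fzX (σ + t * I) / fzX (σ + t * I)) t :=
      ContinuousAt.comp (f := fun t : ℝ => (σ + t * I : ℂ)) h1 (by fun_prop)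
    exact (Complex.continuous_im.continuousAt.comp h2).neg
  have gd : ∀ t ∈ Icc 12 d, HasDerivAt G (G' t) t ∧ |G' t| ≤ 5 / t := fun t ht => fzX_dt hσ.1 hσ.2 ht.1
  have hWc : Continuous W := continuous_iff_continuousAt.2 fun t => (hW t).continuousAt
  have uI : uIcc 12 d = Icc 12 d := uIcc_of_le hd
  have ibp : ∫ t in (12:ℝ)..d, G t * w t = G d * W d - G 12 * W 12 - ∫ t in (12:ℝ)..d, G' t * W t := by
    refine intervalIntegral.integral_mul_deriv_eq_deriv_mul (fun t ht => (gd t (uI ▸ ht)).1) (fun t _ => hW t) ?_ (hw.intervalIntegrable _ _)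
    exact (uI ▸ gc : ContinuousOn G' (uIcc 12 d)).intervalIntegrable
  have hinv : IntervalIntegrable (fun t : ℝ => 1 / t) volume 12 d := by
    apply intervalIntegral.intervalIntegrable_one_div (f := fun t => t)
    · intro t ht; rw [uI] at ht; linarith [ht.1]
    · fun_prop
  have hlog : ∫ t in (12:ℝ)..d, 1 / t = Real.log (d / 12) := by
    rw [integral_one_div]
    rw [uI]; intro h; linarith [h.1]
  have hl : Real.log (d/12) ≤ Real.log d := by
    apply Real.log_le_log (by linarith) ; linarith
  have hl0 : 0 ≤ Real.log (d/12) := Real.log_nonneg (by linarith)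
  have hG12 : |G 12| ≤ |A0| := by
    have := (hA0 σ hσ).trans (le_abs_self A0)
    rw [Real.norm_eq_abs] at this
    exact_mod_cast this
  have hGd : |G d| ≤ |A0| + 5 * Real.log d := by
    have f1 : ∫ t in (12:ℝ)..d, G' t = G d - G 12 :=
      intervalIntegral.integral_eq_sub_of_hasDerivAt (fun t ht => (gd t (uI ▸ ht)).1) (uI ▸ gc : ContinuousOn G' (uIcc 12 d)).intervalIntegrable
    have f2 : ‖∫ t in (12:ℝ)..d, G' t‖ ≤ ∫ t in (12:ℝ)..d, 5 * (1 / t) := by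
      refine intervalIntegral.norm_integral_le_of_norm_le hd (ae_of_all _ fun t ht => ?_) (hinv.const_mul 5)
      have := (gd t ⟨ht.1.le, ht.2⟩).2
      rw [Real.norm_eq_abs]; convert this using 1; ring
    rw [intervalIntegral.integral_const_mul, hlog, f1, Real.norm_eq_abs] at f2
    calc |G d| = |(G d - G 12) + G 12| := by ring_nf
      _ ≤ |G d - G 12| + |G 12| := abs_add_le _ _
      _ ≤ _ := by linarith
  have h3 : ‖∫ t in (12:ℝ)..d, G' t * W t‖ ≤ ∫ t in (12:ℝ)..d, (5 * B) * (1 / t) := by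
    refine intervalIntegral.norm_integral_le_of_norm_le hd (ae_of_all _ fun t ht => ?_) (hinv.const_mul _)
    have h5 := (gd t ⟨ht.1.le, ht.2⟩).2
    have h6 := hB t ⟨ht.1.le, ht.2⟩
    rw [norm_mul, Real.norm_eq_abs, Real.norm_eq_abs]
    have t0 : 0 < t := by linarith [ht.1]
    calc |G' t| * |W t| ≤ (5 / t) * B := mul_le_mul h5 h6 (abs_nonneg _) (by positivity)
      _ = _ := by ring
  rw [intervalIntegral.integral_const_mul, hlog, Real.norm_eq_abs] at h3
  rw [ibp]
  have k1 : |G d * W d| ≤ (|A0| + 5 * Real.log d) * B := by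
    rw [abs_mul]; exact mul_le_mul hGd (hB d ⟨hd, le_rfl⟩) (abs_nonneg _) (by linarith [abs_nonneg A0])
  have k2 : |G 12 * W 12| ≤ |A0| * B := by
    rw [abs_mul]; exact mul_le_mul hG12 (hB 12 ⟨le_rfl, hd⟩) (abs_nonneg _) (by positivity)
  have k3 : (5 * B) * Real.log (d/12) ≤ (5 * B) * Real.log d := mul_le_mul_of_nonneg_left hl (by positivity)
  calc _ ≤ |G d * W d - G 12 * W 12| + |∫ t in (12:ℝ)..d, G' t * W t| := abs_sub _ _
    _ ≤ (|G d * W d| + |G 12 * W 12|) + |∫ t in (12:ℝ)..d, G' t * W t| := by gcongr; exact abs_sub _ _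
    _ ≤ _ := by linarith

theorem fz_osc2 : ∃ A : ℝ, 0 ≤ A ∧ ∀ d ≥ (12:ℝ), ∀ (χ χ2 k k1 k2 : ℝ → ℝ) (X B : ℝ), 0 ≤ X →
    Continuous χ → Continuous χ2 → (∀ x, |χ x| ≤ X) → (∀ x, |χ2 x| ≤ X) → Continuous k → Continuous k2 →
    (∀ t, HasDerivAt k1 (k2 t) t) → (∀ t ∈ Icc 12 d, |k1 t| ≤ B) → (∀ t ∈ Icc 12 d, |∫ u in (12:ℝ)..t, k u| ≤ B) →
    IntegrableOn (fun p : ℝ × ℝ => Real.log ‖fzX (p.1 + p.2 * I)‖ * (χ p.1 * k2 p.2 + χ2 p.1 * k p.2)) (Icc (1/2:ℝ) (3/2) ×ˢ Icc 12 d) ∧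
    |∫ p in Icc (1/2:ℝ) (3/2) ×ˢ Icc 12 d, Real.log ‖fzX (p.1 + p.2 * I)‖ * (χ p.1 * k2 p.2 + χ2 p.1 * k p.2)| ≤ 2 * X * (B * (A + 10 * Real.log d)) := by
  obtain ⟨A, hA, h⟩ := fz_osc
  refine ⟨A, hA, fun d hd χ χ2 k k1 k2 X B hX cχ cχ2 bχ bχ2 ck ck2 dk1 bk1 bk => ?_⟩
  have hsub : Icc (1/2:ℝ) (3/2) ×ˢ Icc 12 d ⊆ Ioi (0:ℝ) ×ˢ Ioi (0:ℝ) := fun p hp =>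
    ⟨by have := hp.1.1; simp only [mem_Ioi]; linarith, by have := hp.2.1; simp only [mem_Ioi]; linarith⟩
  have cG := fzX_cont.mono hsub
  have hint : IntegrableOn (fun p : ℝ × ℝ => Real.log ‖fzX (p.1 + p.2 * I)‖ * (χ p.1 * k2 p.2 + χ2 p.1 * k p.2)) (Icc (1/2:ℝ) (3/2) ×ˢ Icc 12 d) := by
    apply ContinuousOn.integrableOn_compact (isCompact_Icc.prod isCompact_Icc)
    exact cG.mul (Continuous.continuousOn (by fun_prop))
  refine ⟨hint, ?_⟩
  rw [fz_prod_xy (by norm_num) hd hint]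
  have b : ∀ σ ∈ uIoc (1/2:ℝ) (3/2), ‖∫ t in (12:ℝ)..d, Real.log ‖fzX (σ + t * I)‖ * (χ σ * k2 t + χ2 σ * k t)‖ ≤ 2 * X * (B * (A + 10 * Real.log d)) := by
    intro σ hσ
    rw [uIoc_of_le (by norm_num)] at hσ
    have hσ' : σ ∈ Icc (1/2:ℝ) (3/2) := ⟨hσ.1.le, hσ.2⟩
    have cGσ : ContinuousOn (fun t : ℝ => Real.log ‖fzX (σ + t * I)‖) (uIcc 12 d) := by
      rw [uIcc_of_le hd]
      exact cG.comp (f := fun t : ℝ => (σ, t)) (by fun_prop) (fun t ht => ⟨hσ', ht⟩)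
    have e1 := h σ hσ' d hd k2 k1 B dk1 ck2 bk1
    have e2 := h σ hσ' d hd k (fun t => ∫ u in (12:ℝ)..t, k u) B
      (fun t => intervalIntegral.integral_hasDerivAt_right (ck.intervalIntegrable _ _) (ck.stronglyMeasurableAtFilter _ _) ck.continuousAt) ck bk
    have i1 : IntervalIntegrable (fun t : ℝ => Real.log ‖fzX (σ + t * I)‖ * k2 t) volume 12 d := (cGσ.mul ck2.continuousOn).intervalIntegrable
    have i2 : IntervalIntegrable (fun t : ℝ => Real.log ‖fzX (σ + t * I)‖ * k t) volume 12 d := (cGσ.mul ck.continuousOn).intervalIntegrable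
    have e3 : ∫ t in (12:ℝ)..d, Real.log ‖fzX (σ + t * I)‖ * (χ σ * k2 t + χ2 σ * k t) = 
        χ σ * (∫ t in (12:ℝ)..d, Real.log ‖fzX (σ + t * I)‖ * k2 t) + χ2 σ * ∫ t in (12:ℝ)..d, Real.log ‖fzX (σ + t * I)‖ * k t := by
      rw [← intervalIntegral.integral_const_mul, ← intervalIntegral.integral_const_mul, ← intervalIntegral.integral_add (i1.const_mul _) (i2.const_mul _)]
      congr 1; ext t; ring
    rw [e3, Real.norm_eq_abs]
    refine (abs_add_le _ _).trans ?_
    rw [abs_mul, abs_mul]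
    have m1 := mul_le_mul (bχ σ) e1 (abs_nonneg _) hX
    have m2 := mul_le_mul (bχ2 σ) e2 (abs_nonneg _) hX
    linarith
  have := intervalIntegral.norm_integral_le_of_norm_le_const b
  rw [Real.norm_eq_abs] at this
  norm_num at this ⊢
  exact this

structure FZB (B : ℝ) (f f1 f2 : ℝ → ℝ) : Prop where
  d0 : ∀ x, HasDerivAt f (f1 x) x
  d1 : ∀ x, HasDerivAt f1 (f2 x) x
  c2 : Continuous f2
  b0 : ∀ x, |f x| ≤ B
  b1 : ∀ x, |f1 x| ≤ B
  b2 : ∀ x, |f2 x| ≤ B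

theorem FZB.nonneg {B f f1 f2} (h : FZB B f f1 f2) : 0 ≤ B := (abs_nonneg _).trans (h.b0 0)

theorem FZB.c0 {B f f1 f2} (h : FZB B f f1 f2) : Continuous f :=
  continuous_iff_continuousAt.2 fun x => (h.d0 x).continuousAt

theorem FZB.c1 {B f f1 f2} (h : FZB B f f1 f2) : Continuous f1 :=
  continuous_iff_continuousAt.2 fun x => (h.d1 x).continuousAt

theorem FZB.mono {B B' f f1 f2} (h : FZB B f f1 f2) (hB : B ≤ B') : FZB B' f f1 f2 :=
  ⟨h.d0, h.d1, h.c2, fun x => (h.b0 x).trans hB, fun x => (h.b1 x).trans hB, fun x => (h.b2 x).trans hB⟩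

theorem FZB.aff {B f f1 f2} (h : FZB B f f1 f2) (c d : ℝ) :
    FZB (B * (1 + c^2)) (fun x => f (c * x + d)) (fun x => c * f1 (c * x + d)) (fun x => c^2 * f2 (c * x + d)) := by
  have hl : ∀ x, HasDerivAt (fun x => c * x + d) c x := fun x => by
    simpa using ((hasDerivAt_id x).const_mul c).add_const d
  have hB := h.nonneg
  have hc : |c| ≤ 1 + c^2 := by rw [abs_le]; constructor <;> nlinarith [sq_nonneg (c - 1), sq_nonneg (c + 1)]
  refine ⟨fun x => ?_, fun x => ?_, ?_, fun x => ?_, fun x => ?_, fun x => ?_⟩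
  · exact HasDerivAt.congr_deriv ((h.d0 _).comp x (hl x)) (by ring)
  · exact HasDerivAt.congr_deriv (((h.d1 _).comp x (hl x)).const_mul c) (by ring)
  · have := h.c2; fun_prop
  · have := h.b0 (c * x + d); nlinarith [sq_nonneg c]
  · rw [abs_mul]
    have := h.b1 (c * x + d)
    calc |c| * |f1 (c * x + d)| ≤ (1 + c^2) * B := mul_le_mul hc this (abs_nonneg _) (by positivity)
      _ = _ := by ring
  · rw [abs_mul, abs_of_nonneg (sq_nonneg c)]
    have := h.b2 (c * x + d)
    calc c^2 * |f2 (c * x + d)| ≤ (1 + c^2) * B := mul_le_mul (by linarith) this (abs_nonneg _) (by positivity)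
      _ = _ := by ring

theorem FZB.mul {B C f f1 f2 g g1 g2} (h : FZB B f f1 f2) (h' : FZB C g g1 g2) :
    FZB (4 * (B * C)) (fun x => f x * g x) (fun x => f1 x * g x + f x * g1 x)
      (fun x => f2 x * g x + 2 * (f1 x * g1 x) + f x * g2 x) := by
  have hB := h.nonneg
  have hC := h'.nonneg
  have hBC : 0 ≤ B * C := mul_nonneg hB hC
  have key : ∀ u v : ℝ, |u| ≤ B → |v| ≤ C → |u * v| ≤ B * C := fun u v hu hv => by
    rw [abs_mul]; exact mul_le_mul hu hv (abs_nonneg _) hB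
  refine ⟨fun x => (h.d0 x).mul (h'.d0 x), fun x => ?_, ?_, fun x => ?_, fun x => ?_, fun x => ?_⟩
  · exact HasDerivAt.congr_deriv (((h.d1 x).mul (h'.d0 x)).add ((h.d0 x).mul (h'.d1 x))) (by ring)
  · have := h.c2; have := h'.c2; have := h.c0; have := h'.c0; have := h.c1; have := h'.c1
    fun_prop
  · linarith [key _ _ (h.b0 x) (h'.b0 x)]
  · refine (abs_add_le _ _).trans ?_
    linarith [key _ _ (h.b1 x) (h'.b0 x), key _ _ (h.b0 x) (h'.b1 x)]
  · refine (abs_add_le _ _).trans ((add_le_add_left (abs_add_le _ _) _).trans ?_)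
    rw [abs_mul 2, abs_of_pos (by norm_num : (0:ℝ) < 2)]
    linarith [key _ _ (h.b2 x) (h'.b0 x), key _ _ (h.b0 x) (h'.b2 x), key _ _ (h.b1 x) (h'.b1 x)]

theorem fz_S : ∃ (B : ℝ) (S1 S2 : ℝ → ℝ), FZB B Real.smoothTransition S1 S2 ∧ (∀ x, x ≤ 0 → S1 x = 0) ∧ (∀ x, 1 ≤ x → S1 x = 0) := by
  set S := Real.smoothTransition with hS
  have hcd : ContDiff ℝ 2 S := Real.smoothTransition.contDiff (n := 2)
  have hcd1 : ContDiff ℝ 1 (deriv S) := by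
    have : ContDiff ℝ (1+1) S := hcd
    exact (contDiff_succ_iff_deriv.1 this).2.2
  have hcd0 : Continuous (deriv (deriv S)) := hcd1.continuous_deriv le_rfl
  have z1 : ∀ x, x ≤ 0 → deriv S x = 0 := fun x hx => by
    apply IsLocalMin.deriv_eq_zero
    refine Filter.Eventually.of_forall fun y => ?_
    rw [hS, Real.smoothTransition.zero_of_nonpos hx]
    exact Real.smoothTransition.nonneg y
  have z2 : ∀ x, 1 ≤ x → deriv S x = 0 := fun x hx => by
    apply IsLocalMax.deriv_eq_zero
    refine Filter.Eventually.of_forall fun y => ?_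
    rw [hS, Real.smoothTransition.one_of_one_le hx]
    exact Real.smoothTransition.le_one y
  have z3 : ∀ x, x ∉ Icc (0:ℝ) 1 → deriv (deriv S) x = 0 := fun x hx => by
    have : deriv S =ᶠ[nhds x] fun _ => 0 := by
      filter_upwards [isClosed_Icc.isOpen_compl.mem_nhds hx] with y hy
      rw [mem_compl_iff, mem_Icc, not_and_or, not_le, not_le] at hy
      rcases hy with h | h
      · exact z1 y h.le
      · exact z2 y h.le
    rw [this.deriv_eq]; simp
  obtain ⟨B1, hB1⟩ := (isCompact_Icc (a := (0:ℝ)) (b := 1)).exists_bound_of_continuousOn hcd1.continuous.continuousOn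
  obtain ⟨B2, hB2⟩ := (isCompact_Icc (a := (0:ℝ)) (b := 1)).exists_bound_of_continuousOn hcd0.continuousOn
  refine ⟨1 + |B1| + |B2|, deriv S, deriv (deriv S), ⟨fun x => ?_, fun x => ?_, hcd0, fun x => ?_, fun x => ?_, fun x => ?_⟩, z1, z2⟩
  · exact (hcd.differentiable (by norm_num) x).hasDerivAt
  · exact (hcd1.differentiable (by norm_num) x).hasDerivAt
  · rw [abs_of_nonneg (Real.smoothTransition.nonneg x)]
    linarith [Real.smoothTransition.le_one x, abs_nonneg B1, abs_nonneg B2]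
  · by_cases hx : x ∈ Icc (0:ℝ) 1
    · have := hB1 x hx
      rw [Real.norm_eq_abs] at this
      linarith [le_abs_self B1, abs_nonneg B2]
    · rw [mem_Icc, not_and_or, not_le, not_le] at hx
      have : deriv S x = 0 := by
        rcases hx with h | h
        · exact z1 x h.le
        · exact z2 x h.le
      rw [this, abs_zero]; positivity
  · by_cases hx : x ∈ Icc (0:ℝ) 1
    · have := hB2 x hx
      rw [Real.norm_eq_abs] at this
      linarith [le_abs_self B2, abs_nonneg B1]
    · rw [z3 x hx, abs_zero]; positivity

structure FZChi (X : ℝ) (χ χ1 χ2 : ℝ → ℝ) : Prop where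
  t : FZTest (-1/2) (3/2) χ χ1 χ2
  b0 : ∀ x, |χ x| ≤ X
  b2 : ∀ x, |χ2 x| ≤ X
  one : ∀ x ∈ Icc (0:ℝ) 1, χ x = 1
  z1 : χ1 (1/2) = 0
  s0 : ∀ x, χ (1 - x) = χ x
  s2 : ∀ x, χ2 (1 - x) = χ2 x

theorem fz_chi : ∃ X χ χ1 χ2, FZChi X χ χ1 χ2 := by
  obtain ⟨B, S1, S2, h, hz0, hz1⟩ := fz_S
  have hm := (h.aff 2 1).mul (h.aff (-2) 3)
  refine ⟨_, _, _, _, ⟨⟨hm.d0, hm.d1, hm.c2, ?_, ?_, ?_, ?_⟩, hm.b0, hm.b2, ?_, ?_, ?_, ?_⟩⟩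
  · norm_num [Real.smoothTransition.zero]
  · norm_num [Real.smoothTransition.zero]
  · norm_num [Real.smoothTransition.zero, hz0 0]
  · norm_num [Real.smoothTransition.zero, hz0 0]
  · intro x hx
    rw [Real.smoothTransition.one_of_one_le (by linarith [hx.1]), Real.smoothTransition.one_of_one_le (by linarith [hx.2]), one_mul]
  · norm_num [hz1 2]
  · intro x
    rw [show 2 * (1 - x) + 1 = -2 * x + 3 by ring, show -2 * (1 - x) + 3 = 2 * x + 1 by ring]
    ring
  · intro x
    rw [show 2 * (1 - x) + 1 = -2 * x + 3 by ring, show -2 * (1 - x) + 3 = 2 * x + 1 by ring]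
    ring

theorem fz_cut : ∃ C : ℝ, ∀ c d : ℝ, ∃ s s1 s2 : ℝ → ℝ, FZB C s s1 s2 ∧ (∀ t, t ≤ c → s t = 0 ∧ s1 t = 0) ∧
    (∀ t, d ≤ t → s t = 0 ∧ s1 t = 0) ∧ (∀ t ∈ Icc (c+1) (d-1), s t = 1) ∧ (∀ t, 0 ≤ s t ∧ s t ≤ 1) := by
  obtain ⟨B, S1, S2, h, hz0, hz1⟩ := fz_S
  refine ⟨_, fun c d => ⟨_, _, _, (h.aff 1 (-c)).mul (h.aff (-1) d) |>.mono (B' := 4 * (B * 2 * (B * 2))) (by norm_num), ?_, ?_, ?_, ?_⟩⟩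
  · intro t ht
    rw [Real.smoothTransition.zero_of_nonpos (by linarith), hz0 _ (by linarith)]
    simp
  · intro t ht
    rw [Real.smoothTransition.zero_of_nonpos (x := -1 * t + d) (by linarith), hz0 (-1 * t + d) (by linarith)]
    simp
  · intro t ht
    rw [Real.smoothTransition.one_of_one_le (by linarith [ht.1]), Real.smoothTransition.one_of_one_le (by linarith [ht.2]), one_mul]
  · intro t
    have a := Real.smoothTransition.nonneg (1 * t + -c)
    have b := Real.smoothTransition.nonneg (-1 * t + d)
    have a' := Real.smoothTransition.le_one (1 * t + -c)
    have b' := Real.smoothTransition.le_one (-1 * t + d)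
    exact ⟨mul_nonneg a b, mul_le_one₀ a' b b'⟩

theorem fzM_diff (N : ℕ) : Differentiable ℂ (fzM N) := by
  have h : ∀ p ∈ (N.factorial).primeFactors, Differentiable ℂ (fun s : ℂ => 1 - (p : ℂ) ^ (-s)) := by
    intro p hp
    have hp0 : (p:ℂ) ≠ 0 := by exact_mod_cast (Nat.prime_of_mem_primeFactors hp).ne_zero
    intro s
    exact (DifferentiableAt.const_cpow (by fun_prop) (Or.inl hp0)).const_sub 1
  unfold fzM
  fun_prop (disch := assumption)

theorem fz_p_lt {p : ℕ} (hp : p.Prime) {s : ℂ} (hs : 0 < s.re) : ‖(p:ℂ)^(-s)‖ < 1 := by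
  rw [Complex.norm_natCast_cpow_of_pos hp.pos, Complex.neg_re]
  exact Real.rpow_lt_one_of_one_lt_of_neg (by exact_mod_cast hp.one_lt) (by linarith)

theorem fz_p_ne {p : ℕ} (hp : p.Prime) {s : ℂ} (hs : 0 < s.re) : 1 - (p:ℂ)^(-s) ≠ 0 := by
  intro h
  have := fz_p_lt hp hs
  rw [← sub_eq_zero.1 h] at this
  simp at this

theorem fzM_ne (N : ℕ) {s : ℂ} (hs : 0 < s.re) : fzM N s ≠ 0 := by
  unfold fzM
  rw [Finset.prod_ne_zero_iff]
  intro p hp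
  exact fz_p_ne (Nat.prime_of_mem_primeFactors hp) hs

theorem fz_rect_split_x {a m b c d : ℝ} (h1 : a ≤ m) (h2 : m ≤ b) {F : ℝ × ℝ → ℝ}
    (hF : IntegrableOn F (Icc a b ×ˢ Icc c d)) :
    ∫ p in Icc a b ×ˢ Icc c d, F p = (∫ p in Icc a m ×ˢ Icc c d, F p) + ∫ p in Icc m b ×ˢ Icc c d, F p := by
  have e1 : ∫ p in Icc m b ×ˢ Icc c d, F p = ∫ p in Ioc m b ×ˢ Icc c d, F p :=
    (setIntegral_congr_set (Measure.set_prod_ae_eq Ioc_ae_eq_Icc (ae_eq_refl _))).symm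
  have e2 : Icc a b = Icc a m ∪ Ioc m b := (Icc_union_Ioc_eq_Icc h1 h2).symm
  rw [e1, e2, union_prod]
  refine setIntegral_union ?_ (measurableSet_Ioc.prod measurableSet_Icc)
    (hF.mono_set (Set.prod_mono (Icc_subset_Icc le_rfl h2) le_rfl))
    (hF.mono_set (Set.prod_mono (Ioc_subset_Icc_self.trans (Icc_subset_Icc h1 le_rfl)) le_rfl))
  rw [disjoint_left]
  intro p hp hp'
  linarith [hp.1.2, hp'.1.1]

theorem fz_reflect {c d : ℝ} {F : ℝ × ℝ → ℝ} (hF : IntegrableOn F (Icc (-1/2:ℝ) (3/2) ×ˢ Icc c d)) :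
    IntegrableOn (fun p : ℝ × ℝ => F (1 - p.1, p.2)) (Icc (1/2:ℝ) (3/2) ×ˢ Icc c d) ∧
    ∫ p in Icc (-1/2:ℝ) (3/2) ×ˢ Icc c d, F p = ∫ p in Icc (1/2:ℝ) (3/2) ×ˢ Icc c d, (F p + F (1 - p.1, p.2)) := by
  have mp : MeasurePreserving (fun p : ℝ × ℝ => ((1:ℝ) - p.1, p.2)) volume volume := by
    have := (Measure.measurePreserving_sub_left (volume : Measure ℝ) (1:ℝ)).prod (MeasurePreserving.id (volume : Measure ℝ))
    exact this
  have me : MeasurableEmbedding (fun p : ℝ × ℝ => ((1:ℝ) - p.1, p.2)) :=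
    ((MeasurableEquiv.subLeft (1:ℝ)).prodCongr (MeasurableEquiv.refl ℝ)).measurableEmbedding
  have pre : (fun p : ℝ × ℝ => ((1:ℝ) - p.1, p.2)) ⁻¹' (Icc (-1/2:ℝ) (1/2) ×ˢ Icc c d) = Icc (1/2:ℝ) (3/2) ×ˢ Icc c d := by
    ext p
    simp only [mem_preimage, mem_prod, mem_Icc]
    constructor
    · rintro ⟨⟨h1, h2⟩, h3⟩; exact ⟨⟨by linarith, by linarith⟩, h3⟩
    · rintro ⟨⟨h1, h2⟩, h3⟩; exact ⟨⟨by linarith, by linarith⟩, h3⟩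
  have hl : IntegrableOn F (Icc (-1/2:ℝ) (1/2) ×ˢ Icc c d) := hF.mono_set (Set.prod_mono (Icc_subset_Icc le_rfl (by norm_num)) le_rfl)
  have hr : IntegrableOn F (Icc (1/2:ℝ) (3/2) ×ˢ Icc c d) := hF.mono_set (Set.prod_mono (Icc_subset_Icc (by norm_num) le_rfl) le_rfl)
  have i2 : IntegrableOn (fun p : ℝ × ℝ => F (1 - p.1, p.2)) (Icc (1/2:ℝ) (3/2) ×ˢ Icc c d) := by
    have := (mp.integrableOn_comp_preimage me (f := F) (s := Icc (-1/2:ℝ) (1/2) ×ˢ Icc c d)).2 hl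
    rw [pre] at this
    exact this
  refine ⟨i2, ?_⟩
  rw [fz_rect_split_x (m := 1/2) (by norm_num) (by norm_num) hF, integral_add hr i2, add_comm]
  congr 1
  have := mp.setIntegral_preimage_emb me F (Icc (-1/2:ℝ) (1/2) ×ˢ Icc c d)
  rw [pre] at this
  exact this.symm

theorem fz_fe {σ t : ℝ} (hσ : 0 < σ) (ht : 0 < t) :
    ‖riemannZeta ((1 - σ : ℝ) + t * I)‖ = ‖fzX (σ + t * I)‖ * ‖riemannZeta (σ + t * I)‖ := by
  have h := riemannZeta_one_sub (s := σ + t * I) (fun n h => by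
    have := congrArg Complex.im h; simp at this; linarith) (fun h => by
    have := congrArg Complex.im h; simp at this; linarith)
  have e : ((1 - σ : ℝ) + t * I : ℂ) = (starRingEnd ℂ) (1 - (σ + t * I)) := by
    apply Complex.ext <;> simp
  rw [e, riemannZeta_conj, Complex.norm_conj, h, norm_mul]
  rfl

theorem fz_zeta_an {a b c d : ℝ} (hc : 0 < c) : AnalyticOnNhd ℂ riemannZeta (Icc a b ×ℂ Icc c d) := by
  have : DifferentiableOn ℂ riemannZeta {s | 0 < s.im} := fun z hz =>
    (differentiableAt_riemannZeta (fun h => by rw [h] at hz; simp at hz)).differentiableWithinAt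
  refine (this.analyticOnNhd (isOpen_lt continuous_const Complex.continuous_im)).mono fun z hz => ?_
  have := hz.2.1
  show 0 < z.im
  linarith

theorem fz_zeta_ae (a b c d : ℝ) : ∀ᵐ p ∂((volume : Measure (ℝ × ℝ)).restrict (Icc a b ×ˢ Icc c d)),
    riemannZeta (p.1 + p.2 * I) ≠ 0 := by
  have hf : (Icc a b ×ℂ Icc c d ∩ riemannZetaZeros).Finite := (isCompact_Icc.reProdIm isCompact_Icc).inter_riemannZetaZeros_finite
  rw [ae_restrict_iff' (measurableSet_Icc.prod measurableSet_Icc)]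
  have hfin : ((fun z : ℂ => (z.re, z.im)) '' (Icc a b ×ℂ Icc c d ∩ riemannZetaZeros)).Finite := hf.image _
  have h0 := hfin.measure_zero (volume : Measure (ℝ × ℝ))
  filter_upwards [measure_eq_zero_iff_ae_notMem.1 h0] with p hp hpr hz
  apply hp
  refine ⟨p.1 + p.2 * I, ⟨fz_mem_rect hpr, hz⟩, by simp⟩

theorem fz_ident {X χ χ1 χ2} (hχ : FZChi X χ χ1 χ2) {N : ℕ} (hN : 2 ≤ N) {T : ℝ} (hT : 12 ≤ T) {k k1 k2 : ℝ → ℝ}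
    (hk : FZTest 12 T k k1 k2) {B : ℝ} (hb0 : ∀ x, |k x| ≤ B) (hb2 : ∀ x, |k2 x| ≤ B)
    (hX : IntegrableOn (fun p : ℝ × ℝ => Real.log ‖fzX (p.1 + p.2 * I)‖ * (χ p.1 * k2 p.2 + χ2 p.1 * k p.2)) (Icc (1/2:ℝ) (3/2) ×ˢ Icc 12 T)) :
    2 * π * ∑ᶠ ρ ∈ Icc (-1/2:ℝ) (3/2) ×ℂ Icc 12 T, ((analyticOrderAt riemannZeta ρ).toNat : ℝ) * (χ ρ.re * k ρ.im) =
     2 * (∫ p in Icc (1/2:ℝ) (3/2) ×ˢ Icc 12 T, Real.log ‖fzF N (p.1 + p.2 * I)‖ * (χ p.1 * k2 p.2 + χ2 p.1 * k p.2))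
     - 2 * (∫ t in (12:ℝ)..T, k t * (deriv (fzM N) ((1/2:ℝ) + t * I) / fzM N ((1/2:ℝ) + t * I)).re)
     + ∫ p in Icc (1/2:ℝ) (3/2) ×ˢ Icc 12 T, Real.log ‖fzX (p.1 + p.2 * I)‖ * (χ p.1 * k2 p.2 + χ2 p.1 * k p.2) := by
  have hX0 : 0 ≤ X := (abs_nonneg _).trans (hχ.b0 0)
  have hB0 : 0 ≤ B := (abs_nonneg _).trans (hb0 0)
  obtain ⟨hI, hid⟩ := fz_green_an (a := -1/2) (b := 3/2) (by norm_num) hT (fz_zeta_an (by norm_num))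
    ⟨(3/2:ℝ) + (12:ℝ) * I, by rw [mem_reProdIm]; simp; norm_num; exact hT, riemannZeta_ne_zero_of_one_le_re (by simp; norm_num)⟩ hχ.t hk
  rw [← hid]
  set W : ℝ × ℝ → ℝ := fun p => χ p.1 * k2 p.2 + χ2 p.1 * k p.2 with hW
  have cχ := hχ.t.c0
  have cχ2 := hχ.t.c2
  have ck := hk.c0
  have ck2 := hk.c2
  have Wc : Continuous W := by rw [hW]; fun_prop
  have Wb : ∀ p, ‖W p‖ ≤ 2 * (X * B) := fun p => by
    rw [hW, Real.norm_eq_abs]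
    refine (abs_add_le _ _).trans ?_
    rw [abs_mul, abs_mul]
    have m1 := mul_le_mul (hχ.b0 p.1) (hb2 p.2) (abs_nonneg _) hX0
    have m2 := mul_le_mul (hχ.b2 p.1) (hb0 p.2) (abs_nonneg _) hX0
    linarith
  have iF : IntegrableOn (fun p : ℝ × ℝ => Real.log ‖riemannZeta (p.1 + p.2 * I)‖ * W p) (Icc (-1/2:ℝ) (3/2) ×ˢ Icc 12 T) :=
    Integrable.mul_bdd (c := 2 * (X * B)) (g := W) hI Wc.aestronglyMeasurable (ae_of_all _ Wb)
  rw [(fz_reflect iF).2]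
  have iN0 := (fz_logF_int hN T).mono_set (Set.prod_mono (Icc_subset_Icc le_rfl (by norm_num : (3/2:ℝ) ≤ 2)) (le_refl (Icc 12 T)))
  have iN : IntegrableOn (fun p : ℝ × ℝ => Real.log ‖fzF N (p.1 + p.2 * I)‖ * W p) (Icc (1/2:ℝ) (3/2) ×ˢ Icc 12 T) :=
    Integrable.mul_bdd (c := 2 * (X * B)) (g := W) iN0 Wc.aestronglyMeasurable (ae_of_all _ Wb)
  have cM : ContinuousOn (fun p : ℝ × ℝ => Real.log ‖fzM N (p.1 + p.2 * I)‖) (Icc (1/2:ℝ) (3/2) ×ˢ Icc 12 T) := by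
    apply ContinuousOn.log
    · have := (fzM_diff N).continuous
      exact Continuous.continuousOn (by fun_prop)
    · intro p hp
      refine norm_ne_zero_iff.2 (fzM_ne N ?_)
      have := hp.1.1
      simp; linarith
  have iM : IntegrableOn (fun p : ℝ × ℝ => Real.log ‖fzM N (p.1 + p.2 * I)‖ * W p) (Icc (1/2:ℝ) (3/2) ×ˢ Icc 12 T) :=
    ContinuousOn.integrableOn_compact (isCompact_Icc.prod isCompact_Icc) (cM.mul Wc.continuousOn)
  have hM := fz_green_nv (a := 1/2) (b := 3/2) (c := 12) (d := T) (by norm_num) hT (g := fzM N) (χ := χ) (χ1 := χ1) (χ2 := χ2) (k := k) (k1 := k1) (k2 := k2)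
    (fun z _ => (fzM_diff N).analyticAt z) (fun z hz => fzM_ne N (by have := hz.1.1; linarith)) hχ.t.d0 hχ.t.d1 hχ.t.c2 hk
  have hM2 : ∫ p in Icc (1/2:ℝ) (3/2) ×ˢ Icc 12 T, Real.log ‖fzM N (p.1 + p.2 * I)‖ * W p = 
      ∫ t in (12:ℝ)..T, k t * (deriv (fzM N) ((1/2:ℝ) + t * I) / fzM N ((1/2:ℝ) + t * I)).re := by
    rw [hM]
    congr 1; ext t
    rw [hχ.t.zb, hχ.t.z1b, hχ.z1, hχ.one (1/2) (by norm_num)]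
    ring
  have iNM : IntegrableOn (fun p : ℝ × ℝ => 2*(Real.log ‖fzF N (p.1+p.2*I)‖ * W p) - 2*(Real.log ‖fzM N (p.1+p.2*I)‖ * W p)) (Icc (1/2:ℝ) (3/2) ×ˢ Icc 12 T) := (iN.const_mul 2).sub (iM.const_mul 2)
  rw [← hM2, ← integral_const_mul, ← integral_const_mul, ← integral_sub (iN.const_mul 2) (iM.const_mul 2), ← integral_add iNM hX]
  apply integral_congr_ae
  filter_upwards [fz_zeta_ae (1/2) (3/2) 12 T, ae_restrict_mem (measurableSet_Icc.prod measurableSet_Icc)] with p hp hpm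
  have s1 : 0 < p.1 := by linarith [hpm.1.1]
  have s2 : 0 < p.2 := by linarith [hpm.2.1]
  have hWr : W (1 - p.1, p.2) = W p := by simp only [hW]; rw [hχ.s0, hχ.s2]
  simp only [hWr]
  rw [fz_fe s1 s2, Real.log_mul (norm_ne_zero_iff.2 (fzX_ne s1 s2)) (norm_ne_zero_iff.2 hp)]
  have hf : fzF N (p.1 + p.2 * I) = fzM N (p.1 + p.2 * I) * riemannZeta (p.1 + p.2 * I) := rfl
  rw [hf, norm_mul, Real.log_mul (norm_ne_zero_iff.2 (fzM_ne N (by simpa using s1))) (norm_ne_zero_iff.2 hp)]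
  ring

noncomputable def fzSum (k : ℝ → ℝ) (T : ℝ) : ℝ := ∑ᶠ ρ ∈ zetaZerosUpTo T, (zetaZeroMult ρ : ℝ) * k ρ.im

theorem fz_zero_strip {ρ : ℂ} (h0 : riemannZeta ρ = 0) (him : 0 < ρ.im) : 0 < ρ.re ∧ ρ.re < 1 := by
  constructor
  · by_contra hre
    push Not at hre
    have e := fz_fe (σ := 1 - ρ.re) (t := ρ.im) (by linarith) him
    have e2 : (((1 - (1 - ρ.re) : ℝ) : ℂ) + ρ.im * I) = ρ := by
      apply Complex.ext <;> simp
    rw [e2, h0, norm_zero] at e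
    have n1 := norm_pos_iff.2 (fzX_ne (σ := 1 - ρ.re) (t := ρ.im) (by linarith) him)
    have n2 := norm_pos_iff.2 (riemannZeta_ne_zero_of_one_le_re (s := ((1 - ρ.re : ℝ) : ℂ) + ρ.im * I) (by simp; linarith))
    have := mul_pos n1 n2
    linarith
  · by_contra hre
    push Not at hre
    exact riemannZeta_ne_zero_of_one_le_re hre h0

theorem fz_mult_eq {ρ : ℂ} (him : 0 < ρ.im) : zetaZeroMult ρ = (analyticOrderAt riemannZeta ρ).toNat := by
  have : AnalyticAt ℂ riemannZeta ρ := fz_zeta_an (a := ρ.re) (b := ρ.re) (c := ρ.im) (d := ρ.im) him ρ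
    ⟨⟨le_rfl, le_rfl⟩, ⟨le_rfl, le_rfl⟩⟩
  unfold zetaZeroMult
  rw [dif_pos this]

theorem fz_sum_eq {X χ χ1 χ2} (hχ : FZChi X χ χ1 χ2) {T : ℝ} {k : ℝ → ℝ} (hk : ∀ t ≤ 12, k t = 0) :
    ∑ᶠ ρ ∈ Icc (-1/2:ℝ) (3/2) ×ℂ Icc 12 T, ((analyticOrderAt riemannZeta ρ).toNat : ℝ) * (χ ρ.re * k ρ.im) = fzSum k T := by
  unfold fzSum
  rw [finsum_mem_def, finsum_mem_def]
  congr 1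
  ext ρ
  by_cases hz : riemannZeta ρ = 0
  · by_cases him : 12 < ρ.im
    · have hs := fz_zero_strip hz (by linarith)
      by_cases hT : ρ.im ≤ T
      · rw [indicator_of_mem, indicator_of_mem, fz_mult_eq (by linarith), hχ.one _ ⟨hs.1.le, hs.2.le⟩, one_mul]
        · exact ⟨hz, hs.1, hs.2, by linarith, hT⟩
        · exact ⟨⟨by linarith, by linarith⟩, ⟨him.le, hT⟩⟩
      · rw [indicator_of_notMem, indicator_of_notMem]
        · exact fun h => hT h.2.2.2.2
        · exact fun h => hT h.2.2
    · have : k ρ.im = 0 := hk _ (not_lt.1 him)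
      simp only [indicator, this, mul_zero, ite_self]
  · rw [indicator_of_notMem (s := zetaZerosUpTo T) (fun h => hz h.1)]
    by_cases hm : ρ ∈ Icc (-1/2:ℝ) (3/2) ×ℂ Icc 12 T
    · have : AnalyticAt ℂ riemannZeta ρ := fz_zeta_an (by norm_num) ρ hm
      rw [indicator_of_mem hm, this.analyticOrderAt_eq_zero.2 hz]
      simp
    · rw [indicator_of_notMem hm]

theorem fz_main (B ε : ℝ) (hε : 0 < ε) : ∃ N0 : ℕ, ∀ N ≥ N0, ∃ T0 : ℝ, ∀ T ≥ T0, ∀ k k1 k2 : ℝ → ℝ,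
    FZB B k k1 k2 → (∀ t ≤ 12, k t = 0 ∧ k1 t = 0) → k T = 0 → k1 T = 0 →
    (∀ t ∈ Icc 12 T, |∫ u in (12:ℝ)..t, k u| ≤ B) →
    |2 * π * fzSum k T + 2 * ∫ t in (12:ℝ)..T, k t * (deriv (fzM N) ((1/2:ℝ) + t * I) / fzM N ((1/2:ℝ) + t * I)).re| ≤ ε * T := by
  obtain ⟨X, χ, χ1, χ2, hχ⟩ := fz_chi
  have hX0 : 0 ≤ X := (abs_nonneg _).trans (hχ.b0 0)
  obtain ⟨A, hA, hosc⟩ := fz_osc2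
  obtain ⟨N0, hN0⟩ := fz_key (ε := ε / (8 * (X * |B| + 1))) (by positivity)
  refine ⟨max N0 2, fun N hN => ?_⟩
  obtain ⟨T0, hT0⟩ := hN0 N ((le_max_left _ _).trans hN)
  have hN2 : 2 ≤ N := (le_max_right _ _).trans hN
  have hlog : ∀ᶠ T : ℝ in atTop, 2 * X * (|B| * (A + 10 * Real.log T)) ≤ ε / 2 * T := by
    have h1 : (fun T : ℝ => 2 * X * (|B| * (A + 10 * Real.log T))) =o[atTop] (fun T : ℝ => T) := by
      have a1 : (fun _ : ℝ => A) =o[atTop] (fun T : ℝ => T) := Asymptotics.isLittleO_const_id_atTop A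
      have a2 : (fun T : ℝ => Real.log T) =o[atTop] (fun T : ℝ => T) := Real.isLittleO_log_id_atTop
      exact ((a1.add (a2.const_mul_left 10)).const_mul_left |B|).const_mul_left (2 * X)
    filter_upwards [h1.bound (half_pos hε), eventually_ge_atTop 0] with T hT h0
    rw [Real.norm_eq_abs, Real.norm_of_nonneg h0] at hT
    exact (le_abs_self _).trans hT
  obtain ⟨T1, hT1⟩ := eventually_atTop.1 hlog
  refine ⟨max 12 (max T0 T1), fun T hT k k1 k2 hk hz hzT hz1T hp => ?_⟩
  have hT12 : 12 ≤ T := (le_max_left _ _).trans hT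
  have hB : 0 ≤ B := hk.nonneg
  have hk' : FZTest 12 T k k1 k2 := ⟨hk.d0, hk.d1, hk.c2, (hz 12 le_rfl).1, hzT, (hz 12 le_rfl).2, hz1T⟩
  obtain ⟨iX, bX⟩ := hosc T hT12 χ χ2 k k1 k2 X B hX0 hχ.t.c0 hχ.t.c2 hχ.b0 hχ.b2 hk.c0 hk.c2 hk.d1 (fun t _ => hk.b1 t) hp
  have hid := fz_ident hχ hN2 hT12 hk' hk.b0 hk.b2 iX
  rw [fz_sum_eq hχ (fun t ht => (hz t ht).1)] at hid
  rw [hid]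
  have hl := hT1 T ((le_max_right _ _).trans ((le_max_right _ _).trans hT))
  have hkey := hT0 T ((le_max_left _ _).trans ((le_max_right _ _).trans hT))
  rw [abs_of_nonneg hB] at hl hkey
  have hF : |∫ p in Icc (1/2:ℝ) (3/2) ×ˢ Icc 12 T, Real.log ‖fzF N (p.1 + p.2 * I)‖ * (χ p.1 * k2 p.2 + χ2 p.1 * k p.2)| ≤ 2 * (X * B) * (ε / (8 * (X * B + 1)) * T) := by
    have i0 := (fz_logF_int hN2 T)
    have i1 := IntegrableOn.mono_set (Integrable.abs i0) (Set.prod_mono (Icc_subset_Icc le_rfl (by norm_num : (3/2:ℝ) ≤ 2)) (le_refl (Icc 12 T)))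
    calc _ ≤ ∫ p in Icc (1/2:ℝ) (3/2) ×ˢ Icc 12 T, 2 * (X * B) * |Real.log ‖fzF N (p.1 + p.2 * I)‖| := by
          rw [← Real.norm_eq_abs]
          refine norm_integral_le_of_norm_le (i1.const_mul _) (ae_of_all _ fun p => ?_)
          rw [Real.norm_eq_abs, abs_mul, mul_comm]
          refine mul_le_mul_of_nonneg_right ?_ (abs_nonneg _)
          refine (abs_add_le _ _).trans ?_
          rw [abs_mul, abs_mul]
          have m1 := mul_le_mul (hχ.b0 p.1) (hk.b2 p.2) (abs_nonneg _) hX0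
          have m2 := mul_le_mul (hχ.b2 p.1) (hk.b0 p.2) (abs_nonneg _) hX0
          linarith
      _ = 2 * (X * B) * ∫ p in Icc (1/2:ℝ) (3/2) ×ˢ Icc 12 T, |Real.log ‖fzF N (p.1 + p.2 * I)‖| := integral_const_mul _ _
      _ ≤ _ := by
          refine mul_le_mul_of_nonneg_left (le_trans ?_ hkey) (by positivity)
          exact setIntegral_mono_set i0.abs (ae_of_all _ fun _ => abs_nonneg _)
            (Set.prod_mono (Icc_subset_Icc le_rfl (by norm_num : (3/2:ℝ) ≤ 2)) (le_refl (Icc 12 T))).eventuallyLE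
  have hF2 : 2 * (X * B) * (ε / (8 * (X * B + 1)) * T) ≤ ε / 4 * T := by
    have hXB : 0 ≤ X * B := mul_nonneg hX0 hB
    have e : 2 * (X * B) * (ε / (8 * (X * B + 1)) * T) = ε / 4 * T * ((X * B) / (X * B + 1)) := by
      field_simp; ring
    rw [e]
    have : (X * B) / (X * B + 1) ≤ 1 := (div_le_one (by linarith)).2 (by linarith)
    have h2 : 0 ≤ ε / 4 * T := by positivity
    nlinarith
  rw [abs_le] at hF bX ⊢
  constructor <;> linarith [hF.1, hF.2, bX.1, bX.2]

theorem fz_per_bdd {E : Type*} [NormedAddCommGroup E] {F : ℝ → E} (hF : Continuous F) {P : ℝ} (hP : 0 < P) (hper : Function.Periodic F P) :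
    ∃ B, 0 ≤ B ∧ ∀ x, ‖F x‖ ≤ B := by
  obtain ⟨B, hB⟩ := (isCompact_Icc (a := (0:ℝ)) (b := P)).exists_bound_of_continuousOn hF.continuousOn
  refine ⟨B, (norm_nonneg _).trans (hB 0 ⟨le_rfl, hP.le⟩), fun x => ?_⟩
  obtain ⟨y, hy, e⟩ := hper.exists_mem_Ico₀ hP x
  rw [e]
  exact hB y ⟨hy.1, hy.2.le⟩

theorem fz_prim {E : Type*} [NormedAddCommGroup E] [NormedSpace ℝ E] [CompleteSpace E] {F : ℝ → E} (hF : Continuous F) {P : ℝ} (hP : 0 < P)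
    (hper : Function.Periodic F P) (h0 : ∫ t in (0:ℝ)..P, F t = 0) : ∃ B, 0 ≤ B ∧ ∀ x, ‖∫ t in (0:ℝ)..x, F t‖ ≤ B := by
  refine fz_per_bdd (F := fun x => ∫ t in (0:ℝ)..x, F t) ?_ hP ?_
  · exact continuous_iff_continuousAt.2 fun x => (intervalIntegral.integral_hasDerivAt_right (hF.intervalIntegrable _ _)
      (hF.stronglyMeasurableAtFilter _ _) hF.continuousAt).continuousAt
  · intro x
    have := hper.intervalIntegral_add_eq x 0
    rw [zero_add, h0] at this
    show ∫ t in (0:ℝ)..(x+P), F t = _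
    rw [← intervalIntegral.integral_add_adjacent_intervals (hF.intervalIntegrable 0 x) (hF.intervalIntegrable x (x+P)), this, add_zero]

def fzMean (F : ℝ → ℂ) (m : ℂ) : Prop := Tendsto (fun T : ℝ => ((T⁻¹ : ℝ) : ℂ) * ∫ t in (0:ℝ)..T, F t) atTop (nhds m)

theorem fzMean_of_bdd {F : ℝ → ℂ} {m : ℂ} {B : ℝ} (h : ∀ T ≥ 0, ‖(∫ t in (0:ℝ)..T, F t) - T * m‖ ≤ B) : fzMean F m := by
  unfold fzMean
  rw [tendsto_iff_norm_sub_tendsto_zero]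
  have hB : Tendsto (fun T : ℝ => T⁻¹ * B) atTop (nhds 0) := by
    simpa using tendsto_inv_atTop_zero.mul_const B
  refine squeeze_zero' (Eventually.of_forall fun _ => norm_nonneg _) ?_ hB
  filter_upwards [eventually_gt_atTop 0] with T hT
  have e : ((T⁻¹ : ℝ) : ℂ) * (∫ t in (0:ℝ)..T, F t) - m = ((T⁻¹ : ℝ) : ℂ) * ((∫ t in (0:ℝ)..T, F t) - T * m) := by
    have : (T:ℂ) ≠ 0 := by exact_mod_cast hT.ne'
    push_cast
    field_simp
  rw [e, norm_mul, Complex.norm_real, Real.norm_of_nonneg (inv_nonneg.2 hT.le)]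
  exact mul_le_mul_of_nonneg_left (h T hT.le) (inv_nonneg.2 hT.le)

theorem fzMean_per {F : ℝ → ℂ} (hF : Continuous F) {P : ℝ} (hP : 0 < P) (hper : Function.Periodic F P) :
    fzMean F ((P⁻¹ : ℝ) * ∫ t in (0:ℝ)..P, F t) := by
  set m : ℂ := (P⁻¹ : ℝ) * ∫ t in (0:ℝ)..P, F t with hm
  have hPc : (P:ℂ) ≠ 0 := by exact_mod_cast hP.ne'
  obtain ⟨B, _, hB⟩ := fz_prim (F := fun t => F t - m) (by fun_prop) hP (fun x => by simp only [hper x]) (by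
    rw [intervalIntegral.integral_sub (hF.intervalIntegrable _ _) (by simp)]
    simp [hm]
    field_simp; simp)
  refine fzMean_of_bdd (B := B) fun T _ => ?_
  have := hB T
  rw [intervalIntegral.integral_sub (hF.intervalIntegrable _ _) (by simp)] at this
  simpa using this

theorem fzMean_tw {F : ℝ → ℂ} (hF : Continuous F) {P : ℝ} (hP : 0 < P) {w : ℂ} (hw : w ≠ 1) {H : ℝ} (hH : ∀ x, ‖F x‖ ≤ H)
    (hper : ∀ x, F (x + P) = w * F x) : fzMean F 0 := by
  refine fzMean_of_bdd (B := 2 * (H * P) / ‖w - 1‖) fun T _ => ?_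
  have hI : ∀ a b, IntervalIntegrable F volume a b := fun a b => hF.intervalIntegrable a b
  have e1 : w * ∫ t in (0:ℝ)..T, F t = ∫ t in P..(T+P), F t := by
    rw [← intervalIntegral.integral_const_mul]
    have := intervalIntegral.integral_comp_add_right (a := 0) (b := T) F P
    rw [zero_add] at this
    rw [← this]
    congr 1; ext t; rw [hper]
  have e2 : (w - 1) * ∫ t in (0:ℝ)..T, F t = (∫ t in T..(T+P), F t) - ∫ t in (0:ℝ)..P, F t := by
    have a1 := intervalIntegral.integral_add_adjacent_intervals (hI 0 P) (hI P (T+P))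
    have a2 := intervalIntegral.integral_add_adjacent_intervals (hI 0 T) (hI T (T+P))
    rw [sub_mul, e1]
    linear_combination a1 - a2
  have b1 := intervalIntegral.norm_integral_le_of_norm_le_const (f := F) (a := T) (b := T + P) (C := H) (fun x _ => hH x)
  have b2 := intervalIntegral.norm_integral_le_of_norm_le_const (f := F) (a := 0) (b := P) (C := H) (fun x _ => hH x)
  rw [add_sub_cancel_left, abs_of_pos hP] at b1
  rw [sub_zero, abs_of_pos hP] at b2
  have hw' : 0 < ‖w - 1‖ := norm_pos_iff.2 (sub_ne_zero.2 hw)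
  rw [mul_zero, sub_zero, le_div_iff₀ hw', mul_comm, ← norm_mul, e2]
  refine (norm_sub_le _ _).trans ?_
  linarith

theorem fzMean_tsum {f : ℕ → ℝ → ℂ} (hf : ∀ j, Continuous (f j)) {u : ℕ → ℝ} (hu : Summable u) (hb : ∀ j t, ‖f j t‖ ≤ u j)
    {m : ℕ → ℂ} (hm : ∀ j, fzMean (f j) (m j)) : fzMean (fun t => ∑' j, f j t) (∑' j, m j) := by
  unfold fzMean at *
  have e : ∀ T : ℝ, ((T⁻¹ : ℝ) : ℂ) * ∫ t in (0:ℝ)..T, ∑' j, f j t = ∑' j, ((T⁻¹ : ℝ) : ℂ) * ∫ t in (0:ℝ)..T, f j t := by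
    intro T
    rw [tsum_mul_left]
    congr 1
    symm
    refine (intervalIntegral.hasSum_integral_of_dominated_convergence (fun j _ => u j) (fun j => (hf j).aestronglyMeasurable)
      (fun j => ae_of_all _ fun t _ => hb j t) (ae_of_all _ fun t _ => hu) (by simp) (ae_of_all _ fun t _ => ?_)).tsum_eq
    exact (hu.of_norm_bounded (fun j => hb j t)).hasSum
  simp only [e]
  refine tendsto_tsum_of_dominated_convergence (bound := u) hu hm ?_
  filter_upwards [eventually_gt_atTop 0] with T hT j
  rw [norm_mul, Complex.norm_real, Real.norm_of_nonneg (inv_nonneg.2 hT.le)]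
  have b1 := intervalIntegral.norm_integral_le_of_norm_le_const (f := f j) (a := 0) (b := T) (C := u j) (fun x _ => hb j x)
  rw [sub_zero, abs_of_pos hT] at b1
  calc _ ≤ T⁻¹ * (u j * T) := mul_le_mul_of_nonneg_left b1 (inv_nonneg.2 hT.le)
    _ = u j := by field_simp

theorem fzMean.const_mul {F : ℝ → ℂ} {m : ℂ} (h : fzMean F m) (c : ℂ) : fzMean (fun t => c * F t) (c * m) := by
  unfold fzMean at *
  have := h.const_mul c
  refine this.congr fun T => ?_
  rw [intervalIntegral.integral_const_mul]; ring

theorem fzMean.finset_sum {ι : Type*} (s : Finset ι) {F : ι → ℝ → ℂ} {m : ι → ℂ} (hc : ∀ i ∈ s, Continuous (F i)) (h : ∀ i ∈ s, fzMean (F i) (m i)) :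
    fzMean (fun t => ∑ i ∈ s, F i t) (∑ i ∈ s, m i) := by
  unfold fzMean at *
  refine (tendsto_finsetSum s h).congr fun T => ?_
  rw [intervalIntegral.integral_finsetSum (fun i hi => (hc i hi).intervalIntegrable _ _), Finset.mul_sum]

noncomputable def fzEu (p : ℕ) (t : ℝ) : ℂ := Real.log p * ((p:ℂ)^(-((1/2:ℝ) + t * I)) / (1 - (p:ℂ)^(-((1/2:ℝ) + t * I))))

open Classical in
noncomputable def fzm (h : ℝ → ℝ) (α l : ℝ) : ℂ := if cexp (-(l / α : ℝ) * I) = 1 then ∫ u in (0:ℝ)..1, (h u : ℂ) * cexp (-(l / α * u : ℝ) * I) else 0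

theorem fz_term {h : ℝ → ℝ} (hc : Continuous h) (hper : Function.Periodic h 1) {α : ℝ} (hα : 0 < α) (l : ℝ) :
    fzMean (fun t => (h (α * t) : ℂ) * cexp (-(l * t : ℝ) * I)) (fzm h α l) := by
  have hFc : Continuous (fun t : ℝ => (h (α * t) : ℂ) * cexp (-(l * t : ℝ) * I)) := by fun_prop
  obtain ⟨H, hH0, hH⟩ := fz_per_bdd hc one_pos hper
  have hsh : ∀ t : ℝ, (h (α * (t + α⁻¹)) : ℂ) * cexp (-(l * (t + α⁻¹) : ℝ) * I) = cexp (-(l / α : ℝ) * I) * ((h (α * t) : ℂ) * cexp (-(l * t : ℝ) * I)) := by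
    intro t
    have e1 : α * (t + α⁻¹) = α * t + 1 := by field_simp
    rw [e1, hper]
    have e2 : (-(l * (t + α⁻¹) : ℝ) * I : ℂ) = -(l / α : ℝ) * I + -(l * t : ℝ) * I := by push_cast; ring
    rw [e2, Complex.exp_add]; ring
  unfold fzm
  split_ifs with hw
  · have := fzMean_per hFc (inv_pos.2 hα) (fun t => by have := hsh t; rw [hw, one_mul] at this; exact this)
    convert this using 1
    have cv := intervalIntegral.integral_comp_mul_left (a := 0) (b := α⁻¹) (fun u => (h u : ℂ) * cexp (-(l / α * u : ℝ) * I)) hα.ne'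
    rw [mul_zero, mul_inv_cancel₀ hα.ne'] at cv
    have e3 : ∀ t : ℝ, (l / α * (α * t) : ℝ) = l * t := fun t => by field_simp
    simp only [e3] at cv
    rw [cv, inv_inv, Complex.real_smul]
    rw [← mul_assoc, ← Complex.ofReal_mul, mul_inv_cancel₀ hα.ne']; simp
  · refine fzMean_tw hFc (inv_pos.2 hα) hw (H := H) (fun x => ?_) hsh
    rw [norm_mul, Complex.norm_real, ← Complex.ofReal_neg, Complex.norm_exp_ofReal_mul_I, mul_one]
    exact hH _

theorem fz_pexp {p : ℕ} (hp : p.Prime) (t : ℝ) (j : ℕ) : ((p:ℂ)^(-((1/2:ℝ) + t * I)))^j = ((p:ℝ)^(-(1/2:ℝ)) : ℝ)^j * cexp (-((j * Real.log p) * t : ℝ) * I) := by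
  have hp0 : (p:ℂ) ≠ 0 := by exact_mod_cast hp.ne_zero
  have hpp : (0:ℝ) < p := by exact_mod_cast hp.pos
  rw [neg_add, Complex.cpow_add _ _ hp0, mul_pow]
  congr 1
  · rw [← Complex.ofReal_neg, ← Complex.ofReal_natCast, ← Complex.ofReal_cpow hpp.le]
  · rw [Complex.cpow_def_of_ne_zero hp0, ← Complex.exp_nat_mul, ← Complex.natCast_log]
    congr 1
    push_cast; ring

theorem fz_plt {p : ℕ} (hp : p.Prime) : 0 < (p:ℝ)^(-(1/2:ℝ)) ∧ (p:ℝ)^(-(1/2:ℝ)) < 1 := by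
  have h1 : (1:ℝ) < p := by exact_mod_cast hp.one_lt
  exact ⟨by positivity, Real.rpow_lt_one_of_one_lt_of_neg h1 (by norm_num)⟩

theorem fzEu_tsum {p : ℕ} (hp : p.Prime) (t : ℝ) : fzEu p t = Real.log p * ∑' j : ℕ, ((p:ℂ)^(-((1/2:ℝ) + t * I)))^(j+1) := by
  have hz := fz_p_lt hp (s := (1/2:ℝ) + t * I) (by simp)
  unfold fzEu
  simp only [pow_succ]
  rw [tsum_mul_right, tsum_geometric_of_norm_lt_one hz]
  rw [div_eq_inv_mul]

theorem fzEu_cont {p : ℕ} (hp : p.Prime) : Continuous (fzEu p) := by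
  have hp0 : (p:ℂ) ≠ 0 := by exact_mod_cast hp.ne_zero
  have h1 : Continuous (fun t : ℝ => (p:ℂ)^(-((1/2:ℝ) + t * I))) := by
    refine Continuous.const_cpow (by fun_prop) (Or.inl hp0)
  unfold fzEu
  exact continuous_const.mul (h1.div (continuous_const.sub h1) fun t => fz_p_ne hp (by simp))

theorem fz_prime_mean {h : ℝ → ℝ} (hc : Continuous h) (hper : Function.Periodic h 1) {α : ℝ} (hα : 0 < α) {p : ℕ} (hp : p.Prime) :
    fzMean (fun t => (h (α * t) : ℂ) * fzEu p t) (Real.log p * ∑' j : ℕ, (((p:ℝ)^(-(1/2:ℝ)) : ℝ) : ℂ)^(j+1) * fzm h α ((j+1 : ℕ) * Real.log p)) := by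
  obtain ⟨H, hH0, hH⟩ := fz_per_bdd hc one_pos hper
  obtain ⟨r0, r1⟩ := fz_plt hp
  set r := (p:ℝ)^(-(1/2:ℝ)) with hr
  have hs : Summable (fun j : ℕ => r^(j+1) * H) := by
    simp only [pow_succ]
    exact ((summable_geometric_of_lt_one r0.le r1).mul_right r).mul_right H
  have key := (fzMean_tsum (f := fun j t => (r:ℂ)^(j+1) * ((h (α * t) : ℂ) * cexp (-(((j+1 : ℕ) * Real.log p) * t : ℝ) * I)))
    (fun j => by fun_prop) hs (fun j t => by
      rw [norm_mul, norm_mul, norm_pow, Complex.norm_real, Complex.norm_real, ← Complex.ofReal_neg, Complex.norm_exp_ofReal_mul_I, mul_one,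
        Real.norm_of_nonneg r0.le]
      exact mul_le_mul_of_nonneg_left (hH _) (by positivity))
    (fun j => (fz_term hc hper hα ((j+1 : ℕ) * Real.log p)).const_mul _)).const_mul (Real.log p : ℂ)
  convert key using 1
  ext t
  rw [fzEu_tsum hp]
  simp only [fz_pexp hp]
  rw [mul_left_comm, ← tsum_mul_left]
  congr 2
  ext j
  ring

theorem fzM_logDeriv (N : ℕ) (t : ℝ) : deriv (fzM N) ((1/2:ℝ) + t * I) / fzM N ((1/2:ℝ) + t * I) = ∑ p ∈ (N.factorial).primeFactors, fzEu p t := by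
  set s : ℂ := (1/2:ℝ) + t * I with hs
  have hre : 0 < s.re := by rw [hs]; simp
  have hd : ∀ p ∈ (N.factorial).primeFactors, HasDerivAt (fun s : ℂ => 1 - (p : ℂ) ^ (-s)) (Real.log p * (p:ℂ)^(-s)) s := by
    intro p hp
    have hp0 : (p:ℂ) ≠ 0 := by exact_mod_cast (Nat.prime_of_mem_primeFactors hp).ne_zero
    have := (((hasDerivAt_id s).neg).const_cpow (c := (p:ℂ)) (Or.inl hp0)).const_sub 1
    refine HasDerivAt.congr_deriv this ?_
    rw [← Complex.natCast_log]
    simp; ring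
  have e : fzM N = fun s => ∏ p ∈ (N.factorial).primeFactors, (fun s : ℂ => (1 - (p:ℂ)^(-s))) s := rfl
  have := logDeriv_prod (s := (N.factorial).primeFactors) (f := fun (p:ℕ) (s : ℂ) => (1 - (p:ℂ)^(-s))) (x := s)
    (fun p hp => fz_p_ne (Nat.prime_of_mem_primeFactors hp) hre) (fun p hp => (hd p hp).differentiableAt)
  rw [← logDeriv_apply, e, this]
  refine Finset.sum_congr rfl fun p hp => ?_
  rw [logDeriv_apply, (hd p hp).deriv, fzEu, ← hs, mul_div_assoc]

theorem fz_exp1 {α l : ℝ} (hα : 0 < α) (hl : 0 < l) : cexp (-(l / α : ℝ) * I) = 1 ↔ ∃ n : ℕ, 0 < n ∧ l = 2 * π * n * α := by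
  rw [Complex.exp_eq_one_iff]
  constructor
  · rintro ⟨n, hn⟩
    have h1 : -(l / α) = n * (2 * π) := by
      have := congrArg Complex.im hn
      simpa using this
    have h2 : l = 2 * π * (-(n:ℝ)) * α := by field_simp at h1; linarith
    have h3 : (n:ℝ) < 0 := by
      by_contra h
      push Not at h
      have : 0 ≤ 2 * π * n * α := by positivity
      nlinarith
    have h4 : n < 0 := by exact_mod_cast h3
    refine ⟨(-n).toNat, by omega, ?_⟩
    have h5 : (((-n).toNat : ℤ) : ℝ) = ((-n : ℤ) : ℝ) := by rw [Int.toNat_of_nonneg (by omega)]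
    push_cast at h5
    rw [h5]; exact h2
  · rintro ⟨n, hn, rfl⟩
    refine ⟨-n, ?_⟩
    have : (2 * π * n * α / α : ℝ) = 2 * π * n := by field_simp
    rw [this]
    push_cast; ring

theorem fz_special_of {α : ℝ} {p j n : ℕ} (hp : p.Prime) (hj : 0 < j) (hn : 0 < n) (h : j * Real.log p = 2 * π * n * α) :
    ∃ a q, IsSpecialForm α p a q := by
  have hg : 0 < Nat.gcd j n := Nat.gcd_pos_of_pos_left _ hj
  obtain ⟨a, q, hc, ha, hq⟩ := Nat.exists_coprime j n
  refine ⟨a, q, hp, ?_, ?_, hc, ?_⟩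
  · rcases Nat.eq_zero_or_pos a with h0 | h0
    · rw [h0, zero_mul] at ha; omega
    · exact h0
  · rcases Nat.eq_zero_or_pos q with h0 | h0
    · rw [h0, zero_mul] at hq; omega
    · exact h0
  · have hq0 : (0:ℝ) < n := by exact_mod_cast hn
    have ha' : (j:ℝ) = a * (Nat.gcd j n : ℝ) := by exact_mod_cast ha
    have hq' : (n:ℝ) = q * (Nat.gcd j n : ℝ) := by exact_mod_cast hq
    have hg' : (0:ℝ) < Nat.gcd j n := by exact_mod_cast hg
    generalize (Nat.gcd j n : ℝ) = G at *
    have hqp : (0:ℝ) < q := by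
      rw [hq'] at hq0
      exact pos_of_mul_pos_left hq0 hg'.le
    rw [ha', hq'] at h
    rw [eq_div_iff (by positivity)]
    have := mul_right_cancel₀ hg'.ne' (show (a * Real.log p) * G = (2 * π * q * α) * G by linarith)
    linarith

theorem fz_special_uniq {α : ℝ} {p a q p' j n : ℕ} (hs : IsSpecialForm α p a q) (hp' : p'.Prime) (hj : 0 < j) (hn : 0 < n)
    (h : j * Real.log p' = 2 * π * n * α) : p' = p ∧ a ∣ j := by
  obtain ⟨hp, ha, hq, hc, rfl⟩ := hs
  have hq0 : (0:ℝ) < q := by exact_mod_cast hq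
  have h1 : ((q * j : ℕ) : ℝ) * Real.log p' = ((n * a : ℕ) : ℝ) * Real.log p := by
    field_simp at h
    push_cast; linarith
  have h2 : p' ^ (q * j) = p ^ (n * a) := by
    rw [← Real.log_pow, ← Real.log_pow] at h1
    have pp : (0:ℝ) < p := by exact_mod_cast hp.pos
    have pp' : (0:ℝ) < p' := by exact_mod_cast hp'.pos
    have := Real.log_injOn_pos (show (p':ℝ)^(q*j) ∈ Ioi 0 from mem_Ioi.2 (by positivity)) (show (p:ℝ)^(n*a) ∈ Ioi 0 from mem_Ioi.2 (by positivity)) h1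
    exact_mod_cast this
  have h3 : p' = p := by
    have : p' ∣ p ^ (n * a) := h2 ▸ dvd_pow_self p' (by positivity)
    exact (Nat.prime_dvd_prime_iff_eq hp' hp).1 (hp'.dvd_of_dvd_pow this)
  refine ⟨h3, ?_⟩
  rw [h3] at h2
  have h4 : q * j = n * a := Nat.pow_right_injective hp.two_le h2
  exact hc.dvd_of_dvd_mul_left (h4 ▸ Dvd.intro_left n rfl)

theorem fz_rew {R θ r : ℝ} (hr0 : 0 < r) (hr1 : r < 1) (hR : R * r = 1) :
    (((r:ℂ) * cexp (-(θ:ℝ) * I)) / (1 - (r:ℂ) * cexp (-(θ:ℝ) * I))).re = (R * Real.cos θ - 1) / (R^2 - 2 * R * Real.cos θ + 1) := by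
  set w := (r:ℂ) * cexp (-(θ:ℝ) * I) with hw
  have e1 : w.re = r * Real.cos θ := by
    rw [hw, ← Complex.ofReal_neg, Complex.exp_mul_I, ← Complex.ofReal_cos, ← Complex.ofReal_sin]
    simp [-Complex.ofReal_cos, -Complex.ofReal_sin]
  have e2 : w.im = - (r * Real.sin θ) := by
    rw [hw, ← Complex.ofReal_neg, Complex.exp_mul_I, ← Complex.ofReal_cos, ← Complex.ofReal_sin]
    simp [-Complex.ofReal_cos, -Complex.ofReal_sin]
  have hR1 : 1 < R := by
    by_contra h
    push Not at h
    nlinarith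
  have hc := Real.cos_le_one θ
  have hsc := Real.sin_sq_add_cos_sq θ
  have d1 : 0 < R^2 - 2 * R * Real.cos θ + 1 := by nlinarith
  have d2 : 0 < (1 - r * Real.cos θ)^2 + (r * Real.sin θ)^2 := by
    have : r * Real.cos θ < 1 := by nlinarith
    have : 0 < (1 - r * Real.cos θ)^2 := by apply pow_pos; linarith
    positivity
  rw [Complex.div_re, Complex.normSq_apply]
  simp only [Complex.sub_re, Complex.sub_im, Complex.one_re, Complex.one_im, e1, e2, zero_sub, neg_neg]
  rw [← add_div, div_eq_div_iff (by nlinarith) d1.ne']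
  have hrR : r = R⁻¹ := by field_simp; linarith
  have hRp : 0 < R := by linarith
  have hs2 : Real.sin θ ^2 = 1 - Real.cos θ^2 := by linarith
  rw [hrR]
  field_simp
  ring_nf
  rw [hs2]
  ring

theorem fz_tsum_eval {h : ℝ → ℝ} (hc : Continuous h) (hper : Function.Periodic h 1) {α : ℝ} (hα : 0 < α) {p a q : ℕ} (hs : IsSpecialForm α p a q) :
    ∑' j : ℕ, (((p:ℝ)^(-(1/2:ℝ)) : ℝ) : ℂ)^(j+1) * fzm h α ((j+1 : ℕ) * Real.log p)
     = ∫ u in (0:ℝ)..1, (h u : ℂ) * ((((p:ℝ)^(-(1/2:ℝ)))^a : ℝ) * cexp (-(2 * π * q * u : ℝ) * I) / (1 - (((p:ℝ)^(-(1/2:ℝ)))^a : ℝ) * cexp (-(2 * π * q * u : ℝ) * I))) := by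
  obtain ⟨hp, ha, hq, hco, hαe⟩ := id hs
  obtain ⟨H, hH0, hH⟩ := fz_per_bdd hc one_pos hper
  obtain ⟨r0, r1⟩ := fz_plt hp
  set r := (p:ℝ)^(-(1/2:ℝ)) with hr
  have hlp : 0 < Real.log p := Real.log_pos (by exact_mod_cast hp.one_lt)
  have hq0 : (0:ℝ) < q := by exact_mod_cast hq
  have ha0 : (0:ℝ) < a := by exact_mod_cast ha
  let φ : ℕ → ℕ := fun k => a * (k+1) - 1
  have hφ1 : ∀ k, φ k + 1 = a * (k+1) := fun k => Nat.sub_add_cancel (Nat.mul_pos ha (Nat.succ_pos k))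
  have hφ : Function.Injective φ := by
    intro x y hxy
    have := hφ1 x
    rw [hxy, hφ1 y] at this
    have := Nat.eq_of_mul_eq_mul_left ha this
    omega
  have hsupp : Function.support (fun j : ℕ => (r:ℂ)^(j+1) * fzm h α ((j+1 : ℕ) * Real.log p)) ⊆ Set.range φ := by
    intro j hj
    by_contra hn
    apply hj
    have : fzm h α ((j+1 : ℕ) * Real.log p) = 0 := by
      unfold fzm
      rw [if_neg]
      rw [fz_exp1 hα (by positivity)]
      rintro ⟨n, hn0, e⟩
      obtain ⟨-, k, hk⟩ := fz_special_uniq hs hp (Nat.succ_pos j) hn0 e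
      apply hn
      have hk0 : 0 < k := by
        rcases Nat.eq_zero_or_pos k with h0 | h0
        · rw [h0, mul_zero] at hk; omega
        · exact h0
      refine ⟨k - 1, ?_⟩
      have := hφ1 (k-1)
      rw [Nat.sub_add_cancel hk0, ← hk] at this
      omega
    simp only [this, mul_zero]
  rw [← hφ.tsum_eq hsupp]
  have hval : ∀ k : ℕ, (r:ℂ)^(φ k+1) * fzm h α ((φ k+1 : ℕ) * Real.log p) = ∫ u in (0:ℝ)..1, (h u : ℂ) * (((r^a : ℝ) : ℂ) * cexp (-(2 * π * q * u : ℝ) * I))^(k+1) := by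
    intro k
    have hl : ((φ k+1 : ℕ) * Real.log p) / α = 2 * π * q * (k+1 : ℕ) := by
      rw [hφ1, hαe]; push_cast; field_simp
    unfold fzm
    rw [if_pos, ← intervalIntegral.integral_const_mul]
    · congr 1; ext u
      rw [hl, hφ1, mul_pow, ← Complex.exp_nat_mul]
      rw [mul_left_comm]
      congr 2
      · push_cast; rw [pow_mul]
      · congr 1; push_cast; ring
    · rw [fz_exp1 hα (by positivity)]
      refine ⟨q * (k+1), by positivity, ?_⟩
      rw [div_eq_iff hα.ne'] at hl
      rw [hl]; push_cast; ring
  simp only [hval]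
  have ra : r^a < 1 := pow_lt_one₀ r0.le r1 ha.ne'
  have ra0 : 0 < r^a := by positivity
  have hnw : ∀ u : ℝ, ‖((r^a : ℝ) : ℂ) * cexp (-(2 * π * q * u : ℝ) * I)‖ = r^a := fun u => by
    rw [norm_mul, Complex.norm_real, ← Complex.ofReal_neg, Complex.norm_exp_ofReal_mul_I, mul_one, Real.norm_of_nonneg ra0.le]
  refine (intervalIntegral.hasSum_integral_of_dominated_convergence (fun k _ => H * (r^a)^(k+1)) (fun k => ?_)
      (fun k => ae_of_all _ fun t _ => ?_) (ae_of_all _ fun t _ => ?_) (by simp) (ae_of_all _ fun t _ => ?_)).tsum_eq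
  · exact Continuous.aestronglyMeasurable (by fun_prop)
  · rw [norm_mul, norm_pow, hnw, Complex.norm_real]
    exact mul_le_mul_of_nonneg_right (hH t) (by positivity)
  · simp only [pow_succ]
    exact ((summable_geometric_of_lt_one ra0.le ra).mul_right _).mul_left H
  · refine HasSum.mul_left _ ?_
    have := (hasSum_geometric_of_norm_lt_one (ξ := ((r^a : ℝ) : ℂ) * cexp (-(2 * π * q * t : ℝ) * I)) (by rw [hnw]; exact ra)).mul_right (((r^a : ℝ) : ℂ) * cexp (-(2 * π * q * t : ℝ) * I))
    simp only [pow_succ]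
    rw [div_eq_inv_mul]
    exact this

theorem fz_eval_re {h : ℝ → ℝ} (hc : Continuous h) {p a q : ℕ} (hp : p.Prime) (ha : 0 < a) :
    ((Real.log p : ℂ) * ∫ u in (0:ℝ)..1, (h u : ℂ) * ((((p:ℝ)^(-(1/2:ℝ)))^a : ℝ) * cexp (-(2 * π * q * u : ℝ) * I) / (1 - (((p:ℝ)^(-(1/2:ℝ)))^a : ℝ) * cexp (-(2 * π * q * u : ℝ) * I)))).re
     = - π * ∫ u in (0:ℝ)..1, gPAQ p a q u * h u := by
  obtain ⟨r0, r1⟩ := fz_plt hp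
  set r := (p:ℝ)^(-(1/2:ℝ)) with hr
  have ra : r^a < 1 := pow_lt_one₀ r0.le r1 ha.ne'
  have ra0 : 0 < r^a := by positivity
  have hpp : (0:ℝ) < p := by exact_mod_cast hp.pos
  have hnw : ∀ u : ℝ, ‖((r^a : ℝ) : ℂ) * cexp (-(2 * π * q * u : ℝ) * I)‖ = r^a := fun u => by
    rw [norm_mul, Complex.norm_real, ← Complex.ofReal_neg, Complex.norm_exp_ofReal_mul_I, mul_one, Real.norm_of_nonneg ra0.le]
  have hR : (p:ℝ)^((a:ℝ)/2) * r^a = 1 := by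
    rw [hr, ← Real.rpow_natCast, ← Real.rpow_mul hpp.le, ← Real.rpow_add hpp]
    rw [show (a:ℝ)/2 + -(1/2) * a = 0 by ring, Real.rpow_zero]
  have hR2 : (p:ℝ)^(a:ℝ) = ((p:ℝ)^((a:ℝ)/2))^2 := by
    rw [← Real.rpow_natCast, ← Real.rpow_mul hpp.le]; congr 1; push_cast; ring
  rw [Complex.re_ofReal_mul]
  have hcw : Continuous (fun u : ℝ => ((r^a : ℝ) : ℂ) * cexp (-(2 * π * q * u : ℝ) * I)) := by fun_prop
  have hcont : Continuous (fun u : ℝ => (h u : ℂ) * (((r^a : ℝ) : ℂ) * cexp (-(2 * π * q * u : ℝ) * I) / (1 - ((r^a : ℝ) : ℂ) * cexp (-(2 * π * q * u : ℝ) * I)))) := by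
    refine (by fun_prop : Continuous fun u : ℝ => (h u : ℂ)).mul (hcw.div (continuous_const.sub hcw) fun u h0 => ?_)
    have := hnw u
    rw [← sub_eq_zero.1 h0, norm_one] at this
    linarith
  have := Complex.reCLM.intervalIntegral_comp_comm (hcont.intervalIntegrable (μ := volume) 0 1)
  simp only [Complex.reCLM_apply] at this
  rw [← this, ← intervalIntegral.integral_const_mul, ← intervalIntegral.integral_const_mul]
  congr 1; ext u
  rw [Complex.re_ofReal_mul, fz_rew ra0 ra hR, gPAQ, hR2]
  generalize (p:ℝ)^((a:ℝ)/2) = R at *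
  have hpi := Real.pi_pos
  generalize R^2 - 2 * R * Real.cos (2 * π * q * u) + 1 = D at *
  rcases eq_or_ne D 0 with h0 | h0
  · simp [h0]
  · field_simp

theorem fz_limit {h : ℝ → ℝ} (hc : Continuous h) (hper : Function.Periodic h 1) {α : ℝ} (hα : 0 < α) {g : ℝ → ℝ} (hg : IsDensityOf α g) :
    ∃ N1 : ℕ, ∀ N ≥ N1, ∃ m : ℂ, fzMean (fun t => (h (α * t) : ℂ) * (deriv (fzM N) ((1/2:ℝ) + t * I) / fzM N ((1/2:ℝ) + t * I))) m ∧
      m.re = - π * ∫ u in (0:ℝ)..1, g u * h u := by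
  have hgen : ∀ N, fzMean (fun t => (h (α * t) : ℂ) * (deriv (fzM N) ((1/2:ℝ) + t * I) / fzM N ((1/2:ℝ) + t * I)))
      (∑ p ∈ (N.factorial).primeFactors, Real.log p * ∑' j : ℕ, (((p:ℝ)^(-(1/2:ℝ)) : ℝ) : ℂ)^(j+1) * fzm h α ((j+1 : ℕ) * Real.log p)) := by
    intro N
    simp only [fzM_logDeriv, Finset.mul_sum]
    refine fzMean.finset_sum _ (fun p hp => ?_) (fun p hp => fz_prime_mean hc hper hα (Nat.prime_of_mem_primeFactors hp))
    have := fzEu_cont (Nat.prime_of_mem_primeFactors hp)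
    fun_prop
  have hz : ∀ p : ℕ, p.Prime → (∀ j n : ℕ, 0 < j → 0 < n → (j:ℝ) * Real.log p ≠ 2 * π * n * α) →
      (Real.log p * ∑' j : ℕ, (((p:ℝ)^(-(1/2:ℝ)) : ℝ) : ℂ)^(j+1) * fzm h α ((j+1 : ℕ) * Real.log p)) = 0 := by
    intro p hp hne
    have hlp : 0 < Real.log p := Real.log_pos (by exact_mod_cast hp.one_lt)
    have : ∀ j : ℕ, fzm h α ((j+1 : ℕ) * Real.log p) = 0 := by
      intro j
      unfold fzm
      rw [if_neg]
      rw [fz_exp1 hα (by positivity)]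
      rintro ⟨n, hn0, e⟩
      exact hne _ n (Nat.succ_pos j) hn0 e
    simp only [this, mul_zero, tsum_zero]
  by_cases hsp : ∃ p a q : ℕ, IsSpecialForm α p a q
  · obtain ⟨p, a, q, hs⟩ := hsp
    refine ⟨p, fun N hN => ⟨_, hgen N, ?_⟩⟩
    have hmem : p ∈ (N.factorial).primeFactors := by
      rw [Nat.mem_primeFactors]
      exact ⟨hs.1, hs.1.dvd_factorial.2 hN, Nat.factorial_ne_zero _⟩
    rw [Finset.sum_eq_single p, fz_tsum_eval hc hper hα hs, fz_eval_re hc hs.1 hs.2.1, hg.1 p a q hs]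
    · intro p' hp' hne
      refine hz p' (Nat.prime_of_mem_primeFactors hp') fun j n hj hn e => hne ?_
      exact (fz_special_uniq hs (Nat.prime_of_mem_primeFactors hp') hj hn e).1
    · exact fun h => absurd hmem h
  · refine ⟨0, fun N _ => ⟨_, hgen N, ?_⟩⟩
    rw [hg.2 hsp, Finset.sum_eq_zero]
    · simp
    · intro p hp
      refine hz p (Nat.prime_of_mem_primeFactors hp) fun j n hj hn e => hsp ?_
      obtain ⟨a, q, hs⟩ := fz_special_of (Nat.prime_of_mem_primeFactors hp) hj hn e
      exact ⟨p, a, q, hs⟩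

noncomputable def fzL (N : ℕ) (t : ℝ) : ℂ := deriv (fzM N) ((1/2:ℝ) + t * I) / fzM N ((1/2:ℝ) + t * I)

theorem fzL_cont (N : ℕ) : Continuous (fzL N) := by
  have : fzL N = fun t => ∑ p ∈ (N.factorial).primeFactors, fzEu p t := by
    ext t; exact fzM_logDeriv N t
  rw [this]
  exact continuous_finsetSum _ fun p hp => fzEu_cont (Nat.prime_of_mem_primeFactors hp)

theorem fzL_bdd (N : ℕ) : ∃ K, 0 ≤ K ∧ ∀ t, ‖fzL N t‖ ≤ K := by
  have hE : ∀ p : ℕ, p.Prime → ∀ t, ‖fzEu p t‖ ≤ |Real.log p| * ((p:ℝ)^(-(1/2:ℝ)) / (1 - (p:ℝ)^(-(1/2:ℝ)))) := by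
    intro p hp t
    obtain ⟨r0, r1⟩ := fz_plt hp
    have hz : ‖(p:ℂ)^(-((1/2:ℝ) + t * I))‖ = (p:ℝ)^(-(1/2:ℝ)) := by
      rw [Complex.norm_natCast_cpow_of_pos hp.pos]; simp
    unfold fzEu
    rw [norm_mul, norm_div, Complex.norm_real, Real.norm_eq_abs, hz]
    have h1 := norm_sub_norm_le (1:ℂ) ((p:ℂ)^(-((1/2:ℝ) + t * I)))
    rw [hz, norm_one] at h1
    refine mul_le_mul_of_nonneg_left ?_ (abs_nonneg _)
    exact div_le_div_of_nonneg_left r0.le (by linarith) h1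
  refine ⟨∑ p ∈ (N.factorial).primeFactors, |Real.log p| * ((p:ℝ)^(-(1/2:ℝ)) / (1 - (p:ℝ)^(-(1/2:ℝ)))), ?_, fun t => ?_⟩
  · refine Finset.sum_nonneg fun p hp => ?_
    obtain ⟨r0, r1⟩ := fz_plt (Nat.prime_of_mem_primeFactors hp)
    have : 0 < 1 - (p:ℝ)^(-(1/2:ℝ)) := by linarith
    positivity
  · unfold fzL
    rw [fzM_logDeriv]
    exact norm_sum_le_of_le _ fun p hp => hE p (Nat.prime_of_mem_primeFactors hp) t

theorem fz_gap {f : ℝ → ℝ} (hf : Continuous f) {c τ t : ℝ} (hb : ∀ x, |f x| ≤ c) (hz : ∀ x ∈ Icc 13 τ, f x = 0) (hτ : 13 ≤ τ)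
    (ht : t ∈ Icc 12 (τ + 3)) : |∫ u in (12:ℝ)..t, f u| ≤ 4 * c := by
  have hc : 0 ≤ c := (abs_nonneg _).trans (hb 0)
  have hI : ∀ a b, IntervalIntegrable f volume a b := fun a b => hf.intervalIntegrable a b
  have bd : ∀ a b, |∫ u in a..b, f u| ≤ c * |b - a| := fun a b => by
    rw [← Real.norm_eq_abs]
    exact intervalIntegral.norm_integral_le_of_norm_le_const (fun x _ => hb x)
  have z : ∀ b ∈ Icc 13 τ, ∫ u in (13:ℝ)..b, f u = 0 := fun b hb' => by
    rw [intervalIntegral.integral_congr (g := fun _ => 0), intervalIntegral.integral_zero]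
    intro x hx
    rw [uIcc_of_le hb'.1] at hx
    exact hz x ⟨hx.1, hx.2.trans hb'.2⟩
  rcases le_total t 13 with h1 | h1
  · refine (bd 12 t).trans ?_
    rw [abs_of_nonneg (by linarith [ht.1])]
    nlinarith [ht.1]
  · rw [← intervalIntegral.integral_add_adjacent_intervals (hI 12 13) (hI 13 t)]
    have b1 := bd 12 13
    rw [show |(13:ℝ) - 12| = 1 by norm_num] at b1
    rcases le_total t τ with h2 | h2
    · rw [z t ⟨h1, h2⟩, add_zero]; linarith
    · rw [← intervalIntegral.integral_add_adjacent_intervals (hI 13 τ) (hI τ t), z τ ⟨hτ, le_rfl⟩, zero_add]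
      have b2 := bd τ t
      rw [abs_of_nonneg (show 0 ≤ t - τ by linarith)] at b2
      refine (abs_add_le _ _).trans ?_
      nlinarith [ht.2]

theorem fz_Z_fin (T : ℝ) : (zetaZerosUpTo T).Finite := by
  refine ((isCompact_Icc (a := (0:ℝ)) (b := 1)).reProdIm (isCompact_Icc (a := (0:ℝ)) (b := T))).inter_riemannZetaZeros_finite.subset ?_
  rintro ρ ⟨h0, h1, h2, h3, h4⟩
  exact ⟨⟨⟨h1.le, h2.le⟩, ⟨h3.le, h4⟩⟩, h0⟩

theorem fzSum_eq (k : ℝ → ℝ) (T : ℝ) : fzSum k T = ∑ ρ ∈ (fz_Z_fin T).toFinset, (zetaZeroMult ρ : ℝ) * k ρ.im :=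
  finsum_mem_eq_finite_toFinset_sum _ _

theorem fzSum_mono {k k' : ℝ → ℝ} {T : ℝ} (h : ∀ t ≤ T, k t ≤ k' t) : fzSum k T ≤ fzSum k' T := by
  rw [fzSum_eq, fzSum_eq]
  refine Finset.sum_le_sum fun ρ hρ => mul_le_mul_of_nonneg_left (h _ ?_) (Nat.cast_nonneg _)
  exact ((fz_Z_fin T).mem_toFinset.1 hρ).2.2.2.2

theorem fzSum_lin (a b : ℝ) (k k' : ℝ → ℝ) (T : ℝ) : fzSum (fun t => a * k t + b * k' t) T = a * fzSum k T + b * fzSum k' T := by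
  rw [fzSum_eq, fzSum_eq, fzSum_eq, Finset.mul_sum, Finset.mul_sum, ← Finset.sum_add_distrib]
  exact Finset.sum_congr rfl fun _ _ => by ring

theorem fzSum_trunc (k : ℝ → ℝ) {T T' : ℝ} (hT : T ≤ T') : fzSum (fun t => if t ≤ T then k t else 0) T' = fzSum k T := by
  unfold fzSum
  rw [finsum_mem_def, finsum_mem_def]
  congr 1
  ext ρ
  by_cases h : ρ ∈ zetaZerosUpTo T
  · have h' : ρ ∈ zetaZerosUpTo T' := ⟨h.1, h.2.1, h.2.2.1, h.2.2.2.1, h.2.2.2.2.trans hT⟩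
    rw [indicator_of_mem h, indicator_of_mem h']
    simp only [if_pos h.2.2.2.2]
  · rw [indicator_of_notMem h]
    by_cases h' : ρ ∈ zetaZerosUpTo T'
    · rw [indicator_of_mem h']
      have : ¬ ρ.im ≤ T := fun hh => h ⟨h'.1, h'.2.1, h'.2.2.1, h'.2.2.2.1, hh⟩
      simp only [if_neg this, mul_zero]
    · rw [indicator_of_notMem h']

theorem fz_lim_of {S : ℝ → ℝ} {G : ℝ} (h : ∀ ε > 0, ∃ C, ∀ᶠ T : ℝ in atTop, |S T - G * (T + 2)| ≤ ε * (T + 2) + C) :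
    Tendsto (fun T => T⁻¹ * S T) atTop (nhds G) := by
  rw [Metric.tendsto_nhds]
  intro ε hε
  obtain ⟨C, hC⟩ := h (ε / 2) (by positivity)
  filter_upwards [hC, eventually_gt_atTop (2 * (|C| + ε + 2 * |G|) / ε), eventually_gt_atTop 0] with T h1 h2 h3
  rw [Real.dist_eq, show T⁻¹ * S T - G = T⁻¹ * (S T - G * (T + 2) + 2 * G) by field_simp; ring, abs_mul, abs_of_pos (inv_pos.2 h3),
    inv_mul_lt_iff₀ h3]
  rw [div_lt_iff₀ hε] at h2
  refine (abs_add_le _ _).trans_lt ?_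
  rw [abs_mul, abs_of_pos (by norm_num : (0:ℝ) < 2)]
  nlinarith [le_abs_self C]

theorem fz_FZB_of {h : ℝ → ℝ} (hper : Function.Periodic h 1) (hC : ContDiff ℝ 2 h) : ∃ B h1 h2, FZB B h h1 h2 := by
  have hC1 : ContDiff ℝ 1 (deriv h) := ((contDiff_succ_iff_deriv (n := 1)).1 hC).2.2
  have hd0 : Differentiable ℝ h := hC.differentiable (by norm_num)
  have hd1 : Differentiable ℝ (deriv h) := hC1.differentiable (by norm_num)
  have hc2 : Continuous (deriv (deriv h)) := hC1.continuous_deriv le_rfl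
  have pd : ∀ f : ℝ → ℝ, Function.Periodic f 1 → Function.Periodic (deriv f) 1 := by
    intro f hf x
    rw [← deriv_comp_add_const]
    congr 1
    ext y; exact hf y
  obtain ⟨B0, _, b0⟩ := fz_per_bdd hd0.continuous one_pos hper
  obtain ⟨B1, _, b1⟩ := fz_per_bdd hd1.continuous one_pos (pd _ hper)
  obtain ⟨B2, _, b2⟩ := fz_per_bdd hc2 one_pos (pd _ (pd _ hper))
  refine ⟨max B0 (max B1 B2), deriv h, deriv (deriv h), fun x => (hd0 x).hasDerivAt, fun x => (hd1 x).hasDerivAt, hc2,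
    fun x => (b0 x).trans (le_max_left _ _), fun x => (b1 x).trans ((le_max_left _ _).trans (le_max_right _ _)),
    fun x => (b2 x).trans ((le_max_right _ _).trans (le_max_right _ _))⟩

theorem fz_arith {Sb Sk S0 S13 Ib Ik I0 H K D G τ E : ℝ} (hH0 : 0 ≤ H) (hK0 : 0 ≤ K) (hD0 : 0 ≤ D) (hDε : D * (4 * (H + 1)) = E)
    (A1 : |2 * π * Sk + 2 * Ik| ≤ D) (A2 : |2 * π * Sb + 2 * Ib| ≤ D) (bL2 : |Ib| ≤ 4 * K)
    (kL2 : |Ik - I0| ≤ 4 * (H * K) + 12 * (H * K)) (hmT : |I0 - -π * G * τ| ≤ D)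
    (up : Sk - S0 ≤ H * S13 + H * Sb) (lo : -(H * S13 + H * Sb) ≤ Sk - S0) :
    |S0 - G * τ| ≤ E + (H * S13 + (4 * (H * K) + 12 * (H * K)) + H * (4 * K)) := by
  have hpi : 3 < π := Real.pi_gt_three
  have hHK : 0 ≤ H * K := mul_nonneg hH0 hK0
  have hSb : Sb ≤ D + 4 * K := by
    have l1 := (abs_le.1 A2).2
    have l2 := (abs_le.1 bL2).1
    have l3 : 2 * π * Sb ≤ D + 8 * K := by linarith
    by_contra hcon
    push Not at hcon
    have : 6 * Sb ≤ 2 * π * Sb := mul_le_mul_of_nonneg_right (by linarith) (by linarith)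
    linarith
  have hSk : |Sk - G * τ| ≤ 2 * D + (4 * (H * K) + 12 * (H * K)) := by
    have q : |2 * π * (Sk - G * τ)| ≤ 3 * D + 2 * (4 * (H * K) + 12 * (H * K)) := by
      have e : 2 * π * (Sk - G * τ) = (2 * π * Sk + 2 * Ik) - 2 * (Ik - I0) - 2 * (I0 - -π * G * τ) := by ring
      rw [e]
      generalize Ik - I0 = x at *
      generalize I0 - -π * G * τ = y at *
      generalize 2 * π * Sk + 2 * Ik = z at *
      rw [abs_le] at *
      constructor <;> linarith [A1.1, A1.2, kL2.1, kL2.2, hmT.1, hmT.2]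
    rw [abs_mul, abs_of_pos (by positivity : 0 < 2 * π)] at q
    have : 6 * |Sk - G * τ| ≤ 2 * π * |Sk - G * τ| := mul_le_mul_of_nonneg_right (by linarith) (abs_nonneg _)
    linarith
  have hHS : H * Sb ≤ H * (D + 4 * K) := mul_le_mul_of_nonneg_left hSb hH0
  have hfin : 2 * D + H * D ≤ E := by nlinarith [mul_nonneg hH0 hD0]
  rw [abs_le] at hSk ⊢
  constructor <;> linarith [hSk.1, hSk.2]

set_option maxHeartbeats 1000000 in
theorem fz_real0 {α : ℝ} (hα : 0 < α) {h : ℝ → ℝ} (hper : Function.Periodic h 1) (hC : ContDiff ℝ 2 h) (h0 : ∫ u in (0:ℝ)..1, h u = 0)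
    {g : ℝ → ℝ} (hg : IsDensityOf α g) :
    Tendsto (fun T : ℝ => T⁻¹ * fzSum (fun t => h (α * t)) T) atTop (nhds (∫ u in (0:ℝ)..1, g u * h u)) := by
  obtain ⟨H, h1, h2, hH⟩ := fz_FZB_of hper hC
  have hc : Continuous h := hH.c0
  have hH0 := hH.nonneg
  obtain ⟨C, hcut⟩ := fz_cut
  have hC0 : 0 ≤ C := by obtain ⟨s, s1, s2, hs, -⟩ := hcut 0 0; exact hs.nonneg
  have hha : FZB (H * (1 + α^2)) (fun t => h (α * t)) (fun t => α * h1 (α * t)) (fun t => α^2 * h2 (α * t)) := by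
    have := hH.aff α 0
    simpa only [add_zero] using this
  have hperα : Function.Periodic (fun t => h (α * t)) α⁻¹ := fun t => by
    show h (α * (t + α⁻¹)) = h (α * t)
    rw [show α * (t + α⁻¹) = α * t + 1 by field_simp, hper]
  have hint0 : ∫ t in (0:ℝ)..α⁻¹, h (α * t) = 0 := by
    have cv := intervalIntegral.integral_comp_mul_left (a := 0) (b := α⁻¹) h hα.ne'
    rw [mul_zero, mul_inv_cancel₀ hα.ne', h0, smul_zero] at cv
    exact cv
  have hcα : Continuous (fun t => h (α * t)) := by fun_prop
  obtain ⟨P, hP0, hP⟩ := fz_prim hcα (inv_pos.2 hα) hperα hint0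
  simp only [Real.norm_eq_abs] at hP
  have hP12 : ∀ t, |∫ u in (12:ℝ)..t, h (α * u)| ≤ 2 * P := fun t => by
    have := intervalIntegral.integral_add_adjacent_intervals (hcα.intervalIntegrable (μ := volume) 0 12) (hcα.intervalIntegrable 12 t)
    have e : ∫ u in (12:ℝ)..t, h (α * u) = (∫ u in (0:ℝ)..t, h (α * u)) - ∫ u in (0:ℝ)..12, h (α * u) := by linarith
    rw [e]
    refine (abs_sub _ _).trans ?_
    linarith [hP t, hP 12]
  set B := max (max C (4 * 1)) (max (4 * (H * (1 + α^2) * C)) (2 * P + 4 * H)) with hB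
  set G := ∫ u in (0:ℝ)..1, g u * h u with hG
  obtain ⟨N1, hN1⟩ := fz_limit hc hper hα hg
  refine fz_lim_of fun ε hε => ?_
  set δ := ε / (4 * (H + 1)) with hδ
  have hδ0 : 0 < δ := by positivity
  obtain ⟨N0, hN0⟩ := fz_main B δ hδ0
  set N := max N0 N1 with hN
  obtain ⟨T0, hT0⟩ := hN0 N (le_max_left _ _)
  obtain ⟨m, hm, hmG⟩ := hN1 N (le_max_right _ _)
  obtain ⟨K, hK0, hK⟩ := fzL_bdd N
  have hLc := fzL_cont N
  have hLc' : Continuous fun t => (fzL N t).re := Complex.continuous_re.comp hLc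
  have hKr : ∀ t, |(fzL N t).re| ≤ K := fun t => (Complex.abs_re_le_norm _).trans (hK t)
  have hmean : ∀ᶠ T : ℝ in atTop, |(∫ t in (0:ℝ)..(T+2), h (α * t) * (fzL N t).re) - (-π * G) * (T + 2)| ≤ δ * (T + 2) := by
    have ht : Tendsto (fun T : ℝ => T + 2) atTop atTop := tendsto_atTop_add_const_right _ _ tendsto_id
    have := (Metric.tendsto_nhds.1 (hm.comp ht)) δ hδ0
    filter_upwards [this, eventually_gt_atTop 0] with T h1 h3
    have hT2 : 0 < T + 2 := by linarith
    rw [dist_eq_norm] at h1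
    simp only [Function.comp] at h1
    have h2 := (Complex.abs_re_le_norm _).trans h1.le
    rw [Complex.sub_re, Complex.re_ofReal_mul, hmG] at h2
    have hci : Continuous (fun t : ℝ => (h (α * t) : ℂ) * fzL N t) := by fun_prop
    have hre := Complex.reCLM.intervalIntegral_comp_comm (hci.intervalIntegrable (μ := volume) 0 (T+2))
    simp only [Complex.reCLM_apply, Complex.re_ofReal_mul] at hre
    have hre2 : (∫ t in (0:ℝ)..(T+2), (h (α * t) : ℂ) * (deriv (fzM N) ((1/2:ℝ) + t * I) / fzM N ((1/2:ℝ) + t * I))).re = ∫ t in (0:ℝ)..(T+2), h (α * t) * (fzL N t).re := hre.symm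
    rw [hre2] at h2
    have e : (∫ t in (0:ℝ)..(T+2), h (α * t) * (fzL N t).re) - (-π * G) * (T + 2) = (T + 2) * ((T+2)⁻¹ * (∫ t in (0:ℝ)..(T+2), h (α * t) * (fzL N t).re) - (-π * G)) := by
      field_simp
    rw [e, abs_mul, abs_of_pos hT2, mul_comm]
    exact mul_le_mul_of_nonneg_right h2 hT2.le
  refine ⟨H * fzSum (fun _ => 1) 13 + (4 * (H * K) + 12 * (H * K)) + H * (4 * K), ?_⟩
  filter_upwards [hmean, eventually_ge_atTop T0, eventually_ge_atTop 14] with T hmT hTT hT14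
  obtain ⟨s, s1, s2, hs, sL, sR, sM, s01⟩ := hcut 12 (T+1)
  obtain ⟨b, b1, b2, hb, bL, bR, bM, b01⟩ := hcut (T-1) (T+2)
  -- smooth sum
  have hdiff : ∀ t, |h (α * t) * s t - h (α * t)| ≤ H := fun t => by
    rw [show h (α * t) * s t - h (α * t) = h (α * t) * (s t - 1) by ring, abs_mul]
    have := hH.b0 (α * t)
    have h2 : |s t - 1| ≤ 1 := by rw [abs_le]; constructor <;> linarith [(s01 t).1, (s01 t).2]
    calc _ ≤ H * 1 := mul_le_mul this h2 (abs_nonneg _) hH0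
      _ = H := mul_one _
  have hdz : ∀ x ∈ Icc 13 T, h (α * x) * s x - h (α * x) = 0 := fun x hx => by
    rw [sM x ⟨by linarith [hx.1], by linarith [hx.2]⟩]; ring
  have hsc := hs.c0
  have hbc := hb.c0
  have kprim : ∀ t ∈ Icc 12 (T+2), |∫ u in (12:ℝ)..t, h (α * u) * s u| ≤ B := by
    intro t ht
    have e : ∫ u in (12:ℝ)..t, h (α * u) * s u = (∫ u in (12:ℝ)..t, h (α * u)) + ∫ u in (12:ℝ)..t, (h (α * u) * s u - h (α * u)) := by
      rw [← intervalIntegral.integral_add (hcα.intervalIntegrable _ _) (Continuous.intervalIntegrable (by fun_prop) _ _)]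
      congr 1; ext u; ring
    rw [e]
    have g1 := fz_gap (f := fun u => h (α * u) * s u - h (α * u)) (by fun_prop) hdiff hdz (by linarith) (t := t) ⟨ht.1, by linarith [ht.2]⟩
    refine (abs_add_le _ _).trans (le_trans ?_ ((le_max_right _ _).trans (le_max_right _ _)))
    linarith [hP12 t]
  have A1 := hT0 (T+2) (by linarith) _ _ _ ((hha.mul hs).mono (B' := B) ((le_max_left _ _).trans (le_max_right _ _)))
    (fun t ht => by simp [(sL t ht).1, (sL t ht).2]) (by simp [(sR (T+2) (by linarith)).1])
    (by simp [(sR (T+2) (by linarith)).1, (sR (T+2) (by linarith)).2]) kprim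
  have A2 := hT0 (T+2) (by linarith) _ _ _ (hb.mono (B' := B) ((le_max_left _ _).trans (le_max_left _ _)))
    (fun t ht => bL t (by linarith)) (bR (T+2) le_rfl).1 (bR (T+2) le_rfl).2 (fun t ht => by
      refine le_trans (fz_gap hbc (c := 1) (τ := T - 1) (fun x => ?_) (fun x hx => (bL x hx.2).1) (by linarith) ⟨ht.1, by linarith [ht.2]⟩) ((le_max_right _ _).trans (le_max_left _ _))
      rw [abs_of_nonneg (b01 x).1]; exact (b01 x).2)
  have A1' : |2 * π * fzSum (fun t => h (α * t) * s t) (T+2) + 2 * ∫ t in (12:ℝ)..(T+2), h (α * t) * s t * (fzL N t).re| ≤ δ * (T + 2) := A1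
  have A2' : |2 * π * fzSum b (T+2) + 2 * ∫ t in (12:ℝ)..(T+2), b t * (fzL N t).re| ≤ δ * (T + 2) := A2
  have bL2 : |∫ t in (12:ℝ)..(T+2), b t * (fzL N t).re| ≤ 4 * K := by
    refine fz_gap (f := fun t => b t * (fzL N t).re) (by fun_prop) (τ := T - 1) (fun x => ?_) (fun x hx => by rw [(bL x hx.2).1, zero_mul]) (by linarith) ⟨by linarith, by linarith⟩
    rw [abs_mul, abs_of_nonneg (b01 x).1]
    calc _ ≤ 1 * K := mul_le_mul (b01 x).2 (hKr x) (abs_nonneg _) zero_le_one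
      _ = K := one_mul _
  have kL2 : |(∫ t in (12:ℝ)..(T+2), h (α * t) * s t * (fzL N t).re) - ∫ t in (0:ℝ)..(T+2), h (α * t) * (fzL N t).re| ≤ 4 * (H * K) + 12 * (H * K) := by
    have ci : Continuous (fun t => h (α * t) * (fzL N t).re) := by fun_prop
    have e : (∫ t in (12:ℝ)..(T+2), h (α * t) * s t * (fzL N t).re) - ∫ t in (0:ℝ)..(T+2), h (α * t) * (fzL N t).re
       = (∫ t in (12:ℝ)..(T+2), (h (α * t) * s t - h (α * t)) * (fzL N t).re) - ∫ t in (0:ℝ)..12, h (α * t) * (fzL N t).re := by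
      rw [← intervalIntegral.integral_add_adjacent_intervals (ci.intervalIntegrable 0 12) (ci.intervalIntegrable 12 (T+2))]
      have : ∫ t in (12:ℝ)..(T+2), (h (α * t) * s t - h (α * t)) * (fzL N t).re = (∫ t in (12:ℝ)..(T+2), h (α * t) * s t * (fzL N t).re) - ∫ t in (12:ℝ)..(T+2), h (α * t) * (fzL N t).re := by
        rw [← intervalIntegral.integral_sub (Continuous.intervalIntegrable (by fun_prop) _ _) (ci.intervalIntegrable _ _)]
        congr 1; ext u; ring
      rw [this]; ring
    rw [e]
    refine (abs_sub _ _).trans (add_le_add ?_ ?_)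
    · refine fz_gap (f := fun t => (h (α * t) * s t - h (α * t)) * (fzL N t).re) (by fun_prop) (τ := T) (fun x => ?_) (fun x hx => by rw [hdz x hx, zero_mul]) (by linarith) ⟨by linarith, by linarith⟩
      rw [abs_mul]
      exact mul_le_mul (hdiff x) (hKr x) (abs_nonneg _) hH0
    · have := intervalIntegral.norm_integral_le_of_norm_le_const (f := fun t => h (α * t) * (fzL N t).re) (a := 0) (b := 12) (C := H * K) (fun x _ => by
        rw [Real.norm_eq_abs, abs_mul]; exact mul_le_mul (hH.b0 _) (hKr x) (abs_nonneg _) hH0)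
      rw [Real.norm_eq_abs, show |(12:ℝ) - 0| = 12 by norm_num] at this
      linarith
  -- comparison of sharp and smooth sums
  have hcmp : ∀ t ≤ T + 2, |h (α * t) * s t - (if t ≤ T then h (α * t) else 0)| ≤ H * ((if t ≤ 13 then 1 else 0) + b t) := by
    intro t ht
    have hbt := (b01 t).1
    by_cases h13 : t ≤ 13
    · rw [if_pos h13, if_pos (by linarith)]
      refine (hdiff t).trans ?_
      nlinarith
    · rw [if_neg h13, zero_add]
      push Not at h13
      by_cases hTt : t ≤ T
      · rw [if_pos hTt, hdz t ⟨h13.le, hTt⟩, abs_zero]; positivity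
      · rw [if_neg hTt, sub_zero]
        push Not at hTt
        by_cases hT1 : t ≤ T + 1
        · rw [bM t ⟨by linarith, by linarith⟩, mul_one, abs_mul, abs_of_nonneg (s01 t).1]
          calc _ ≤ H * 1 := mul_le_mul (hH.b0 _) (s01 t).2 (s01 t).1 hH0
            _ = H := mul_one _
        · rw [(sR t (by linarith)).1, mul_zero, abs_zero]; positivity
  have up := fzSum_mono (T := T + 2) (fun t ht => (abs_le.1 (hcmp t ht)).2)
  have lo := fzSum_mono (T := T + 2) (fun t ht => (abs_le.1 (hcmp t ht)).1)
  have eD : fzSum (fun t => h (α * t) * s t - (if t ≤ T then h (α * t) else 0)) (T+2) = fzSum (fun t => h (α * t) * s t) (T+2) - fzSum (fun t => h (α * t)) T := by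
    have := fzSum_lin 1 (-1) (fun t => h (α * t) * s t) (fun t => if t ≤ T then h (α * t) else 0) (T+2)
    rw [fzSum_trunc (fun t => h (α * t)) (by linarith : T ≤ T + 2)] at this
    simp only [one_mul, neg_mul] at this
    exact this
  have eU : fzSum (fun t => H * ((if t ≤ 13 then 1 else 0) + b t)) (T+2) = H * fzSum (fun _ => 1) 13 + H * fzSum b (T+2) := by
    have := fzSum_lin H H (fun t => if t ≤ 13 then (1:ℝ) else 0) b (T+2)
    rw [fzSum_trunc (fun _ => (1:ℝ)) (by linarith : 13 ≤ T + 2)] at this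
    rw [← this]
    simp only [mul_add]
  have eLo : fzSum (fun t => -(H * ((if t ≤ 13 then 1 else 0) + b t))) (T+2) = - fzSum (fun t => H * ((if t ≤ 13 then 1 else 0) + b t)) (T+2) := by
    have := fzSum_lin (-1) 0 (fun t => H * ((if t ≤ 13 then 1 else 0) + b t)) (fun _ => 0) (T+2)
    simpa using this
  rw [eD, eU] at up
  rw [eD, eLo, eU] at lo
  exact fz_arith hH0 hK0 (by positivity) (by rw [hδ]; field_simp) A1' A2' bL2 kL2 hmT up lo

theorem fzm_one {α l : ℝ} (hα : 0 < α) (hl : 0 < l) : fzm (fun _ => 1) α l = 0 := by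
  unfold fzm
  split_ifs with hw
  · have hne : (-(l / α : ℝ) * I : ℂ) ≠ 0 := by
      have : (l / α : ℝ) ≠ 0 := by positivity
      have : ((l / α : ℝ) : ℂ) ≠ 0 := by exact_mod_cast this
      exact mul_ne_zero (neg_ne_zero.2 this) I_ne_zero
    have e := integral_exp_mul_complex (a := 0) (b := 1) hne
    simp only [Complex.ofReal_one, mul_one, Complex.ofReal_zero, mul_zero, Complex.exp_zero, hw, sub_self, zero_div] at e
    rw [← e]
    congr 1; ext u
    rw [Complex.ofReal_one, one_mul]
    congr 1; push_cast; ring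
  · rfl

theorem fzL_mean (N : ℕ) : fzMean (fun t => deriv (fzM N) ((1/2:ℝ) + t * I) / fzM N ((1/2:ℝ) + t * I)) 0 := by
  simp only [fzM_logDeriv]
  have := fzMean.finset_sum (N.factorial).primeFactors (F := fun p t => fzEu p t) (m := fun _ => 0)
    (fun p hp => fzEu_cont (Nat.prime_of_mem_primeFactors hp)) (fun p hp => ?_)
  · simpa using this
  · have hp' := Nat.prime_of_mem_primeFactors hp
    have hlp : 0 < Real.log p := Real.log_pos (by exact_mod_cast hp'.one_lt)
    have := fz_prime_mean (h := fun _ => 1) continuous_const (fun _ => rfl) one_pos hp'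
    have hz : ∀ j : ℕ, fzm (fun _ => 1) 1 ((j+1 : ℕ) * Real.log p) = 0 := fun j => fzm_one one_pos (by positivity)
    simp only [hz, mul_zero, tsum_zero, Complex.ofReal_one, one_mul] at this
    exact this

theorem fz_shift {h : ℝ → ℝ} (hc : Continuous h) (hper : Function.Periodic h 1) {α : ℝ} (hα : 0 < α) {g : ℝ → ℝ} (hg : IsDensityOf α g) (c : ℝ) :
    ∫ u in (0:ℝ)..1, g u * (h u - c) = ∫ u in (0:ℝ)..1, g u * h u := by
  obtain ⟨N1, h1⟩ := fz_limit hc hper hα hg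
  obtain ⟨N2, h2⟩ := fz_limit (h := fun u => h u - c) (by fun_prop) (fun u => by simp only [hper u]) hα hg
  obtain ⟨m1, hm1, e1⟩ := h1 (max N1 N2) (le_max_left _ _)
  obtain ⟨m2, hm2, e2⟩ := h2 (max N1 N2) (le_max_right _ _)
  have h0 := (fzL_mean (max N1 N2)).const_mul (c:ℂ)
  have hLc := fzL_cont (max N1 N2)
  have : m2 = m1 - (c:ℂ) * 0 := by
    refine tendsto_nhds_unique hm2 ((Tendsto.sub hm1 h0).congr fun T => ?_)
    rw [← mul_sub, ← intervalIntegral.integral_sub]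
    · congr 2; ext t; push_cast; ring
    · exact Continuous.intervalIntegrable ((by fun_prop : Continuous fun t : ℝ => (h (α * t) : ℂ)).mul hLc) _ _
    · exact Continuous.intervalIntegrable (continuous_const.mul hLc) _ _
  rw [mul_zero, sub_zero] at this
  rw [this, e1] at e2
  exact (mul_left_cancel₀ (neg_ne_zero.2 Real.pi_pos.ne') e2).symm

theorem fz_zetaN (T : ℝ) : (zetaN T : ℝ) = fzSum (fun _ => 1) T := by
  rw [fzSum_eq]
  unfold zetaN
  rw [finsum_mem_eq_finite_toFinset_sum _ (fz_Z_fin T)]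
  push_cast
  simp

theorem fz_real {α : ℝ} (hα : 0 < α) {h : ℝ → ℝ} (hper : Function.Periodic h 1) (hC : ContDiff ℝ 2 h)
    {g : ℝ → ℝ} (hg : IsDensityOf α g) :
    Tendsto (fun T : ℝ => T⁻¹ * fzSum (fun t => h (α * t)) T - zetaN T * T⁻¹ * ∫ u in (0:ℝ)..1, h u) atTop (nhds (∫ u in (0:ℝ)..1, g u * h u)) := by
  have hc := hC.continuous
  set c := ∫ u in (0:ℝ)..1, h u with hcd
  have := fz_real0 hα (h := fun u => h u - c) (fun u => by simp only [hper u]) (hC.sub contDiff_const) (by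
    rw [intervalIntegral.integral_sub (hc.intervalIntegrable _ _) (by simp)]
    simp [hcd]) hg
  rw [fz_shift hc hper hα hg] at this
  refine this.congr fun T => ?_
  have e := fzSum_lin 1 (-c) (fun t => h (α * t)) (fun _ => 1) T
  have e2 : (fun t => h (α * t) - c) = fun t => 1 * h (α * t) + -c * 1 := by ext t; ring
  rw [e2, e, fz_zetaN]
  ring

theorem fz_g_cont {α : ℝ} {g : ℝ → ℝ} (hg : IsDensityOf α g) : Continuous g := by
  by_cases hsp : ∃ p a q : ℕ, IsSpecialForm α p a q
  · obtain ⟨p, a, q, hs⟩ := hsp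
    rw [hg.1 p a q hs]
    unfold gPAQ
    refine Continuous.div (by fun_prop) (by fun_prop) fun u => ?_
    have hp1 : (1:ℝ) < p := by exact_mod_cast hs.1.one_lt
    have hpp : (0:ℝ) < p := by linarith
    have ha0 : (0:ℝ) < a := by exact_mod_cast hs.2.1
    have hR2 : (p:ℝ)^(a:ℝ) = ((p:ℝ)^((a:ℝ)/2))^2 := by
      rw [← Real.rpow_natCast, ← Real.rpow_mul hpp.le]; congr 1; push_cast; ring
    have hR : 1 < (p:ℝ)^((a:ℝ)/2) := Real.one_lt_rpow hp1 (by positivity)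
    rw [hR2]
    have hcos := Real.cos_le_one (2 * π * q * u)
    refine mul_ne_zero Real.pi_pos.ne' (ne_of_gt ?_)
    nlinarith
  · rw [hg.2 hsp]; exact continuous_const

theorem fz_zsum {h : ℝ → ℂ} (α T : ℝ) : zetaZeroSum α h T = (fzSum (fun t => (h (α * t)).re) T : ℂ) + (fzSum (fun t => (h (α * t)).im) T : ℂ) * I := by
  unfold zetaZeroSum
  rw [finsum_mem_eq_finite_toFinset_sum _ (fz_Z_fin T), fzSum_eq, fzSum_eq]
  push_cast
  rw [Finset.sum_mul, ← Finset.sum_add_distrib]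
  refine Finset.sum_congr rfl fun ρ _ => ?_
  conv_lhs => rw [← Complex.re_add_im (h (α * ρ.im))]
  ring

theorem fz_int_reim {f : ℝ → ℂ} (hf : Continuous f) : ∫ u in (0:ℝ)..1, f u = ((∫ u in (0:ℝ)..1, (f u).re : ℝ) : ℂ) + ((∫ u in (0:ℝ)..1, (f u).im : ℝ) : ℂ) * I := by
  have h1 := Complex.reCLM.intervalIntegral_comp_comm (hf.intervalIntegrable (μ := volume) 0 1)
  have h2 := Complex.imCLM.intervalIntegral_comp_comm (hf.intervalIntegrable (μ := volume) 0 1)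
  simp only [Complex.reCLM_apply, Complex.imCLM_apply] at h1 h2
  rw [h1, h2, Complex.re_add_im]

theorem fz_final (α : ℝ) (hα : 0 < α) (h : ℝ → ℂ) (hper : Function.Periodic h 1) (hC2 : ContDiff ℝ 2 h) (g : ℝ → ℝ) (hg : IsDensityOf α g) :
    Tendsto (fun T : ℝ => (1 / (T:ℂ)) * zetaZeroSum α h T - ((zetaN T : ℂ) / (T:ℂ)) * ∫ u in (0:ℝ)..1, h u) atTop
      (nhds (∫ u in (0:ℝ)..1, (g u : ℂ) * h u)) := by
  have hc := hC2.continuous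
  have hgc := fz_g_cont hg
  have r1 := fz_real hα (h := fun u => (h u).re) (fun u => by simp only [hper u]) (Complex.reCLM.contDiff.comp hC2) hg
  have r2 := fz_real hα (h := fun u => (h u).im) (fun u => by simp only [hper u]) (Complex.imCLM.contDiff.comp hC2) hg
  have c1 := (Complex.continuous_ofReal.tendsto _).comp r1
  have c2 := ((Complex.continuous_ofReal.tendsto _).comp r2).mul_const I
  have := c1.add c2
  rw [fz_int_reim (f := fun u => (g u : ℂ) * h u) (by fun_prop)]
  simp only [Complex.re_ofReal_mul, Complex.im_ofReal_mul]
  refine this.congr fun T => ?_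
  simp only [Function.comp]
  rw [fz_zsum, fz_int_reim hc]
  push_cast
  ring

/-- Corollary 2 of Ford–Zaharescu. -/
theorem ford_zaharescu_cor2 (α : ℝ) (hα : 0 < α) (h : ℝ → ℂ)
    (hper : Function.Periodic h 1) (hC2 : ContDiff ℝ 2 h)
    (g : ℝ → ℝ) (hg : IsDensityOf α g) :
    Filter.Tendsto (fun T : ℝ =>
        (1 / (T : ℂ)) * zetaZeroSum α h T - ((zetaN T : ℂ) / (T : ℂ)) * ∫ u in (0:ℝ)..1, h u)
      Filter.atTop (nhds (∫ u in (0:ℝ)..1, (g u : ℂ) * h u)) := by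
  exact fz_final α hα h hper hC2 g hg
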